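/- arXiv:1603.05430 — 2 statements merged into one kernel-verified Lean document; each statement's English description precedes it below -/
import Mathlib

section
/- p(4,4) = 5: every form of degree 4 in ℝ[x_1,x_2,x_3,x_4] that is a sum of squares of quadratic forms is a sum of five squares of quadratic forms, and there exists such a form that is not a sum of four squares of quadratic forms. -/
open MvPolynomial

noncomputable section

/-- `f` is a sum of `r` squares of forms of degree `d` in `n` variables. -/
def IsSOS (n d r : ℕ) (f : MvPolynomial (Fin n) ℝ) : Prop :=
  ∃ p : Fin r → MvPolynomial (Fin n) ℝ,
    (∀ i, (p i).IsHomogeneous d) ∧ f = ∑ i, p i ^ 2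

/-- `f` lies in `Σ_{n,2d}`: it is a sum of squares of forms of degree `d`. -/
def InSigma (n d : ℕ) (f : MvPolynomial (Fin n) ℝ) : Prop :=
  ∃ r, IsSOS n d r f

/-- The sum of squares length `ℓ(f)`. -/
def sosLength (n d : ℕ) (f : MvPolynomial (Fin n) ℝ) : ℕ :=
  sInf {r | IsSOS n d r f}



/-- multiplication by `x` is injective modulo `J` -/
def NZD {R : Type*} [CommRing R] (J : Ideal R) (x : R) : Prop := ∀ a, x * a ∈ J → a ∈ J

lemma mem_sup_single {R : Type*} [CommRing R] (J : Ideal R) (y a : R) :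
    a ∈ J ⊔ Ideal.span {y} ↔ ∃ b, a - y * b ∈ J := by
  constructor
  · intro h
    obtain ⟨j, hj, z, hz, rfl⟩ := Submodule.mem_sup.1 h
    obtain ⟨b, rfl⟩ := Ideal.mem_span_singleton'.1 hz
    exact ⟨b, by convert hj using 1; ring⟩
  · rintro ⟨b, hb⟩
    refine Submodule.mem_sup.2 ⟨_, hb, y * b, ?_, by ring⟩
    exact Ideal.mul_mem_right _ _ (Ideal.mem_span_singleton_self y)

lemma NZD.swap {R : Type*} [CommRing R] {J : Ideal R} {x y : R} (hx : NZD J x)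
    (hy : NZD (J ⊔ Ideal.span {x}) y) : NZD (J ⊔ Ideal.span {y}) x := by
  intro a ha
  obtain ⟨b, hb⟩ := (mem_sup_single _ _ _).1 ha
  have h1 : b ∈ J ⊔ Ideal.span {x} := by
    apply hy
    rw [mem_sup_single]
    refine ⟨a, ?_⟩
    have := J.neg_mem hb
    convert this using 1; ring
  obtain ⟨c, hc⟩ := (mem_sup_single _ _ _).1 h1
  rw [mem_sup_single]
  refine ⟨c, hx _ ?_⟩
  have := J.add_mem hb (J.mul_mem_left y hc)
  convert this using 1; ring

/-- exchange of socle elements -/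
lemma socle_exchange {R : Type*} [CommRing R] {J : Ideal R} {x y : R} (hx : NZD J x)
    {s s' t w : R} (h : y * s - x * s' ∈ J) (hw : t * s - x * w ∈ J) :
    t * s' - y * w ∈ J := by
  apply hx
  have := J.sub_mem (J.mul_mem_left y hw) (J.mul_mem_left t h)
  convert this using 1; ring

abbrev S4 := MvPolynomial (Fin 4) ℝ

/-- the mixed ideals -/
def JJ (L : List S4) (B : Finset (Fin 4)) : Ideal S4 :=
  Ideal.ofList L ⊔ Ideal.span (X '' (B : Set (Fin 4)))

lemma JJ_cons (q : S4) (L : List S4) (B : Finset (Fin 4)) :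
    JJ (q :: L) B = JJ L B ⊔ Ideal.span {q} := by
  unfold JJ
  rw [Ideal.ofList_cons, sup_comm (Ideal.span {q}), sup_assoc, sup_assoc,
    sup_comm (Ideal.span {q})]

lemma JJ_insert (j : Fin 4) (L : List S4) (B : Finset (Fin 4)) :
    JJ L (insert j B) = JJ L B ⊔ Ideal.span {X j} := by
  unfold JJ
  rw [Finset.coe_insert, Set.image_insert_eq, Ideal.span_insert, sup_comm (Ideal.span {X j}),
    sup_assoc]

def GoodL (V : Submodule ℝ S4) : List S4 → Prop
  | [] => True
  | (q :: L) => GoodL V L ∧ q ∈ V ∧ ∀ B : Finset (Fin 4), L.length + B.card ≤ 3 → NZD (JJ L B) q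

lemma GoodL.nzd_X {V : Submodule ℝ S4} : ∀ {L : List S4}, GoodL V L → ∀ (B : Finset (Fin 4)) (j : Fin 4),
    j ∉ B → L.length + B.card ≤ 3 → NZD (JJ L B) (X j)
  | [], _, B, j, hj, _ => by
    intro a ha
    simp only [JJ, Ideal.ofList_nil, bot_sup_eq] at ha ⊢
    rw [mem_ideal_span_X_image] at ha ⊢
    intro m hm
    have := ha (Finsupp.single j 1 + m) (by
      rw [mem_support_iff] at hm ⊢
      rwa [add_comm, mul_comm, coeff_mul_X])
    obtain ⟨i, hi, hne⟩ := this
    refine ⟨i, hi, ?_⟩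
    have hij : j ≠ i := by rintro rfl; exact hj hi
    simpa [Finsupp.single_apply, hij] using hne
  | (q :: L), h, B, j, hj, hc => by
    rw [JJ_cons]
    simp only [List.length_cons] at hc
    apply NZD.swap (h.1.nzd_X B j hj (by omega))
    rw [← JJ_insert]
    exact h.2.2 _ (by rw [Finset.card_insert_of_notMem hj]; omega)

lemma exists_nzd (V : Submodule ℝ S4)
    (hV : ∀ P : Ideal S4, P.IsPrime → (∀ q ∈ V, q ∈ P) → ∀ i, X i ∈ P)
    (F : Set (Ideal S4)) (hF : F.Finite) (hs : ∀ J ∈ F, ∃ j, NZD J (X j)) :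
    ∃ q ∈ V, ∀ J ∈ F, NZD J q := by
  classical
  have hfin : (⋃ J ∈ F, associatedPrimes S4 (S4 ⧸ J)).Finite :=
    hF.biUnion fun J _ => associatedPrimes.finite S4 (S4 ⧸ J)
  set A := ⋃ J ∈ F, associatedPrimes S4 (S4 ⧸ J) with hA
  let sub : Ideal S4 → Submodule ℝ V := fun P => (P.restrictScalars ℝ).comap V.subtype
  have hne : ∀ P ∈ A, sub P ≠ ⊤ := by
    intro P hP htop
    simp only [hA, Set.mem_iUnion] at hP
    obtain ⟨J, hJ, hPJ⟩ := hP
    obtain ⟨j, hj⟩ := hs J hJ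
    have hX := hV P hPJ.isPrime (by
      intro q hq
      have : (⟨q, hq⟩ : V) ∈ sub P := by rw [htop]; trivial
      exact this)
    obtain ⟨hp, u, hu⟩ := isAssociatedPrime_iff.1 hPJ
    obtain ⟨u, rfl⟩ := Ideal.Quotient.mk_surjective u
    have hmem : ∀ a : S4, a ∈ P ↔ a * u ∈ J := by
      intro a
      rw [hu]
      simp only [Submodule.mem_colon_singleton, Submodule.mem_bot]
      rw [← Ideal.Quotient.mk_eq_mk, ← Submodule.Quotient.mk_smul, Submodule.Quotient.mk_eq_zero]
      rfl
    have h1 := hj u ((hmem _).1 (hX j))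
    apply hp.ne_top
    rw [Ideal.eq_top_iff_one, hmem]
    simpa using h1
  have := Subspace.biUnion_ne_univ_of_top_notMem (k := ℝ) (s := (hfin.image sub).toFinset) (by
    simp only [Set.Finite.mem_toFinset, Set.mem_image, not_exists, not_and]
    exact fun P hP => hne P hP)
  rw [Set.ne_univ_iff_exists_notMem] at this
  obtain ⟨⟨q, hq⟩, hq2⟩ := this
  refine ⟨q, hq, ?_⟩
  simp only [Set.Finite.mem_toFinset, Set.mem_iUnion, not_exists, SetLike.mem_coe, Set.mem_image] at hq2
  intro J hJ a ha
  by_contra hna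
  have hz : q ∈ ⋃ p ∈ associatedPrimes S4 (S4 ⧸ J), (p : Set S4) := by
    rw [biUnion_associatedPrimes_eq_zero_divisors]
    refine ⟨Ideal.Quotient.mk J a, ?_, ?_⟩
    · rwa [Ne, Ideal.Quotient.eq_zero_iff_mem]
    · rw [← Ideal.Quotient.mk_eq_mk, ← Submodule.Quotient.mk_smul, Submodule.Quotient.mk_eq_zero]
      exact ha
  simp only [Set.mem_iUnion] at hz
  obtain ⟨P, hP, hqP⟩ := hz
  refine hq2 (sub P) ⟨P, ?_, rfl⟩ hqP
  simp only [hA, Set.mem_iUnion]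
  exact ⟨J, hJ, hP⟩

lemma exists_goodL (V : Submodule ℝ S4)
    (hV : ∀ P : Ideal S4, P.IsPrime → (∀ q ∈ V, q ∈ P) → ∀ i, X i ∈ P) (k : ℕ) (hk : k ≤ 4) :
    ∃ L, GoodL V L ∧ L.length = k := by
  induction k with
  | zero => exact ⟨[], trivial, rfl⟩
  | succ k ih =>
    obtain ⟨L, hL, hl⟩ := ih (by omega)
    obtain ⟨q, hq, hq2⟩ := exists_nzd V hV (JJ L '' {B | L.length + B.card ≤ 3})
      (Set.toFinite _) (by
        rintro _ ⟨B, hB, rfl⟩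
        have hB' : L.length + B.card ≤ 3 := hB
        have : ∃ j, j ∉ B := by
          by_contra hcon
          push Not at hcon
          have : B = Finset.univ := Finset.eq_univ_iff_forall.2 hcon
          rw [this] at hB'; simp at hB'
        obtain ⟨j, hj⟩ := this
        exact ⟨j, hL.nzd_X B j hj hB'⟩)
    exact ⟨q :: L, ⟨hL, hq, fun B hB => hq2 _ ⟨B, hB, rfl⟩⟩, by simp [hl]⟩



attribute [local instance] MvPolynomial.gradedAlgebra

lemma JJ_homog (L : List S4) (hL : ∀ q ∈ L, q.IsHomogeneous 2) (B : Finset (Fin 4)) :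
    (JJ L B).IsHomogeneous (homogeneousSubmodule (Fin 4) ℝ) := by
  unfold JJ
  apply Ideal.IsHomogeneous.sup
  · apply Ideal.homogeneous_span
    intro q hq
    exact ⟨2, hL q hq⟩
  · apply Ideal.homogeneous_span
    rintro _ ⟨i, _, rfl⟩
    exact ⟨1, isHomogeneous_X _ _⟩

/-- component extraction for products -/
lemma homogComp_mul {q : S4} {d : ℕ} (hq : q.IsHomogeneous d) (a : S4) (n : ℕ) :
    homogeneousComponent (n + d) (q * a) = q * homogeneousComponent n a := by
  conv_lhs => rw [← sum_homogeneousComponent a, Finset.mul_sum, map_sum]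
  have h1 : ∀ i, homogeneousComponent (n + d) (q * homogeneousComponent i a) =
      if i = n then q * homogeneousComponent i a else 0 := by
    intro i
    rw [homogeneousComponent_of_mem ((mem_homogeneousSubmodule _ _).2
      (hq.mul (homogeneousComponent_isHomogeneous i a)))]
    congr 1
    simp only [eq_iff_iff]; omega
  simp only [h1, Finset.sum_ite_eq', Finset.mem_range]
  split_ifs with h
  · rfl
  · rw [homogeneousComponent_eq_zero _ _ (by omega), mul_zero]

lemma GoodL.subset {V : Submodule ℝ S4} : ∀ {L : List S4}, GoodL V L → ∀ q ∈ L, q ∈ V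
  | [], _, q, hq => by simp at hq
  | (p :: L), h, q, hq => by
    rcases List.mem_cons.1 hq with rfl | hq
    · exact h.2.1
    · exact h.1.subset q hq

lemma GoodL.socle {V : Submodule ℝ S4} (hV2 : ∀ q ∈ V, q.IsHomogeneous 2) :
    ∀ {L : List S4}, GoodL V L → ∀ (B : Finset (Fin 4)), L.length + B.card = 4 →
    ∃ s : S4, s.IsHomogeneous L.length ∧ (∀ i, X i * s ∈ JJ L B) ∧
      ∀ u, (∀ i, X i * u ∈ JJ L B) → ∃ c : ℝ, u - C c * s ∈ JJ L B
  | [], _, B, hB => by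
    have hB' : B = Finset.univ := by
      rw [← Finset.card_eq_iff_eq_univ]; simpa using hB
    subst hB'
    refine ⟨1, isHomogeneous_one _ _, ?_, ?_⟩
    · intro i
      simp only [JJ, Ideal.ofList_nil, bot_sup_eq, mul_one]
      exact Ideal.subset_span ⟨i, by simp, rfl⟩
    · intro u _
      refine ⟨coeff 0 u, ?_⟩
      simp only [JJ, Ideal.ofList_nil, bot_sup_eq, mul_one]
      rw [mem_ideal_span_X_image]
      intro m hm
      by_contra hcon
      push Not at hcon
      have : m = 0 := by ext i; simpa using hcon i (by simp)
      subst this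
      simp at hm
  | (q :: L), h, B, hB => by
    simp only [List.length_cons] at hB
    have : ∃ j, j ∉ B := by
      by_contra hcon
      push Not at hcon
      have : B = Finset.univ := Finset.eq_univ_iff_forall.2 hcon
      rw [this] at hB; simp at hB
    obtain ⟨j, hj⟩ := this
    obtain ⟨s, hs, hs1, hs2⟩ := GoodL.socle hV2 h.1 (insert j B)
      (by rw [Finset.card_insert_of_notMem hj]; omega)
    have hq2 := hV2 q h.2.1
    have hx : NZD (JJ L B) (X j) := h.1.nzd_X B j hj (by omega)
    have hqn : NZD (JJ L B) q := h.2.2 B (by omega)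
    have hhom := JJ_homog L (fun p hp => hV2 p (h.1.subset p hp)) B
    rw [JJ_insert] at hs1 hs2
    rw [JJ_cons]
    -- find s'
    have hqs : q * s ∈ JJ L B ⊔ Ideal.span {X j} := by
      -- q lies in the ideal of the variables
      have hqm : q ∈ Ideal.span (X '' (Set.univ : Set (Fin 4))) := by
        rw [mem_ideal_span_X_image]
        intro m hm
        by_contra hcon
        push Not at hcon
        have : m = 0 := by ext i; simpa using hcon i (by simp)
        subst this
        have := hq2.coeff_eq_zero (d := 0) (by simp)
        rw [mem_support_iff] at hm
        exact hm this
      refine Submodule.span_induction (p := fun q _ => q * s ∈ JJ L B ⊔ Ideal.span {X j})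
        ?_ (by simp) ?_ ?_ hqm
      · rintro _ ⟨i, _, rfl⟩; exact hs1 i
      · intro x y _ _ hx hy; rw [add_mul]; exact Ideal.add_mem _ hx hy
      · intro a x _ hx; rw [smul_eq_mul, mul_assoc]; exact Ideal.mul_mem_left _ _ hx
    obtain ⟨s0, hs0⟩ := (mem_sup_single _ _ _).1 hqs
    set s' := homogeneousComponent (L.length + 1) s0 with hs'
    have key : q * s - X j * s' ∈ JJ L B := by
      have h1 := homogeneousComponent_mem_of_mem hhom hs0 (L.length + 1 + 1)
      rw [map_sub, homogComp_mul (isHomogeneous_X ℝ j), homogeneousComponent_eq_self] at h1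
      · exact h1
      · have := hq2.mul hs
        rw [show L.length + 1 + 1 = 2 + L.length by ring]; exact this
    refine ⟨s', homogeneousComponent_isHomogeneous _ _, ?_, ?_⟩
    · intro i
      obtain ⟨w, hw⟩ := (mem_sup_single _ _ _).1 (hs1 i)
      exact (mem_sup_single _ _ _).2 ⟨w, socle_exchange hx key hw⟩
    · intro u hu
      obtain ⟨v, hv⟩ := (mem_sup_single _ _ _).1 (hu j)
      -- X j * u - q * v ∈ J
      have hvs : ∀ i, X i * v ∈ JJ L B ⊔ Ideal.span {X j} := by
        intro i
        obtain ⟨w, hw⟩ := (mem_sup_single _ _ _).1 (hu i)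
        exact (mem_sup_single _ _ _).2 ⟨w, socle_exchange hqn hv hw⟩
      obtain ⟨c, hc⟩ := hs2 v hvs
      obtain ⟨w, hw⟩ := (mem_sup_single _ _ _).1 hc
      refine ⟨c, (mem_sup_single _ _ _).2 ⟨w, hx _ ?_⟩⟩
      have := (JJ L B).add_mem (Ideal.add_mem _ hv (Ideal.mul_mem_left _ (C c) key))
        (Ideal.mul_mem_left _ q hw)
      convert this using 1; ring

lemma GoodL.krull {V : Submodule ℝ S4} : ∀ {L : List S4}, GoodL V L → L.length ≤ 4 →
    ringKrullDim (S4 ⧸ JJ L ∅) + L.length ≤ 4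
  | [], _, _ => by
    have h := ringKrullDim_quotient_le (JJ [] ∅)
    have : ringKrullDim S4 = 4 := by simp [S4]
    rw [this] at h
    simpa using h
  | (q :: L), h, hl => by
    simp only [List.length_cons] at hl
    have ih := h.1.krull (by omega)
    have hq := h.2.2 ∅ (by simp; omega)
    have hle : JJ L ∅ ≤ JJ (q :: L) ∅ := by rw [JJ_cons]; exact le_sup_left
    have := ringKrullDim_succ_le_of_surjective (Ideal.Quotient.factor hle)
      (Ideal.Quotient.factor_surjective hle) (r := Ideal.Quotient.mk _ q) (by
        rw [mem_nonZeroDivisors_iff_right]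
        intro x hx
        obtain ⟨a, rfl⟩ := Ideal.Quotient.mk_surjective x
        rw [← map_mul, Ideal.Quotient.eq_zero_iff_mem] at hx
        rw [Ideal.Quotient.eq_zero_iff_mem]
        exact hq a (by rwa [mul_comm])) (by
        rw [Ideal.Quotient.factor_mk, Ideal.Quotient.eq_zero_iff_mem, JJ_cons]
        exact Ideal.mem_sup_right (Ideal.mem_span_singleton_self q))
    calc _ = ringKrullDim (S4 ⧸ JJ (q :: L) ∅) + 1 + L.length := by
          simp only [List.length_cons]; push_cast; rw [add_assoc, add_comm (1 : WithBot ℕ∞)]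
      _ ≤ ringKrullDim (S4 ⧸ JJ L ∅) + L.length := by gcongr
      _ ≤ 4 := ih



attribute [local instance] MvPolynomial.gradedAlgebra

lemma aeval_line {q : S4} {d : ℕ} (hq : q.IsHomogeneous d) (z : Fin 4 → ℂ) :
    aeval (fun i => Polynomial.C (z i) * Polynomial.X) q =
      Polynomial.C (aeval z q) * Polynomial.X ^ d := by
  rw [aeval_def, aeval_def, eval₂_eq, eval₂_eq, map_sum, Finset.sum_mul]
  refine Finset.sum_congr rfl fun m hm => ?_
  have hdeg : ∑ i ∈ m.support, m i = d := by
    have := hq.degree_eq_sum_deg_support hm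
    rw [this]
  simp only [mul_pow, Finset.prod_mul_distrib, Finset.prod_pow_eq_pow_sum, hdeg, map_mul, map_prod,
    map_pow]
  rw [mul_assoc]
  rfl

lemma krull_cancel (d : WithBot ℕ∞) (h : d + (4 : ℕ) ≤ 4) : d ≤ 0 := by
  induction d with
  | bot => simp
  | coe d =>
    induction d with
    | top =>
      exfalso
      have : ((⊤ : ℕ∞) : WithBot ℕ∞) + (4 : ℕ) = ((⊤ + 4 : ℕ∞) : WithBot ℕ∞) := rfl
      rw [this] at h
      have h2 : (⊤ + 4 : ℕ∞) ≤ 4 := 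
        WithBot.coe_le_coe.1 (show ((⊤ + 4 : ℕ∞) : WithBot ℕ∞) ≤ ((4 : ℕ∞) : WithBot ℕ∞) from h)
      simp at h2
    | coe n =>
      norm_cast at h ⊢
      have h3 : n + 4 ≤ 4 := by exact_mod_cast h
      have : n = 0 := by omega
      subst this; simp

lemma GoodL.radical {V : Submodule ℝ S4} (hV2 : ∀ q ∈ V, q.IsHomogeneous 2) {L : List S4}
    (h : GoodL V L) (hl : L.length = 4) (i : Fin 4) : X i ∈ (JJ L ∅).radical := by
  rw [← vanishingIdeal_zeroLocus_eq_radical (K := ℂ), mem_vanishingIdeal_iff]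
  intro z hz
  by_contra hne
  rw [aeval_X] at hne
  have hd : ringKrullDim (S4 ⧸ JJ L ∅) ≤ 0 := by
    have := h.krull hl.le
    rw [hl] at this
    exact krull_cancel _ this
  let φ : S4 →ₐ[ℝ] Polynomial ℂ := aeval (fun i => Polynomial.C (z i) * Polynomial.X)
  have hker : JJ L ∅ ≤ RingHom.ker φ := by
    simp only [JJ, Finset.coe_empty, Set.image_empty, Ideal.span_empty, sup_bot_eq]
    rw [Ideal.ofList, Ideal.span_le]
    intro q hq
    have hq' : q ∈ L := hq
    have h0 : aeval z q = 0 := by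
      apply (mem_zeroLocus_iff).1 hz
      simp only [JJ, Finset.coe_empty, Set.image_empty, Ideal.span_empty, sup_bot_eq]
      exact Ideal.subset_span hq
    change φ q = 0
    simp only [φ]
    rw [aeval_line (hV2 q (h.subset q hq')), h0]; simp
  have hprime : (RingHom.ker φ).IsPrime := RingHom.ker_isPrime _
  have hdim : ringKrullDim (S4 ⧸ RingHom.ker φ) ≤ 0 :=
    (ringKrullDim_le_of_surjective (Ideal.Quotient.factor hker)
      (Ideal.Quotient.factor_surjective hker)).trans hd
  have : Ring.KrullDimLE 0 (S4 ⧸ RingHom.ker φ) := by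
    rw [Ring.krullDimLE_iff]; exact_mod_cast hdim
  have hfield : IsField (S4 ⧸ RingHom.ker φ) := Ring.KrullDimLE.isField_of_isDomain
  have hmax : (RingHom.ker φ).IsMaximal := Ideal.Quotient.maximal_of_isField _ hfield
  let ψ : S4 →+* ℂ := (Polynomial.evalRingHom 0).comp φ.toRingHom
  have hle : RingHom.ker φ ≤ RingHom.ker ψ := by
    intro p hp
    have hp' : φ p = 0 := hp
    change Polynomial.eval 0 (φ p) = 0
    rw [hp']; simp
  have heq := hmax.eq_of_le (RingHom.ker_ne_top ψ) hle
  have : X i ∈ RingHom.ker ψ := by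
    change Polynomial.eval 0 (φ (X i)) = 0
    simp [φ]
  rw [← heq] at this
  have h2 : φ (X i) = 0 := this
  simp [φ] at h2
  exact hne h2

lemma GoodL.high {V : Submodule ℝ S4} (hV2 : ∀ q ∈ V, q.IsHomogeneous 2) {L : List S4}
    (h : GoodL V L) (hl : L.length = 4) (d : ℕ) (hd : 5 ≤ d) (u : S4) (hu : u.IsHomogeneous d) :
    u ∈ JJ L ∅ := by
  have hm : Ideal.span (Set.range (X : Fin 4 → S4)) ≤ (JJ L ∅).radical := by
    rw [Ideal.span_le]
    rintro _ ⟨i, rfl⟩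
    exact h.radical hV2 hl i
  obtain ⟨N, hN⟩ := Ideal.exists_pow_le_of_le_radical_of_fg hm (IsNoetherian.noetherian _)
  have hbig : ∀ d, N ≤ d → ∀ u : S4, u.IsHomogeneous d → u ∈ JJ L ∅ := by
    intro d hd u hu
    apply hN
    rw [u.as_sum]
    refine Ideal.sum_mem _ fun m hm => ?_
    have hdeg : ∑ i, m i = d := by
      have := hu.degree_eq_sum_deg_support hm
      rw [this, ← Finsupp.degree_eq_sum]; rfl
    rw [monomial_eq]
    apply Ideal.mul_mem_left
    rw [Finsupp.prod_fintype _ _ (by simp)]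
    apply Ideal.pow_le_pow_right hd
    rw [← hdeg, ← Finset.prod_pow_eq_pow_sum]
    refine Ideal.prod_mem_prod fun i _ => Ideal.pow_mem_pow
      (Ideal.subset_span (Set.mem_range_self i)) _
  obtain ⟨s, hs, -, hs2⟩ := h.socle hV2 ∅ (by simp [hl])
  rw [hl] at hs
  have hhom := JJ_homog L (fun p hp => hV2 p (h.subset p hp)) ∅
  have key : ∀ k d, 5 ≤ d → N ≤ d + k → ∀ u : S4, u.IsHomogeneous d → u ∈ JJ L ∅ := by
    intro k
    induction k with
    | zero => intro d _ hN u hu; exact hbig d hN u hu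
    | succ k ih =>
      intro d h5 hN u hu
      obtain ⟨c, hc⟩ := hs2 u (fun i => ih (1 + d) (by omega) (by omega) _
        ((isHomogeneous_X ℝ i).mul hu))
      have := homogeneousComponent_mem_of_mem hhom hc d
      rw [map_sub, homogeneousComponent_eq_self hu, homogeneousComponent_C_mul,
        homogeneousComponent_of_mem ((mem_homogeneousSubmodule _ _).2 hs), if_neg (by omega)] at this
      simpa using this
  exact key N d hd (by omega) u hu

/-- Elements of degree `n+2` in the ideal generated by quadrics. -/
lemma ofList_graded (L : List S4) (hL : ∀ q ∈ L, q.IsHomogeneous 2) (T : Submodule ℝ S4) (n : ℕ)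
    (hT : ∀ q ∈ L, ∀ p : S4, p.IsHomogeneous n → q * p ∈ T) (u : S4) (hu : u.IsHomogeneous (n + 2))
    (hmem : u ∈ JJ L ∅) : u ∈ T := by
  simp only [JJ, Finset.coe_empty, Set.image_empty, Ideal.span_empty, sup_bot_eq, Ideal.ofList] at hmem
  rw [← homogeneousComponent_eq_self hu]
  clear hu
  refine Submodule.span_induction (p := fun u _ => ∀ a : S4, homogeneousComponent (n + 2) (u * a) ∈ T)
    ?_ ?_ ?_ ?_ hmem 1 |> fun h => by simpa using h
  · intro q hq a
    have hq' : q ∈ L := hq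
    rw [homogComp_mul (hL q hq')]
    exact hT q hq' _ (homogeneousComponent_isHomogeneous _ _)
  · intro a; simp
  · intro x y _ _ hx hy a; rw [add_mul, map_add]; exact T.add_mem (hx a) (hy a)
  · intro a x _ hx b
    rw [smul_eq_mul, mul_comm a x, mul_assoc]; exact hx _

/-- **Key algebraic lemma**. -/
lemma exists_common_zero (q : Fin 5 → S4) (hq : ∀ i, (q i).IsHomogeneous 2)
    (hli : LinearIndependent ℝ q) (lam : S4 →ₗ[ℝ] ℝ)
    (h0 : ∀ i, ∀ p : S4, p.IsHomogeneous 2 → lam (q i * p) = 0)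
    (u0 : S4) (hu0 : u0.IsHomogeneous 4) (hlam : lam u0 ≠ 0) :
    ∃ z : Fin 4 → ℂ, z ≠ 0 ∧ ∀ i, aeval z (q i) = 0 := by
  by_contra hcon
  push Not at hcon
  let V : Submodule ℝ S4 := Submodule.span ℝ (Set.range q)
  have hV2 : ∀ p ∈ V, p.IsHomogeneous 2 := by
    intro p hp
    have : V ≤ homogeneousSubmodule (Fin 4) ℝ 2 := by
      rw [Submodule.span_le]; rintro _ ⟨i, rfl⟩; exact hq i
    exact this hp
  have hV : ∀ P : Ideal S4, P.IsPrime → (∀ q ∈ V, q ∈ P) → ∀ i, X i ∈ P := by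
    intro P hP hVP i
    rw [← IsPrime.vanishingIdeal_zeroLocus (K := ℂ) P, mem_vanishingIdeal_iff]
    intro z hz
    by_contra hne
    obtain ⟨j, hj⟩ := hcon z (by rintro rfl; simp at hne)
    exact hj (mem_zeroLocus_iff.1 hz _ (hVP _ (Submodule.subset_span ⟨j, rfl⟩)))
  obtain ⟨L, hL, hl⟩ := exists_goodL V hV 4 le_rfl
  have hL2 : ∀ p ∈ L, p.IsHomogeneous 2 := fun p hp => hV2 p (hL.subset p hp)
  obtain ⟨s, hs, -, hs2⟩ := hL.socle hV2 ∅ (by simp [hl])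
  rw [hl] at hs
  have hhom := JJ_homog L hL2 ∅
  have hlamV : ∀ v ∈ V, ∀ p : S4, p.IsHomogeneous 2 → lam (v * p) = 0 := by
    intro v hv p hp
    refine Submodule.span_induction (p := fun v _ => lam (v * p) = 0) ?_ (by simp) ?_ ?_ hv
    · rintro _ ⟨i, rfl⟩; exact h0 i p hp
    · intro x y _ _ hx hy; rw [add_mul, map_add, hx, hy, add_zero]
    · intro a x _ hx; rw [smul_mul_assoc, map_smul, hx, smul_zero]
  have hJ4 : ∀ u ∈ JJ L ∅, u.IsHomogeneous 4 → lam u = 0 := by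
    intro u hu hu4
    exact ofList_graded L hL2 (LinearMap.ker lam) 2
      (fun q hq p hp => hlamV q (hL.subset q hq) p hp) u hu4 hu
  have hsoc : ∀ u : S4, u.IsHomogeneous 4 → ∃ c : ℝ, u - C c * s ∈ JJ L ∅ ∧ lam u = c * lam s := by
    intro u hu
    obtain ⟨c, hc⟩ := hs2 u (fun i => hL.high hV2 hl (1 + 4) (by norm_num) _
      ((isHomogeneous_X ℝ i).mul hu))
    refine ⟨c, hc, ?_⟩
    have := hJ4 _ hc (hu.sub (hs.C_mul c))
    rw [map_sub, ← smul_eq_C_mul, map_smul, sub_eq_zero] at this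
    simpa using this
  have hls : lam s ≠ 0 := by
    intro h
    obtain ⟨c, -, hc⟩ := hsoc u0 hu0
    rw [h, mul_zero] at hc; exact hlam hc
  have low : ∀ d, d < 4 → ∀ u : S4, u.IsHomogeneous d → (∀ i, X i * u ∈ JJ L ∅) → u ∈ JJ L ∅ := by
    intro d hd u hu hX
    obtain ⟨c, hc⟩ := hs2 u hX
    have := homogeneousComponent_mem_of_mem hhom hc d
    rw [map_sub, homogeneousComponent_eq_self hu, homogeneousComponent_C_mul,
      homogeneousComponent_of_mem ((mem_homogeneousSubmodule _ _).2 hs), if_neg (by omega)] at this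
    simpa using this
  have hVJ : ∀ v ∈ V, v ∈ JJ L ∅ := by
    intro v hv
    refine low 2 (by norm_num) v (hV2 v hv) fun i => ?_
    refine low (1 + 2) (by norm_num) _ ((isHomogeneous_X ℝ i).mul (hV2 v hv)) fun j => ?_
    have hp : (X j * X i : S4).IsHomogeneous 2 := (isHomogeneous_X ℝ j).mul (isHomogeneous_X ℝ i)
    have h1 := hlamV v hv _ hp
    obtain ⟨c, hc, hc2⟩ := hsoc (v * (X j * X i)) ((hV2 v hv).mul hp)
    rw [h1] at hc2
    have : c = 0 := by
      rcases mul_eq_zero.1 hc2.symm with h | h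
      · exact h
      · exact absurd h hls
    subst this
    simp only [map_zero, zero_mul, sub_zero] at hc
    convert hc using 1; ring
  have hVs : V ≤ Submodule.span ℝ {p | p ∈ L} := by
    intro v hv
    refine ofList_graded L hL2 _ 0 ?_ v (hV2 v hv) (hVJ v hv)
    intro p hp a ha
    obtain ⟨c, rfl⟩ : ∃ c, a = C c := ⟨_, totalDegree_eq_zero_iff_eq_C.1
      ((totalDegree_zero_iff_isHomogeneous _).2 ha)⟩
    rw [mul_comm, ← smul_eq_C_mul]
    exact Submodule.smul_mem _ _ (Submodule.subset_span hp)
  classical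
  have hfin : {p | p ∈ L} = (L.toFinset : Set S4) := by ext; simp
  have h5 : Module.finrank ℝ V = 5 := by
    rw [finrank_span_eq_card hli]; simp
  rw [hfin] at hVs
  have h6 := Submodule.finrank_mono hVs
  have h7 := finrank_span_finset_le_card (R := ℝ) L.toFinset
  have h8 := List.toFinset_card_le L
  simp only [Set.finrank] at h7
  omega



lemma quad_repr (p : S4) (hp : p.IsHomogeneous 2) :
    ∃ A : Fin 4 → Fin 4 → ℝ, p = ∑ i, ∑ k, C (A i k) * X i * X k := by
  have h : p ∈ homogeneousSubmodule (Fin 4) ℝ 2 := hp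
  rw [← homogeneousSubmodule_one_pow, homogeneousSubmodule_one_eq_span_X, pow_two,
    Submodule.span_mul_span] at h
  refine Submodule.span_induction (p := fun p _ =>
    ∃ A : Fin 4 → Fin 4 → ℝ, p = ∑ i, ∑ k, C (A i k) * X i * X k) ?_ ?_ ?_ ?_ h
  · rintro _ ⟨_, ⟨i, rfl⟩, _, ⟨k, rfl⟩, rfl⟩
    refine ⟨fun a b => if a = i ∧ b = k then 1 else 0, ?_⟩
    rw [Finset.sum_eq_single i, Finset.sum_eq_single k]
    · simp
    · intro b _ hb; simp [hb]
    · simp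
    · intro b _ hb; simp [hb]
    · simp
  · exact ⟨0, by simp⟩
  · rintro x y _ _ ⟨A, rfl⟩ ⟨B, rfl⟩
    refine ⟨A + B, ?_⟩
    simp only [← Finset.sum_add_distrib, Pi.add_apply, map_add, add_mul]
  · rintro a x _ ⟨A, rfl⟩
    refine ⟨a • A, ?_⟩
    simp only [Finset.smul_sum, Pi.smul_apply, smul_eq_mul, map_mul, smul_eq_C_mul, mul_assoc]

/-- the five quadrics through the coordinate points and `(1,1,1,1)` -/
def q5 : Fin 5 → S4 := ![X 0 * X 1 - X 2 * X 3, X 0 * X 2 - X 2 * X 3, X 0 * X 3 - X 2 * X 3,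
  X 1 * X 2 - X 2 * X 3, X 1 * X 3 - X 2 * X 3]

lemma q5_homog (i : Fin 5) : (q5 i).IsHomogeneous 2 := by
  have h : ∀ a b c d : Fin 4, (X a * X b - X c * X d : S4).IsHomogeneous 2 := fun a b c d =>
    ((isHomogeneous_X ℝ a).mul (isHomogeneous_X ℝ b)).sub
      ((isHomogeneous_X ℝ c).mul (isHomogeneous_X ℝ d))
  fin_cases i <;> exact h _ _ _ _

lemma q5_span (p : S4) (hp : p.IsHomogeneous 2) (h0 : eval ![1, 0, 0, 0] p = 0)
    (h1 : eval ![0, 1, 0, 0] p = 0) (h2 : eval ![0, 0, 1, 0] p = 0) (h3 : eval ![0, 0, 0, 1] p = 0)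
    (h4 : eval ![1, 1, 1, 1] p = 0) :
    ∃ c : Fin 5 → ℝ, ∀ x, eval x p = ∑ k, c k * eval x (q5 k) := by
  obtain ⟨A, rfl⟩ := quad_repr p hp
  simp [Fin.sum_univ_four] at h0 h1 h2 h3 h4
  refine ⟨![A 0 1 + A 1 0, A 0 2 + A 2 0, A 0 3 + A 3 0, A 1 2 + A 2 1, A 1 3 + A 3 1], ?_⟩
  intro x
  simp [Fin.sum_univ_four, Fin.sum_univ_five, q5, h0, h1, h2, h3]
  rw [h0, h1, h2, h3] at h4
  linear_combination (x 2 * x 3) * h4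

lemma lower_bound : ∃ f : MvPolynomial (Fin 4) ℝ, InSigma 4 2 f ∧ ¬ IsSOS 4 2 4 f := by
  refine ⟨∑ k, q5 k ^ 2, ⟨5, q5, q5_homog, rfl⟩, ?_⟩
  rintro ⟨p, hp, hf⟩
  have hev : ∀ x, ∑ k, (eval x (q5 k)) ^ 2 = ∑ j, (eval x (p j)) ^ 2 := by
    intro x
    have := congrArg (eval x) hf
    simpa only [map_sum, map_pow] using this
  have hz : ∀ x, (∀ k, eval x (q5 k) = 0) → ∀ j, eval x (p j) = 0 := by
    intro x hx j
    have := hev x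
    simp only [hx, ne_eq, OfNat.ofNat_ne_zero, not_false_eq_true, zero_pow,
      Finset.sum_const_zero] at this
    have h2 := (Finset.sum_eq_zero_iff_of_nonneg (fun i _ => sq_nonneg _)).1 this.symm j
      (Finset.mem_univ _)
    exact pow_eq_zero_iff (two_ne_zero) |>.1 h2
  have hc : ∀ j, ∃ c : Fin 5 → ℝ, ∀ x, eval x (p j) = ∑ k, c k * eval x (q5 k) := by
    intro j
    apply q5_span (p j) (hp j) <;>
    · apply hz
      intro k
      fin_cases k <;> simp [q5]
  choose c hc using hc
  simp only [hc] at hev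
  set D : Fin 5 → Fin 5 → ℝ := fun k l => ∑ j, c j k * c j l with hD
  have hsym : ∀ k l, D k l = D l k := by
    intro k l; simp only [hD]; exact Finset.sum_congr rfl fun j _ => mul_comm _ _
  have hquad : ∀ x, ∑ k, (eval x (q5 k)) ^ 2 =
      ∑ k, ∑ l, D k l * (eval x (q5 k) * eval x (q5 l)) := by
    intro x
    rw [hev x]
    change ∑ j, (∑ k, c j k * (fun k => eval x (q5 k)) k) ^ 2 = ∑ k, ∑ l, D k l * ((fun k => eval x (q5 k)) k * (fun k => eval x (q5 k)) l)
    generalize (fun k => eval x (q5 k)) = y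
    simp only [hD, Fin.sum_univ_five, Fin.sum_univ_four]
    ring
  have e01 := hquad ![1, 1, 0, 0]
  have e02 := hquad ![1, 0, 1, 0]
  have e03 := hquad ![1, 0, 0, 1]
  have e12 := hquad ![0, 1, 1, 0]
  have e13 := hquad ![0, 1, 0, 1]
  have a1 := hquad ![1, 1, 1, 0]
  have a2 := hquad ![1, 1, -1, 0]
  have a3 := hquad ![1, -1, 1, 0]
  have b1 := hquad ![1, 1, 0, 1]
  have b2 := hquad ![1, 1, 0, -1]
  have b3 := hquad ![1, -1, 0, 1]
  have c1 := hquad ![1, 0, 1, 1]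
  have c2 := hquad ![1, 0, 1, -1]
  have c3 := hquad ![1, 0, -1, 1]
  have d1 := hquad ![0, 1, 1, 1]
  have d2 := hquad ![0, 1, 1, -1]
  have d3 := hquad ![0, 1, -1, 1]
  have f1 := hquad ![0, 0, 1, 1]
  clear hquad hev hc hz hf
  clear_value D
  simp [Fin.sum_univ_five, q5, hsym 1 0, hsym 2 0, hsym 3 0, hsym 4 0, hsym 2 1, hsym 3 1,
    hsym 4 1, hsym 3 2, hsym 4 2, hsym 4 3] at e01 e02 e03 e12 e13 a1 a2 a3 b1 b2 b3 c1 c2 c3 d1 d2 d3 f1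
  have hone : ∀ k l, D k l = if k = l then 1 else 0 := by
    have g00 : D 0 0 = 1 := by linarith
    have g11 : D 1 1 = 1 := by linarith
    have g22 : D 2 2 = 1 := by linarith
    have g33 : D 3 3 = 1 := by linarith
    have g44 : D 4 4 = 1 := by linarith
    have g01 : D 0 1 = 0 := by linarith
    have g02 : D 0 2 = 0 := by linarith
    have g03 : D 0 3 = 0 := by linarith
    have g04 : D 0 4 = 0 := by linarith
    have g12 : D 1 2 = 0 := by linarith
    have g13 : D 1 3 = 0 := by linarith
    have g14 : D 1 4 = 0 := by linarith
    have g23 : D 2 3 = 0 := by linarith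
    have g24 : D 2 4 = 0 := by linarith
    have g34 : D 3 4 = 0 := by linarith
    intro k l
    fin_cases k <;> fin_cases l <;> simp [g00, g11, g22, g33, g44, g01, g02, g03, g04, g12, g13, g14, g23, g24, g34,
      hsym 1 0, hsym 2 0, hsym 3 0, hsym 4 0, hsym 2 1, hsym 3 1, hsym 4 1, hsym 3 2, hsym 4 2, hsym 4 3]
  let M : Matrix (Fin 4) (Fin 5) ℝ := Matrix.of c
  have hM : M.transpose * M = 1 := by
    ext k l
    rw [Matrix.one_apply, ← hone, hD, Matrix.mul_apply]
    rfl
  have h1 : (M.transpose * M).rank = 5 := by rw [hM, Matrix.rank_one]; simp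
  have h2 := Matrix.rank_mul_le_right M.transpose M
  have h3 := M.rank_le_height
  omega



/-- exponents of degree `d` -/
abbrev Mon (d : ℕ) : Type := {m : Fin 4 →₀ ℕ // m ∈ Finset.finsuppAntidiag (Finset.univ : Finset (Fin 4)) d}

abbrev VV (d : ℕ) : Type := EuclideanSpace ℝ (Mon d)

lemma mon_degree {d : ℕ} (m : Mon d) : m.1.degree = d := by
  have := m.2
  rw [Finset.mem_finsuppAntidiag] at this
  rw [Finsupp.degree_eq_sum]; exact this.1

lemma mem_mon {d : ℕ} (m : Fin 4 →₀ ℕ) (h : m.degree = d) :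
    m ∈ Finset.finsuppAntidiag (Finset.univ : Finset (Fin 4)) d := by
  rw [Finset.mem_finsuppAntidiag]
  rw [Finsupp.degree_eq_sum] at h
  exact ⟨h, by simp⟩

def ofV (d : ℕ) : VV d →ₗ[ℝ] S4 where
  toFun y := ∑ m, monomial m.1 (y m)
  map_add' x y := by simp [Finset.sum_add_distrib]
  map_smul' a x := by simp [Finset.smul_sum, smul_monomial]

def toV (d : ℕ) : S4 →ₗ[ℝ] VV d where
  toFun p := WithLp.toLp 2 (fun m => coeff m.1 p)
  map_add' x y := by ext; simp
  map_smul' a x := by ext; simp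

lemma toV_apply (d : ℕ) (p : S4) (m : Mon d) : toV d p m = coeff m.1 p := rfl

lemma ofV_def (d : ℕ) (y : VV d) : ofV d y = ∑ m, monomial m.1 (y m) := rfl

lemma coeff_ofV (d : ℕ) (y : VV d) (m : Mon d) : coeff m.1 (ofV d y) = y m := by
  rw [ofV_def, coeff_sum, Finset.sum_eq_single m]
  · simp
  · intro b _ hb
    rw [coeff_monomial, if_neg]
    exact fun h => hb (Subtype.ext h)
  · simp

lemma toV_ofV (d : ℕ) (y : VV d) : toV d (ofV d y) = y := by
  ext m; exact coeff_ofV d y m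

lemma ofV_homog (d : ℕ) (y : VV d) : (ofV d y).IsHomogeneous d := by
  rw [ofV_def]
  exact IsHomogeneous.sum _ _ _ fun m _ => isHomogeneous_monomial _ (mon_degree m)

lemma ofV_toV (d : ℕ) (p : S4) (hp : p.IsHomogeneous d) : ofV d (toV d p) = p := by
  ext m
  by_cases h : m.degree = d
  · exact coeff_ofV d (toV d p) ⟨m, mem_mon m h⟩
  · rw [hp.coeff_eq_zero h, (ofV_homog d _).coeff_eq_zero h]

lemma ofV_injective (d : ℕ) : Function.Injective (ofV d) :=
  Function.LeftInverse.injective (toV_ofV d)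

/-- Polynomial-valued map with `C^1` coefficients. -/
def Sm {E : Type*} [NormedAddCommGroup E] [NormedSpace ℝ E] (g : E → S4) : Prop :=
  ∀ m, ContDiff ℝ 1 (fun v => coeff m (g v))

namespace Sm
variable {E : Type*} [NormedAddCommGroup E] [NormedSpace ℝ E]

lemma add {f g : E → S4} (hf : Sm f) (hg : Sm g) : Sm (fun v => f v + g v) := by
  intro m; simp only [coeff_add]; exact (hf m).add (hg m)

lemma sub {f g : E → S4} (hf : Sm f) (hg : Sm g) : Sm (fun v => f v - g v) := by
  intro m; simp only [coeff_sub]; exact (hf m).sub (hg m)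

lemma mul {f g : E → S4} (hf : Sm f) (hg : Sm g) : Sm (fun v => f v * g v) := by
  intro m; simp only [coeff_mul]
  exact ContDiff.sum fun i _ => (hf _).mul (hg _)

lemma pow {f : E → S4} (hf : Sm f) (n : ℕ) : Sm (fun v => f v ^ n) := by
  induction n with
  | zero => simp only [pow_zero]; intro m; exact contDiff_const
  | succ n ih => simp only [pow_succ]; exact ih.mul hf

lemma sum {ι : Type*} (s : Finset ι) {f : ι → E → S4} (hf : ∀ i ∈ s, Sm (f i)) :
    Sm (fun v => ∑ i ∈ s, f i v) := by
  intro m; simp only [coeff_sum]; exact ContDiff.sum fun i hi => hf i hi m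

lemma const (p : S4) : Sm (fun _ : E => p) := fun _ => contDiff_const

lemma C {f : E → ℝ} (hf : ContDiff ℝ 1 f) : Sm (fun v => MvPolynomial.C (f v)) := by
  intro m
  simp only [coeff_C]
  split_ifs
  · exact hf
  · exact contDiff_const

lemma ofV (d : ℕ) {f : E → VV d} (hf : ContDiff ℝ 1 f) : Sm (fun v => ofV d (f v)) := by
  intro m
  simp only [ofV_def, coeff_sum, coeff_monomial]
  refine ContDiff.sum fun i _ => ?_
  split_ifs
  · exact (contDiff_euclidean.1 hf) i
  · exact contDiff_const

lemma toV (d : ℕ) {f : E → S4} (hf : Sm f) : ContDiff ℝ 1 (fun v => toV d (f v)) := by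
  rw [contDiff_euclidean]
  intro i
  exact hf i.1

end Sm

def Phi (q : Fin 5 → VV 2) : VV 4 := toV 4 (∑ i, ofV 2 (q i) ^ 2)

lemma sq_homog {p : S4} (hp : p.IsHomogeneous 2) : (p ^ 2).IsHomogeneous 4 := hp.pow 2

lemma sum_sq_homog {ι : Type*} (s : Finset ι) (p : ι → S4) (hp : ∀ i ∈ s, (p i).IsHomogeneous 2) :
    (∑ i ∈ s, p i ^ 2).IsHomogeneous 4 :=
  IsHomogeneous.sum _ _ _ fun i hi => sq_homog (hp i hi)

lemma ofV_Phi (q : Fin 5 → VV 2) : ofV 4 (Phi q) = ∑ i, ofV 2 (q i) ^ 2 :=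
  ofV_toV 4 _ (sum_sq_homog _ _ fun i _ => ofV_homog 2 _)

lemma Phi_contDiff : ContDiff ℝ 1 Phi := by
  unfold Phi
  refine Sm.toV 4 (Sm.sum _ fun i _ => Sm.pow (Sm.ofV 2 ?_) 2)
  exact contDiff_apply ℝ _ i

lemma Phi_smul (a : ℝ) (q : Fin 5 → VV 2) : Phi (a • q) = a ^ 2 • Phi q := by
  unfold Phi
  rw [← map_smul]
  congr 1
  simp [Finset.smul_sum, smul_pow]

lemma sum_sq_zero {n : ℕ} (p : Fin n → S4) (h : ∑ i, p i ^ 2 = 0) (i : Fin n) : p i = 0 := by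
  apply MvPolynomial.funext
  intro x
  have := congrArg (eval x) h
  simp only [map_sum, map_pow, map_zero] at this
  have h2 := (Finset.sum_eq_zero_iff_of_nonneg (fun i _ => sq_nonneg _)).1 this i (Finset.mem_univ _)
  simpa using h2

lemma Phi_eq_zero (q : Fin 5 → VV 2) (h : Phi q = 0) : q = 0 := by
  have h1 := ofV_Phi q
  rw [h, map_zero] at h1
  funext i
  apply ofV_injective 2
  rw [sum_sq_zero _ h1.symm i]; simp

lemma Phi_coercive : ∃ c : ℝ, 0 < c ∧ ∀ q, c * ‖q‖ ^ 2 ≤ ‖Phi q‖ := by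
  have hK : IsCompact (Metric.sphere (0 : Fin 5 → VV 2) 1) := isCompact_sphere 0 1
  rcases (Metric.sphere (0 : Fin 5 → VV 2) 1).eq_empty_or_nonempty with he | hne
  · refine ⟨1, one_pos, fun q => ?_⟩
    by_cases hq : q = 0
    · simp [hq]
    · exfalso
      have : (‖q‖⁻¹ • q) ∈ Metric.sphere (0 : Fin 5 → VV 2) 1 := by
        simp [norm_smul, hq]
      rw [he] at this; exact this
  · obtain ⟨q0, hq0, hmin⟩ := hK.exists_isMinOn hne (Phi_contDiff.continuous.norm.continuousOn)
    refine ⟨‖Phi q0‖, ?_, fun q => ?_⟩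
    · rw [norm_pos_iff]
      intro h
      rw [Phi_eq_zero q0 h] at hq0
      simp at hq0
    · by_cases hq : q = 0
      · simp [hq]
      · have hm : (‖q‖⁻¹ • q) ∈ Metric.sphere (0 : Fin 5 → VV 2) 1 := by
          simp [norm_smul, hq]
        have h1 : ‖Phi q0‖ ≤ ‖Phi (‖q‖⁻¹ • q)‖ := hmin hm
        have hn : 0 < ‖q‖ := norm_pos_iff.2 hq
        rw [Phi_smul, norm_smul] at h1
        have h2 : ‖(‖q‖⁻¹ ^ 2 : ℝ)‖ = (‖q‖ ^ 2)⁻¹ := by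
          rw [Real.norm_of_nonneg (by positivity), inv_pow]
        rw [h2, inv_mul_eq_div, le_div_iff₀ (by positivity)] at h1
        exact h1

lemma Phi_proper : IsProperMap Phi := by
  rw [isProperMap_iff_tendsto_cocompact]
  refine ⟨Phi_contDiff.continuous, ?_⟩
  rw [← Metric.cobounded_eq_cocompact, ← Metric.cobounded_eq_cocompact,
    ← tendsto_norm_atTop_iff_cobounded]
  obtain ⟨c, hc, h⟩ := Phi_coercive
  refine Filter.tendsto_atTop_mono h ?_
  exact Filter.Tendsto.const_mul_atTop hc
    ((Filter.tendsto_pow_atTop two_ne_zero).comp tendsto_norm_cobounded_atTop)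

lemma Phi_closed {S : Set (Fin 5 → VV 2)} (hS : IsClosed S) : IsClosed (Phi '' S) :=
  Phi_proper.isClosedMap S hS

/-- tuples with a common complex zero -/
def ZZ : Set (Fin 5 → VV 2) :=
  {q | ∃ z : Fin 4 → ℂ, ‖z‖ = 1 ∧ ∀ i, aeval z (ofV 2 (q i)) = 0}

lemma ZZ_closed : IsClosed ZZ := by
  let K := Metric.sphere (0 : Fin 4 → ℂ) 1
  have : CompactSpace K := isCompact_iff_compactSpace.1 (isCompact_sphere 0 1)
  have hcl : IsClosed {w : K × (Fin 5 → VV 2) | ∀ i, aeval w.1.1 (ofV 2 (w.2 i)) = 0} := by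
    simp only [Set.ofPred_forall]
    refine isClosed_iInter fun i => isClosed_eq ?_ continuous_const
    simp only [ofV_def, map_sum, aeval_monomial, Finsupp.prod_fintype, pow_zero, implies_true]
    refine continuous_finsetSum _ fun m _ => Continuous.mul ?_ ?_
    · refine (Complex.continuous_ofReal).comp ?_
      change Continuous fun x : K × (Fin 5 → VV 2) => (x.2 i) m
      exact (EuclideanSpace.proj m).continuous.comp ((continuous_apply i).comp continuous_snd)
    · refine continuous_finsetProd _ fun k _ => Continuous.pow ?_ _
      exact (continuous_apply k).comp (continuous_subtype_val.comp continuous_fst)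
  have := isClosedMap_snd_of_compactSpace _ hcl
  convert this using 1
  ext q
  constructor
  · rintro ⟨z, hz, h⟩
    exact ⟨(⟨z, by simpa [K] using hz⟩, q), h, rfl⟩
  · rintro ⟨⟨z, q'⟩, h, rfl⟩
    exact ⟨z.1, by simpa [K] using z.2, h⟩



lemma quartic_nonneg_lin (a b c d : ℝ) (h : ∀ s : ℝ, 0 ≤ a * s + b * s ^ 2 + c * s ^ 3 + d * s ^ 4) :
    a = 0 := by
  have hd : HasDerivAt (fun s : ℝ => a * s + b * s ^ 2 + c * s ^ 3 + d * s ^ 4) a 0 := by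
    have h1 := (((hasDerivAt_id (0:ℝ)).const_mul a).add
      (((hasDerivAt_id (0:ℝ)).pow 2).const_mul b)).add
      (((hasDerivAt_id (0:ℝ)).pow 3).const_mul c) |>.add (((hasDerivAt_id (0:ℝ)).pow 4).const_mul d)
    simp only [id_eq] at h1
    exact h1.congr_deriv (by norm_num)
  refine IsLocalMin.hasDerivAt_eq_zero (Filter.Eventually.of_forall fun s => ?_) hd
  simpa using h s

lemma first_order {V : Type*} [NormedAddCommGroup V] [InnerProductSpace ℝ V] (r b c : V)
    (h : ∀ s : ℝ, ‖r‖ ≤ ‖r - (s • b + s ^ 2 • c)‖) : inner ℝ r b = 0 := by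
  have h2 := quartic_nonneg_lin (-2 * inner ℝ r b) (‖b‖ ^ 2 - 2 * inner ℝ r c) (2 * inner ℝ b c)
    (‖c‖ ^ 2) (fun s => by
      have h1 := pow_le_pow_left₀ (norm_nonneg r) (h s) 2
      rw [norm_sub_sq_real, norm_add_sq_real] at h1
      simp only [inner_add_right, inner_smul_right, inner_smul_left, norm_smul, mul_pow,
        Real.norm_eq_abs, sq_abs, RCLike.conj_to_real] at h1
      linarith)
  linarith

lemma second_order {V : Type*} [NormedAddCommGroup V] [InnerProductSpace ℝ V] (r c : V)
    (h : ∀ s : ℝ, ‖r‖ ≤ ‖r - s ^ 2 • c‖) : inner ℝ r c ≤ 0 := by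
  by_contra hneg
  push Not at hneg
  set t : ℝ := inner ℝ r c / (‖c‖ ^ 2 + 1) with ht
  have htp : 0 < t := by positivity
  have h1 := pow_le_pow_left₀ (norm_nonneg r) (h (Real.sqrt t)) 2
  rw [norm_sub_sq_real, Real.sq_sqrt htp.le, norm_smul, inner_smul_right, mul_pow,
    Real.norm_eq_abs, sq_abs] at h1
  have h2 : t * (‖c‖ ^ 2 + 1) = inner ℝ r c := by
    rw [ht]; field_simp
  have h3 : t * ‖c‖ ^ 2 ≤ inner ℝ r c := by nlinarith
  nlinarith [mul_le_mul_of_nonneg_left h3 htp.le, mul_pos htp hneg]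

lemma min_mem_ZZ (g : VV 4) (hg : InSigma 4 2 (ofV 4 g)) (q : Fin 5 → VV 2)
    (hmin : ∀ q', ‖g - Phi q‖ ≤ ‖g - Phi q'‖) (hne : g ≠ Phi q) : q ∈ ZZ := by
  set r := g - Phi q with hr
  have hr0 : r ≠ 0 := sub_ne_zero.2 hne
  have hrr : 0 < inner ℝ r r := real_inner_self_pos.2 hr0
  -- variation formula
  have hvar : ∀ (c : Fin 5 → ℝ) (h : VV 2) (s : ℝ),
      ‖r‖ ≤ ‖r - (s • toV 4 (2 * (∑ i, c i • ofV 2 (q i)) * ofV 2 h)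
        + s ^ 2 • toV 4 ((∑ i, c i ^ 2) • ofV 2 h ^ 2))‖ := by
    intro c h s
    have h1 := hmin (fun i => q i + (s * c i) • h)
    convert h1 using 2
    rw [hr, sub_sub]
    congr 1
    unfold Phi
    rw [← map_smul, ← map_smul, ← map_add, ← map_add]
    congr 1
    simp only [map_add, map_smul, smul_eq_C_mul, Finset.sum_mul, Finset.mul_sum, map_sum, map_pow,
      map_mul, ← Finset.sum_add_distrib]
    refine Finset.sum_congr rfl fun i _ => ?_
    ring
  have hfo : ∀ i (p : S4), p.IsHomogeneous 2 → inner ℝ r (toV 4 (ofV 2 (q i) * p)) = 0 := by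
    intro i p hp
    have h1 := first_order r _ _ (hvar (Pi.single i 1) (toV 2 p))
    rw [ofV_toV 2 p hp] at h1
    have h2 : ∑ k, (Pi.single i 1 : Fin 5 → ℝ) k • ofV 2 (q k) = ofV 2 (q i) := by
      rw [Finset.sum_eq_single i]
      · simp
      · intro b _ hb; simp [hb]
      · simp
    rw [h2, mul_assoc, two_mul, map_add, inner_add_right] at h1
    linarith
  have hPhi0 : inner ℝ r (Phi q) = 0 := by
    unfold Phi
    rw [map_sum, inner_sum]
    refine Finset.sum_eq_zero fun i _ => ?_
    rw [pow_two]
    exact hfo i _ (ofV_homog 2 _)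
  have hli : LinearIndependent ℝ (fun i => ofV 2 (q i)) := by
    by_contra hdep
    rw [Fintype.not_linearIndependent_iff] at hdep
    obtain ⟨c, hc, i0, hi0⟩ := hdep
    have hcpos : 0 < ∑ i, c i ^ 2 :=
      Finset.sum_pos' (fun i _ => sq_nonneg _) ⟨i0, Finset.mem_univ _, by positivity⟩
    have hso : ∀ p : S4, p.IsHomogeneous 2 → inner ℝ r (toV 4 (p ^ 2)) ≤ 0 := by
      intro p hp
      have h1 := second_order r (toV 4 ((∑ i, c i ^ 2) • p ^ 2)) (fun s => by
        have := hvar c (toV 2 p) s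
        rw [ofV_toV 2 p hp, hc] at this
        simpa using this)
      rw [map_smul, inner_smul_right] at h1
      exact nonpos_of_mul_nonpos_right h1 hcpos
    obtain ⟨n, p, hp, hgp⟩ := hg
    have hg0 : inner ℝ r g ≤ 0 := by
      rw [← toV_ofV 4 g, hgp, map_sum, inner_sum]
      exact Finset.sum_nonpos fun i _ => hso _ (hp i)
    have : inner ℝ r r = inner ℝ r g - inner ℝ r (Phi q) := by
      rw [← inner_sub_right]
    linarith
  obtain ⟨z, hz, h⟩ := exists_common_zero (fun i => ofV 2 (q i)) (fun i => ofV_homog 2 _) hli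
    ((innerₛₗ ℝ r).comp (toV 4)) (fun i p hp => hfo i p hp) (ofV 4 r) (ofV_homog 4 r) (by
      simp only [LinearMap.comp_apply, toV_ofV]
      exact hrr.ne')
  have hn : ‖z‖ ≠ 0 := norm_ne_zero_iff.2 hz
  refine ⟨((‖z‖⁻¹ : ℝ) : ℂ) • z, ?_, fun i => ?_⟩
  · rw [norm_smul]; simp [hn]
  · have h2 : ∀ c : ℂ, aeval (c • z) (ofV 2 (q i)) = c ^ 2 * aeval z (ofV 2 (q i)) := by
      intro c
      simp only [ofV_def, map_sum, aeval_monomial, Finsupp.prod_fintype, pow_zero, implies_true,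
        Finset.mul_sum, Pi.smul_apply, smul_eq_mul]
      refine Finset.sum_congr rfl fun m _ => ?_
      simp only [mul_pow, Finset.prod_mul_distrib]
      rw [Finset.prod_pow_eq_pow_sum]
      have := mon_degree m
      rw [Finsupp.degree_eq_sum] at this
      rw [this]; ring
    rw [h2, h i, mul_zero]

/-- Local openness away from `Phi '' ZZ`. -/
lemma local_open (f : VV 4) (hf : f ∈ Set.range Phi) (hfZ : f ∉ Phi '' ZZ) :
    ∃ δ > 0, ∀ g : VV 4, InSigma 4 2 (ofV 4 g) → dist g f < δ → g ∈ Set.range Phi := by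
  have hcl := Phi_closed ZZ_closed
  obtain ⟨ε, hε, hball⟩ := Metric.isOpen_iff.1 hcl.isOpen_compl f hfZ
  refine ⟨ε / 2, by positivity, fun g hg hd => ?_⟩
  have hIm : IsClosed (Set.range Phi) := by
    rw [← Set.image_univ]; exact Phi_closed isClosed_univ
  obtain ⟨y, ⟨q, rfl⟩, hy⟩ := hIm.exists_infDist_eq_dist ⟨f, hf⟩ g
  by_contra hng
  have hq : q ∈ ZZ := by
    refine min_mem_ZZ g hg q (fun q' => ?_) (fun h => hng ⟨q, h.symm⟩)
    rw [← dist_eq_norm, ← dist_eq_norm, ← hy]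
    exact Metric.infDist_le_dist_of_mem ⟨q', rfl⟩
  have h1 : dist g (Phi q) ≤ dist g f := by rw [← hy]; exact Metric.infDist_le_dist_of_mem hf
  have h2 : Phi q ∈ Metric.ball f ε := by
    rw [Metric.mem_ball]
    have := dist_triangle (Phi q) g f
    rw [dist_comm (Phi q) g] at this
    linarith
  exact hball h2 ⟨q, hq, rfl⟩

lemma path_lemma (f0 f1 : VV 4) (h0 : f0 ∈ Set.range Phi)
    (hS : ∀ t ∈ Set.Icc (0:ℝ) 1, InSigma 4 2 (ofV 4 (f0 + t • (f1 - f0))))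
    (hZ : ∀ t ∈ Set.Icc (0:ℝ) 1, f0 + t • (f1 - f0) ∉ Phi '' ZZ) : f1 ∈ Set.range Phi := by
  have hIm : IsClosed (Set.range Phi) := by
    rw [← Set.image_univ]; exact Phi_closed isClosed_univ
  let γ : ℝ → VV 4 := fun t => f0 + t • (f1 - f0)
  have hγ : Continuous γ := by fun_prop
  have key : Set.Icc (0:ℝ) 1 ⊆ γ ⁻¹' Set.range Phi := by
    refine IsClosed.Icc_subset_of_forall_mem_nhdsWithin
      ((hIm.preimage hγ).inter isClosed_Icc) ?_ ?_
    · change γ 0 ∈ Set.range Phi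
      simpa [γ] using h0
    · rintro t ⟨ht, ht1⟩
      obtain ⟨δ, hδ, h⟩ := local_open (γ t) ht (hZ t ⟨ht1.1, ht1.2.le⟩)
      have h1 : ∀ᶠ s in nhdsWithin t (Set.Ioi t), dist (γ s) (γ t) < δ :=
        (hγ.continuousAt.mono_left nhdsWithin_le_nhds).eventually (Metric.ball_mem_nhds _ hδ)
      have h2 : ∀ᶠ s in nhdsWithin t (Set.Ioi t), s ∈ Set.Ioo t 1 := Ioo_mem_nhdsGT ht1.2
      filter_upwards [h1, h2] with s hs hs2
      exact h _ (hS s ⟨ht1.1.trans hs2.1.le, hs2.2.le⟩) hs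
  have := key (Set.right_mem_Icc.2 zero_le_one)
  simpa [γ] using this



def f0 : S4 := ∑ i, X i ^ 4

lemma f0_homog : f0.IsHomogeneous 4 :=
  IsHomogeneous.sum _ _ _ fun i _ => by simpa using (isHomogeneous_X ℝ i).pow 4

lemma f0_nonsing (q : Fin 5 → S4) (h : f0 = ∑ i, q i ^ 2) (z : Fin 4 → ℂ)
    (hz : ∀ i, aeval z (q i) = 0) : z = 0 := by
  funext j
  have h1 := congrArg (fun p => aeval z (pderiv j p)) h
  simp only [f0, map_sum, Derivation.leibniz_pow, map_nsmul, map_smul, smul_eq_mul, map_mul, map_pow,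
    hz, pderiv_X, aeval_X] at h1
  rw [Finset.sum_eq_single j] at h1
  · simpa using h1
  · intro b _ hb
    simp [Pi.single_apply, hb, Ne.symm hb]
  · simp

/-- the generators -/
def gens (u v y w Q : S4) : Fin 27 → S4 :=
  ![y * y * u * u, y * y * u * v, y * y * v * v, y * y * u * y, y * y * v * y, y * y * y * y,
    y * y * u * w, y * y * v * w, y * y * y * w, y * y * w * w,
    y * w * u * u, y * w * u * v, y * w * v * v, y * w * u * w, y * w * v * w, y * w * w * w,
    w * w * u * u, w * w * u * v, w * w * v * v, w * w * u * w, w * w * v * w, w * w * w * w,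
    Q * y * u, Q * y * v, Q * w * u, Q * w * v, Q * Q]

lemma gens_Sm {E : Type*} [NormedAddCommGroup E] [NormedSpace ℝ E] {u v y w Q : E → S4}
    (hu : Sm u) (hv : Sm v) (hy : Sm y) (hw : Sm w) (hQ : Sm Q) (k : Fin 27) :
    Sm (fun t => gens (u t) (v t) (y t) (w t) (Q t) k) := by
  have m4 : ∀ {a b c d : E → S4}, Sm a → Sm b → Sm c → Sm d →
      Sm (fun t => a t * b t * c t * d t) := fun ha hb hc hd => ((ha.mul hb).mul hc).mul hd
  have m3 : ∀ {a b c : E → S4}, Sm a → Sm b → Sm c →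
      Sm (fun t => a t * b t * c t) := fun ha hb hc => (ha.mul hb).mul hc
  fin_cases k
  exacts [m4 hy hy hu hu, m4 hy hy hu hv, m4 hy hy hv hv, m4 hy hy hu hy, m4 hy hy hv hy,
    m4 hy hy hy hy, m4 hy hy hu hw, m4 hy hy hv hw, m4 hy hy hy hw, m4 hy hy hw hw,
    m4 hy hw hu hu, m4 hy hw hu hv, m4 hy hw hv hv, m4 hy hw hu hw, m4 hy hw hv hw, m4 hy hw hw hw,
    m4 hw hw hu hu, m4 hw hw hu hv, m4 hw hw hv hv, m4 hw hw hu hw, m4 hw hw hv hw, m4 hw hw hw hw,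
    m3 hQ hy hu, m3 hQ hy hv, m3 hQ hw hu, m3 hQ hw hv, hQ.mul hQ]

lemma sq_gens (u v y w : S4) (p q a1 a2 a3 a4 b1 b2 b4 c : ℝ) (Q : S4)
    (hQ : Q = v * v - C p * u * v - C q * u * u) :
    ∃ k : Fin 27 → ℝ, (y * (C a1 * u + C a2 * v + C a3 * y + C a4 * w)
      + w * (C b1 * u + C b2 * v + C b4 * w) + C c * Q) ^ 2
      = ∑ i, C (k i) * gens u v y w Q i := by
  refine ⟨![a1 ^ 2 - 2 * c * a3 * q, 2 * a1 * a2 - 2 * c * a3 * p, a2 ^ 2 + 2 * c * a3, 2 * a1 * a3,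
    2 * a2 * a3, a3 ^ 2, 2 * a1 * a4 + 2 * a3 * b1, 2 * a2 * a4 + 2 * a3 * b2, 2 * a3 * a4,
    a4 ^ 2 + 2 * a3 * b4,
    2 * a1 * b1 - 2 * c * a4 * q, 2 * (a1 * b2 + a2 * b1) - 2 * c * a4 * p,
    2 * a2 * b2 + 2 * c * a4, 2 * (a1 * b4 + a4 * b1), 2 * (a2 * b4 + a4 * b2), 2 * a4 * b4,
    b1 ^ 2 - 2 * c * b4 * q, 2 * b1 * b2 - 2 * c * b4 * p, b2 ^ 2 + 2 * c * b4, 2 * b1 * b4,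
    2 * b2 * b4, b4 ^ 2, 2 * c * a1, 2 * c * a2, 2 * c * b1, 2 * c * b2, c ^ 2], ?_⟩
  have h2 : (C (2:ℝ) : S4) = 2 := map_ofNat C 2
  simp only [Fin.sum_univ_succ, Fin.sum_univ_zero, gens, Matrix.cons_val_zero, Matrix.cons_val_succ,
    map_add, map_sub, map_mul, map_pow, h2]
  subst hQ
  ring



lemma real_basis (a b : ℂ) (h : a.im * b.re - a.re * b.im ≠ 0) (w : ℂ) :
    ∃ s t : ℝ, w = s * a + t * b := by
  obtain ⟨s, hs⟩ : ∃ s : ℝ, s * (a.im * b.re - a.re * b.im) = w.im * b.re - w.re * b.im :=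
    ⟨_, div_mul_cancel₀ _ h⟩
  obtain ⟨t, ht⟩ : ∃ t : ℝ, t * (a.im * b.re - a.re * b.im) = a.im * w.re - a.re * w.im :=
    ⟨_, div_mul_cancel₀ _ h⟩
  refine ⟨s, t, ?_⟩
  apply Complex.ext
  · simp only [Complex.add_re, Complex.mul_re, Complex.ofReal_re, Complex.ofReal_im]
    apply mul_right_cancel₀ h
    linear_combination (-a.re) * hs - b.re * ht
  · simp only [Complex.add_im, Complex.mul_im, Complex.ofReal_re, Complex.ofReal_im]
    apply mul_right_cancel₀ h
    linear_combination (-a.im) * hs - b.im * ht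

lemma real_basis_uniq (a b : ℂ) (h : a.im * b.re - a.re * b.im ≠ 0) (s t : ℝ)
    (h0 : (s : ℂ) * a + t * b = 0) : s = 0 ∧ t = 0 := by
  have hr := congrArg Complex.re h0
  have hi := congrArg Complex.im h0
  simp only [Complex.add_re, Complex.mul_re, Complex.add_im, Complex.mul_im, Complex.ofReal_re,
    Complex.ofReal_im, Complex.zero_re, Complex.zero_im] at hr hi
  constructor
  · have : s * (a.im * b.re - a.re * b.im) = 0 := by linear_combination b.re * hi - b.im * hr
    exact (mul_eq_zero.1 this).resolve_right h
  · have : t * (a.im * b.re - a.re * b.im) = 0 := by linear_combination a.im * hr - a.re * hi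
    exact (mul_eq_zero.1 this).resolve_right h

def gy (σ : Equiv.Perm (Fin 4)) (θ : Fin 6 → ℝ) : S4 :=
  X (σ 2) - C (θ 0) * X (σ 0) - C (θ 1) * X (σ 1)
def gw (σ : Equiv.Perm (Fin 4)) (θ : Fin 6 → ℝ) : S4 :=
  X (σ 3) - C (θ 2) * X (σ 0) - C (θ 3) * X (σ 1)
def gQ (σ : Equiv.Perm (Fin 4)) (θ : Fin 6 → ℝ) : S4 :=
  X (σ 1) * X (σ 1) - C (θ 4) * X (σ 0) * X (σ 1) - C (θ 5) * X (σ 0) * X (σ 0)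

lemma quad_struct (z : Fin 4 → ℂ) (σ : Equiv.Perm (Fin 4))
    (h : (z (σ 0)).im * (z (σ 1)).re - (z (σ 0)).re * (z (σ 1)).im ≠ 0) (θ : Fin 6 → ℝ)
    (hy : aeval z (gy σ θ) = 0) (hw : aeval z (gw σ θ) = 0) (hQ : aeval z (gQ σ θ) = 0)
    (p : S4) (hp : p.IsHomogeneous 2) (hpz : aeval z p = 0) :
    ∃ a1 a2 a3 a4 b1 b2 b4 c : ℝ, p =
      gy σ θ * (C a1 * X (σ 0) + C a2 * X (σ 1) + C a3 * gy σ θ + C a4 * gw σ θ)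
      + gw σ θ * (C b1 * X (σ 0) + C b2 * X (σ 1) + C b4 * gw σ θ) + C c * gQ σ θ := by
  obtain ⟨A, rfl⟩ := quad_repr p hp
  set B : Fin 4 → Fin 4 → ℝ := fun i k => A (σ i) (σ k) with hB
  have hre : (∑ i, ∑ k, C (A i k) * X i * X k : S4) =
      ∑ i, ∑ k, C (B i k) * X (σ i) * X (σ k) := by
    rw [← Equiv.sum_comp σ]
    refine Finset.sum_congr rfl fun i _ => ?_
    rw [← Equiv.sum_comp σ]
  rw [hre] at hpz ⊢
  clear hre hp
  clear_value B
  have ha0 : z (σ 0) ≠ 0 := by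
    intro h0; rw [h0] at h; simp at h
  set α := θ 0 with hα
  set β := θ 1 with hβ
  set γ := θ 2 with hγ
  set δ := θ 3 with hδ
  set P := θ 4 with hP
  set R := θ 5 with hR
  set e1 := B 0 0 + α * (B 0 2 + B 2 0) + γ * (B 0 3 + B 3 0) + α ^ 2 * B 2 2
    + α * γ * (B 2 3 + B 3 2) + γ ^ 2 * B 3 3 with he1
  set e2 := B 0 1 + B 1 0 + β * (B 0 2 + B 2 0) + δ * (B 0 3 + B 3 0) + α * (B 1 2 + B 2 1)
    + γ * (B 1 3 + B 3 1) + 2 * α * β * B 2 2 + (α * δ + β * γ) * (B 2 3 + B 3 2)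
    + 2 * γ * δ * B 3 3 with he2
  set c := B 1 1 + β * (B 1 2 + B 2 1) + δ * (B 1 3 + B 3 1) + β ^ 2 * B 2 2
    + β * δ * (B 2 3 + B 3 2) + δ ^ 2 * B 3 3 with hc
  have h2 : (C (2:ℝ) : S4) = 2 := map_ofNat C 2
  have key : (∑ i, ∑ k, C (B i k) * X (σ i) * X (σ k) : S4) =
      gy σ θ * (C (B 0 2 + B 2 0 + 2 * α * B 2 2 + γ * (B 2 3 + B 3 2)) * X (σ 0)
        + C (B 1 2 + B 2 1 + 2 * β * B 2 2 + δ * (B 2 3 + B 3 2)) * X (σ 1)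
        + C (B 2 2) * gy σ θ + C (B 2 3 + B 3 2) * gw σ θ)
      + gw σ θ * (C (B 0 3 + B 3 0 + 2 * γ * B 3 3 + α * (B 2 3 + B 3 2)) * X (σ 0)
        + C (B 1 3 + B 3 1 + 2 * δ * B 3 3 + β * (B 2 3 + B 3 2)) * X (σ 1)
        + C (B 3 3) * gw σ θ) + C c * gQ σ θ
      + X (σ 0) * (C (e1 + c * R) * X (σ 0) + C (e2 + c * P) * X (σ 1)) := by
    simp only [Fin.sum_univ_four, gy, gw, gQ, ← hα, ← hβ, ← hγ, ← hδ, ← hP, ← hR, he1, he2, hc,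
      map_add, map_mul, map_pow, h2]
    ring
  have h3 : e1 + c * R = 0 ∧ e2 + c * P = 0 := by
    apply real_basis_uniq _ _ h
    rw [key] at hpz
    simp only [map_add, map_mul, hy, hw, hQ, zero_mul, mul_zero, zero_add, aeval_X, aeval_C,
      mul_eq_zero, ha0, false_or] at hpz
    simpa using hpz
  rw [key, h3.1, h3.2]
  simp only [map_zero, zero_mul, add_zero, mul_zero]
  exact ⟨_, _, _, _, _, _, _, _, rfl⟩

lemma perm_ex : ∀ i k : Fin 4, i ≠ k → ∃ σ : Equiv.Perm (Fin 4), σ 0 = i ∧ σ 1 = k := by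
  decide

def gensσ (σ : Equiv.Perm (Fin 4)) (θ : Fin 6 → ℝ) : Fin 27 → S4 :=
  gens (X (σ 0)) (X (σ 1)) (gy σ θ) (gw σ θ) (gQ σ θ)

lemma bad_struct (z : Fin 4 → ℂ) (i k : Fin 4)
    (h : (z i).im * (z k).re - (z i).re * (z k).im ≠ 0) (q : Fin 5 → S4)
    (hq : ∀ i, (q i).IsHomogeneous 2) (hqz : ∀ i, aeval z (q i) = 0) :
    ∃ σ θ, ∃ c : Fin 27 → ℝ, ∑ i, q i ^ 2 = ∑ j, C (c j) * gensσ σ θ j := by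
  have hik : i ≠ k := by
    rintro rfl; apply h; ring
  obtain ⟨σ, rfl, rfl⟩ := perm_ex i k hik
  have ha0 : z (σ 0) ≠ 0 := by
    intro h0; rw [h0] at h; simp at h
  obtain ⟨α, β, hy⟩ := real_basis _ _ h (z (σ 2))
  obtain ⟨γ, δ, hw⟩ := real_basis _ _ h (z (σ 3))
  obtain ⟨R, P, hQ⟩ := real_basis _ _ h (z (σ 1) ^ 2 / z (σ 0))
  rw [div_eq_iff ha0] at hQ
  have hst := quad_struct z σ h ![α, β, γ, δ, P, R] (by simp [gy]; rw [hy]; ring)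
    (by simp [gw]; rw [hw]; ring) (by simp [gQ]; linear_combination hQ)
  have : ∀ i, ∃ c : Fin 27 → ℝ, q i ^ 2 = ∑ j, C (c j) * gensσ σ ![α, β, γ, δ, P, R] j := by
    intro i
    obtain ⟨a1, a2, a3, a4, b1, b2, b4, c, hqi⟩ := hst (q i) (hq i) (hqz i)
    rw [hqi]
    exact sq_gens _ _ _ _ P R _ _ _ _ _ _ _ _ _ rfl
  choose c hc using this
  refine ⟨σ, ![α, β, γ, δ, P, R], fun j => ∑ i, c i j, ?_⟩
  simp only [hc, map_sum, Finset.sum_mul]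
  rw [Finset.sum_comm]

/-- parametrisation of the bad set -/
def badMap (σ : Equiv.Perm (Fin 4)) (t : (Fin 6 → ℝ) × (Fin 27 → ℝ) × ℝ) : VV 4 :=
  toV 4 (∑ j, C (t.2.1 j) * gensσ σ t.1 j + C t.2.2 * f0)

lemma badMap_contDiff (σ : Equiv.Perm (Fin 4)) : ContDiff ℝ 1 (badMap σ) := by
  unfold badMap
  have hθ : ∀ i : Fin 6, ContDiff ℝ 1 (fun t : (Fin 6 → ℝ) × (Fin 27 → ℝ) × ℝ => t.1 i) := by
    intro i; fun_prop
  refine Sm.toV 4 (Sm.add (Sm.sum _ fun j _ => Sm.mul (Sm.C (by fun_prop)) ?_)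
    (Sm.mul (Sm.C (by fun_prop)) (Sm.const _)))
  refine gens_Sm (Sm.const _) (Sm.const _) ?_ ?_ ?_ j
  · exact ((Sm.const _).sub ((Sm.C (hθ 0)).mul (Sm.const _))).sub ((Sm.C (hθ 1)).mul (Sm.const _))
  · exact ((Sm.const _).sub ((Sm.C (hθ 2)).mul (Sm.const _))).sub ((Sm.C (hθ 3)).mul (Sm.const _))
  · exact ((Sm.const _).sub (((Sm.C (hθ 4)).mul (Sm.const _)).mul (Sm.const _))).sub
      (((Sm.C (hθ 5)).mul (Sm.const _)).mul (Sm.const _))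

lemma bad_dense : Dense (⋃ σ, Set.range (badMap σ))ᶜ := by
  apply dense_compl_of_dimH_lt_finrank
  have h35 : Module.finrank ℝ (VV 4) = 35 := by
    rw [finrank_euclideanSpace, Fintype.card_coe, Finset.card_finsuppAntidiag_nat_eq_choose]
    rfl
  rw [dimH_iUnion, h35]
  refine lt_of_le_of_lt (b := (34 : ENNReal)) (iSup_le fun σ => ?_) (by norm_num)
  refine (badMap_contDiff σ).dimH_range_le.trans ?_
  have : Module.finrank ℝ ((Fin 6 → ℝ) × (Fin 27 → ℝ) × ℝ) = 34 := by simp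
  rw [this]; norm_num



lemma InSigma.add' {f g : S4} (hf : InSigma 4 2 f) (hg : InSigma 4 2 g) : InSigma 4 2 (f + g) := by
  obtain ⟨r, p, hp, rfl⟩ := hf
  obtain ⟨s, q, hq, rfl⟩ := hg
  refine ⟨r + s, Fin.append p q, fun i => ?_, ?_⟩
  · refine Fin.addCases (fun i => ?_) (fun i => ?_) i
    · rw [Fin.append_left]; exact hp i
    · rw [Fin.append_right]; exact hq i
  · rw [Fin.sum_univ_add]; simp

lemma InSigma.zero' : InSigma 4 2 (0 : S4) := ⟨0, fun _ => 0, fun i => i.elim0, by simp⟩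

lemma InSigma.sq {p : S4} (hp : p.IsHomogeneous 2) : InSigma 4 2 (p ^ 2) :=
  ⟨1, fun _ => p, fun _ => hp, by simp⟩

lemma InSigma.smul' {f : S4} (hf : InSigma 4 2 f) {a : ℝ} (ha : 0 ≤ a) : InSigma 4 2 (a • f) := by
  obtain ⟨r, p, hp, rfl⟩ := hf
  refine ⟨r, fun i => C (Real.sqrt a) * p i, fun i => ?_, ?_⟩
  · simpa using (isHomogeneous_C _ (Real.sqrt a)).mul (hp i)
  · simp only [mul_pow, ← map_pow, Real.sq_sqrt ha, smul_eq_C_mul, Finset.mul_sum]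

lemma InSigma.sum' {ι : Type*} (s : Finset ι) (f : ι → S4) (h : ∀ i ∈ s, InSigma 4 2 (f i)) :
    InSigma 4 2 (∑ i ∈ s, f i) := by
  classical
  induction s using Finset.induction_on with
  | empty => simpa using InSigma.zero'
  | insert a s ha ih =>
    rw [Finset.sum_insert ha]
    exact (h a (Finset.mem_insert_self _ _)).add'
      (ih fun i hi => h i (Finset.mem_insert_of_mem hi))

lemma InSigma.eval_nonneg {f : S4} (hf : InSigma 4 2 f) (x : Fin 4 → ℝ) : 0 ≤ eval x f := by
  obtain ⟨r, p, hp, rfl⟩ := hf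
  simp only [map_sum, map_pow]
  exact Finset.sum_nonneg fun i _ => sq_nonneg _

lemma InSigma.homog {f : S4} (hf : InSigma 4 2 f) : f.IsHomogeneous 4 := by
  obtain ⟨r, p, hp, rfl⟩ := hf
  exact sum_sq_homog _ _ fun i _ => hp i

lemma f0_pos (x : Fin 4 → ℝ) (hx : x ≠ 0) : 0 < eval x f0 := by
  simp only [f0, map_sum, map_pow, eval_X]
  obtain ⟨i, hi⟩ := Function.ne_iff.1 hx
  have : x i ≠ 0 := hi
  exact Finset.sum_pos' (fun i _ => by positivity) ⟨i, Finset.mem_univ _, by positivity⟩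

lemma f0_range : toV 4 f0 ∈ Set.range Phi := by
  refine ⟨fun i => toV 2 ((![X 0 ^ 2, X 1 ^ 2, X 2 ^ 2, X 3 ^ 2, 0] : Fin 5 → S4) i), ?_⟩
  unfold Phi
  congr 1
  have h2 : ∀ i : Fin 4, (X i ^ 2 : S4).IsHomogeneous 2 := fun i => by
    simpa using (isHomogeneous_X ℝ i).pow 2
  have : ∀ i, ofV 2 (toV 2 ((![X 0 ^ 2, X 1 ^ 2, X 2 ^ 2, X 3 ^ 2, 0] : Fin 5 → S4) i)) =
      (![X 0 ^ 2, X 1 ^ 2, X 2 ^ 2, X 3 ^ 2, 0] : Fin 5 → S4) i := by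
    intro i
    apply ofV_toV
    fin_cases i
    exacts [h2 0, h2 1, h2 2, h2 3, isHomogeneous_zero _ _ _]
  simp only [this, f0, Fin.sum_univ_four, Fin.sum_univ_five]
  simp
  ring

lemma f0_sigma : InSigma 4 2 f0 := by
  refine InSigma.sum' _ _ fun i _ => ?_
  have : (X i ^ 4 : S4) = (X i ^ 2) ^ 2 := by ring
  rw [this]
  exact InSigma.sq (by simpa using (isHomogeneous_X ℝ i).pow 2)

lemma generic_range (f1 : VV 4) (hS : InSigma 4 2 (ofV 4 f1))
    (hpos : ∀ x : Fin 4 → ℝ, x ≠ 0 → 0 < eval x (ofV 4 f1))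
    (hgen : f1 ∉ ⋃ σ, Set.range (badMap σ)) : f1 ∈ Set.range Phi := by
  have hof : ∀ t : ℝ, ofV 4 (toV 4 f0 + t • (f1 - toV 4 f0)) =
      (1 - t) • f0 + t • ofV 4 f1 := by
    intro t
    rw [map_add, map_smul, map_sub, ofV_toV 4 _ f0_homog, smul_sub, sub_smul, one_smul]
    abel
  refine path_lemma (toV 4 f0) f1 f0_range (fun t ht => ?_) (fun t ht => ?_)
  · rw [hof]
    exact (f0_sigma.smul' (by linarith [ht.2])).add' (hS.smul' ht.1)
  rintro ⟨q, ⟨z, hz, hqz⟩, hq⟩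
  have h1 : ∑ i, ofV 2 (q i) ^ 2 = (1 - t) • f0 + t • ofV 4 f1 := by
    rw [← hof, ← hq, ofV_Phi]
  have hz0 : z ≠ 0 := by rintro rfl; simp at hz
  rcases eq_or_lt_of_le ht.1 with h0 | h0
  · subst h0
    apply hz0
    refine f0_nonsing (fun i => ofV 2 (q i)) ?_ z hqz
    rw [h1]; simp
  by_cases hreal : ∃ i k, (z i).im * (z k).re - (z i).re * (z k).im ≠ 0
  · obtain ⟨i, k, hik⟩ := hreal
    obtain ⟨σ, θ, c, hc⟩ := bad_struct z i k hik (fun i => ofV 2 (q i)) (fun i => ofV_homog 2 _) hqz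
    apply hgen
    refine Set.mem_iUnion.2 ⟨σ, ⟨(θ, fun j => t⁻¹ * c j, t⁻¹ * (t - 1)), ?_⟩⟩
    unfold badMap
    rw [← toV_ofV 4 f1]
    congr 1
    have h2 : ofV 4 f1 = t⁻¹ • (∑ j, C (c j) * gensσ σ θ j + (t - 1) • f0) := by
      rw [← hc, h1, eq_inv_smul_iff₀ h0.ne', sub_smul, sub_smul]
      abel
    rw [h2]
    simp only [smul_add, Finset.smul_sum, smul_eq_C_mul, map_mul, mul_assoc]
  · push Not at hreal
    obtain ⟨k, hk⟩ := Function.ne_iff.1 hz0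
    have hk : z k ≠ 0 := hk
    let x : Fin 4 → ℝ := fun i => (z i * (starRingEnd ℂ) (z k)).re
    have hx : ∀ i, (x i : ℂ) = (starRingEnd ℂ) (z k) * z i := by
      intro i
      apply Complex.ext
      · simp [x]; ring
      · simp; linear_combination (-1) * hreal i k
    have hx0 : x ≠ 0 := by
      intro h
      have h3 := hx k
      rw [h] at h3
      simp [hk] at h3
    have hev : ∀ i, eval x (ofV 2 (q i)) = 0 := by
      intro i
      obtain ⟨A, hA⟩ := quad_repr _ (ofV_homog 2 (q i))
      have h4 := hqz i
      rw [hA] at h4 ⊢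
      have h5 : ((eval x (∑ i, ∑ k, C (A i k) * X i * X k) : ℝ) : ℂ) =
          (starRingEnd ℂ) (z k) ^ 2 * aeval z (∑ i, ∑ k, C (A i k) * X i * X k) := by
        simp only [map_sum, map_mul, eval_C, eval_X, aeval_C, aeval_X, Complex.ofReal_sum,
          Complex.ofReal_mul, hx, Finset.mul_sum, Complex.coe_algebraMap]
        refine Finset.sum_congr rfl fun i _ => Finset.sum_congr rfl fun j _ => ?_
        ring
      rw [h4, mul_zero] at h5
      exact_mod_cast h5
    have h6 := congrArg (eval x) h1
    simp only [map_sum, map_pow, hev, map_add, smul_eval] at h6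
    have h7 := f0_pos x hx0
    have h8 := hpos x hx0
    simp at h6
    nlinarith [ht.2, mul_pos h0 h8, mul_nonneg (sub_nonneg.2 ht.2) h7.le]

def WW : S4 := ∑ ij : Fin 4 × Fin 4, (X ij.1 * X ij.2) ^ 2

lemma XX_homog (i j : Fin 4) : (X i * X j : S4).IsHomogeneous 2 :=
  (isHomogeneous_X ℝ i).mul (isHomogeneous_X ℝ j)

lemma WW_sigma : InSigma 4 2 WW := InSigma.sum' _ _ fun ij _ => InSigma.sq (XX_homog _ _)

lemma WW_sub (i j : Fin 4) : InSigma 4 2 (WW - (X i * X j) ^ 2) := by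
  unfold WW
  rw [← Finset.add_sum_erase _ _ (Finset.mem_univ (i, j)), add_sub_cancel_left]
  exact InSigma.sum' _ _ fun ij _ => InSigma.sq (XX_homog _ _)

/-- `p` is absorbed by multiples of `WW` -/
def Absb (p : S4) : Prop := ∃ K : ℝ, 0 ≤ K ∧ ∀ c : ℝ, |c| ≤ 1 → InSigma 4 2 (K • WW + c • p)

lemma Absb.of_homog (p : S4) (hp : p.IsHomogeneous 4) : Absb p := by
  have h : p ∈ homogeneousSubmodule (Fin 4) ℝ 4 := hp
  rw [← homogeneousSubmodule_one_pow, homogeneousSubmodule_one_eq_span_X, pow_succ, pow_succ,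
    pow_two, Submodule.span_mul_span, Submodule.span_mul_span, Submodule.span_mul_span] at h
  refine Submodule.span_induction (p := fun p _ => Absb p) ?_ ?_ ?_ ?_ h
  · rintro _ ⟨_, ⟨_, ⟨_, ⟨i, rfl⟩, _, ⟨j, rfl⟩, rfl⟩, _, ⟨k, rfl⟩, rfl⟩, _, ⟨l, rfl⟩, rfl⟩
    refine ⟨2, by norm_num, fun c hc => ?_⟩
    have hc2 : c ^ 2 ≤ 1 := by rwa [sq_le_one_iff_abs_le_one]
    have e : (2:ℝ) • WW + c • ((X i * X j) * X k * X l : S4) =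
        (WW - (X i * X j) ^ 2) + (WW - (X k * X l) ^ 2)
        + ((X i * X j + C (c / 2) * (X k * X l)) ^ 2 + (1 - c ^ 2 / 4) • (X k * X l) ^ 2) := by
      have h2 : (C c : S4) = 2 * C (c / 2) := by
        rw [← map_ofNat C 2, ← map_mul]; congr 1; ring
      have h4 : (C (1 - c ^ 2 / 4) : S4) = 1 - C (c / 2) ^ 2 := by
        rw [← map_one C, ← map_pow, ← map_sub]; congr 1; ring
      rw [smul_eq_C_mul, smul_eq_C_mul, smul_eq_C_mul, h4, h2, map_ofNat]
      ring
    change InSigma 4 2 ((2:ℝ) • WW + c • ((X i * X j) * X k * X l : S4))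
    rw [e]
    refine ((WW_sub i j).add' (WW_sub k l)).add' ((InSigma.sq ?_).add'
      ((InSigma.sq (XX_homog k l)).smul' (by linarith)))
    refine (XX_homog i j).add ?_
    simpa using (isHomogeneous_C _ (c / 2)).mul (XX_homog k l)
  · exact ⟨0, le_rfl, fun c _ => by simpa using InSigma.zero'⟩
  · rintro x y _ _ ⟨K, hK, h1⟩ ⟨L, hL, h2⟩
    refine ⟨K + L, by positivity, fun c hc => ?_⟩
    have := (h1 c hc).add' (h2 c hc)
    convert this using 1
    rw [add_smul, smul_add]; abel
  · rintro a x _ ⟨K, hK, h1⟩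
    refine ⟨(|a| + 1) * K, by positivity, fun c hc => ?_⟩
    have hd : |c * a / (|a| + 1)| ≤ 1 := by
      rw [abs_div, abs_mul, abs_of_pos (show (0:ℝ) < |a| + 1 by positivity),
        div_le_one (by positivity)]
      nlinarith [abs_nonneg a, abs_nonneg c]
    have := (h1 _ hd).smul' (show (0:ℝ) ≤ |a| + 1 by positivity)
    convert this using 1
    rw [smul_add, smul_smul, smul_smul, smul_smul]
    congr 2
    field_simp

lemma interior_ex : ∃ K : ℝ, ∀ y : VV 4, ‖y‖ ≤ 1 → InSigma 4 2 (K • WW + ofV 4 y) := by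
  have h : ∀ m : Mon 4, Absb (monomial m.1 1) := fun m =>
    Absb.of_homog _ (isHomogeneous_monomial _ (mon_degree m))
  choose K hK h using h
  refine ⟨∑ m, K m, fun y hy => ?_⟩
  rw [ofV_def, Finset.sum_smul, ← Finset.sum_add_distrib]
  refine InSigma.sum' _ _ fun m _ => ?_
  have := h m (y m) ((PiLp.norm_apply_le y m).trans hy)
  simpa [smul_monomial] using this

lemma upper_bound (f : S4) (hf : InSigma 4 2 f) : IsSOS 4 2 5 f := by
  have hIm : IsClosed (Set.range Phi) := by
    rw [← Set.image_univ]; exact Phi_closed isClosed_univ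
  obtain ⟨K, hK⟩ := interior_ex
  set G : VV 4 := toV 4 (K • WW + f0) with hG
  have hGo : ofV 4 G = K • WW + f0 := by
    apply ofV_toV
    refine IsHomogeneous.add ?_ f0_homog
    rw [smul_eq_C_mul]
    simpa using (isHomogeneous_C _ K).mul WW_sigma.homog
  have hmem : toV 4 f ∈ closure (Set.range Phi) := by
    rw [Metric.mem_closure_iff]
    intro e he
    set ε : ℝ := e / (2 * (‖G‖ + 1)) with hε
    have hεp : 0 < ε := by positivity
    obtain ⟨f1, hf1, hball⟩ := bad_dense.exists_mem_open
      (Metric.isOpen_ball (x := toV 4 f + ε • G) (ε := ε))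
      ⟨_, Metric.mem_ball_self hεp⟩
    rw [Metric.mem_ball, dist_eq_norm] at hball
    set y : VV 4 := ε⁻¹ • (f1 - (toV 4 f + ε • G)) with hy
    have hyn : ‖y‖ ≤ 1 := by
      rw [hy, norm_smul, Real.norm_of_nonneg (by positivity), inv_mul_le_iff₀ hεp]
      linarith
    have hfy : f1 = toV 4 f + ε • (G + y) := by
      rw [hy, smul_add, smul_inv_smul₀ hεp.ne']; abel
    have hof : ofV 4 f1 = (f + ε • (K • WW + ofV 4 y)) + ε • f0 := by
      rw [hfy, map_add, map_smul, map_add, hGo, ofV_toV 4 f hf.homog]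
      simp only [smul_add]; abel
    have hs1 := hf.add' ((hK y hyn).smul' hεp.le)
    refine ⟨f1, generic_range f1 ?_ (fun x hx => ?_) hf1, ?_⟩
    · rw [hof]
      exact hs1.add' (f0_sigma.smul' hεp.le)
    · rw [hof, map_add, smul_eval]
      have := hs1.eval_nonneg x
      have := mul_pos hεp (f0_pos x hx)
      linarith
    · rw [dist_comm, dist_eq_norm, hfy, add_sub_cancel_left, norm_smul,
        Real.norm_of_nonneg hεp.le]
      have h1 : ‖G + y‖ ≤ ‖G‖ + 1 := (norm_add_le _ _).trans (by linarith)
      have h2 : ε * (‖G‖ + 1) = e / 2 := by rw [hε]; field_simp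
      have := mul_le_mul_of_nonneg_left h1 hεp.le
      linarith
  rw [hIm.closure_eq] at hmem
  obtain ⟨q, hq⟩ := hmem
  refine ⟨fun i => ofV 2 (q i), fun i => ofV_homog 2 _, ?_⟩
  rw [← ofV_Phi, hq, ofV_toV 4 f hf.homog]

/-- `p(4,4) = 5`: every quaternary quartic that is a sum of squares of quadratic
forms is a sum of five squares of quadratic forms, and some such quartic is not
a sum of four squares of quadratic forms. -/
theorem p_four_four :
    (∀ f : MvPolynomial (Fin 4) ℝ, InSigma 4 2 f → IsSOS 4 2 5 f) ∧
    (∃ f : MvPolynomial (Fin 4) ℝ, InSigma 4 2 f ∧ ¬ IsSOS 4 2 4 f) := by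
  exact ⟨upper_bound, lower_bound⟩
end
end

section
/- The set {f ∈ Σ_{3,6} : ℓ(f) = 4} of ternary sextic sums of squares whose sum of squares length is exactly 4 is an open and dense subset of Σ_{3,6} (in the subspace topology induced from ℝ[x_1,x_2,x_3]_6). -/
open MvPolynomial

noncomputable section

/-- The coefficientwise topology on polynomials; on each finite-dimensional
subspace of forms of fixed degree it induces the standard topology. -/
instance (n : ℕ) : TopologicalSpace (MvPolynomial (Fin n) ℝ) :=
  TopologicalSpace.induced (fun f (m : Fin n →₀ ℕ) => MvPolynomial.coeff m f) inferInstance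

/-- The cone `Σ_{3,6}` as a subset of the space `ℝ[x₁,x₂,x₃]₆` of sextic forms. -/
def SigmaSet36 : Set (MvPolynomial.homogeneousSubmodule (Fin 3) ℝ 6) :=
  {f | InSigma 3 3 (f : MvPolynomial (Fin 3) ℝ)}


/-! ### Part A: algebra of ternary forms -/

namespace SexticAux

/-- Abbreviation for ternary real polynomials. -/
abbrev R3 := MvPolynomial (Fin 3) ℝ

/-- Restriction to the line `z = 0`, dehomogenized by `y = 1`. -/
def ps : R3 →ₐ[ℝ] Polynomial ℝ := aeval ![Polynomial.X, 1, 0]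

/-- Homogenization of a univariate polynomial to a binary form of degree `m`. -/
def th (m : ℕ) (w : Polynomial ℝ) : R3 :=
  ∑ i ∈ Finset.range (m + 1), C (w.coeff i) * (X 0 ^ i * X 1 ^ (m - i))

lemma th_hom (m : ℕ) (w : Polynomial ℝ) : (th m w).IsHomogeneous m := by
  unfold th
  apply IsHomogeneous.sum
  intro i hi
  have hi' : i ≤ m := by simpa [Nat.lt_succ_iff] using hi
  have h1 : (X 0 ^ i * X 1 ^ (m - i) : R3).IsHomogeneous (i + (m - i)) :=
    (isHomogeneous_X_pow _ _).mul (isHomogeneous_X_pow _ _)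
  have h2 := (isHomogeneous_C (Fin 3) (w.coeff i)).mul h1
  have : 0 + (i + (m - i)) = m := by omega
  rwa [this] at h2

lemma ps_th (m : ℕ) (w : Polynomial ℝ) (hw : w.natDegree ≤ m) : ps (th m w) = w := by
  unfold th ps
  simp only [map_sum, map_mul, map_pow, aeval_X, algHom_C]
  simp
  conv_rhs => rw [Polynomial.as_sum_range_C_mul_X_pow' w (Nat.lt_succ_of_le hw)]

lemma degree_three (d : Fin 3 →₀ ℕ) : Finsupp.degree d = d 0 + d 1 + d 2 := by
  rw [Finsupp.degree_eq_sum, Fin.sum_univ_three]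

lemma ps_coeff (m : ℕ) (g : R3) (hg : g.IsHomogeneous m) (d : Fin 3 →₀ ℕ)
    (hd : Finsupp.degree d = m) (hd2 : d 2 = 0) : (ps g).coeff (d 0) = coeff d g := by
  unfold ps
  rw [aeval_def, eval₂_eq', Polynomial.finsetSum_coeff]
  rw [Finset.sum_eq_single d]
  · simp [Fin.prod_univ_three, hd2]
  · intro e he hne
    rw [degree_three] at hd
    have hedeg : Finsupp.degree e = m := by
      by_contra h
      exact (mem_support_iff.mp he) (hg.coeff_eq_zero h)
    rw [degree_three] at hedeg
    by_cases h2 : e 2 = 0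
    · have h0 : e 0 ≠ d 0 := by
        intro h0
        apply hne
        ext i
        fin_cases i
        · exact h0
        · simp; omega
        · simp; omega
      simp [Fin.prod_univ_three, h2, Polynomial.coeff_X_pow, Ne.symm h0]
    · simp [Fin.prod_univ_three, h2]
  · intro h
    simp [notMem_support_iff.mp h]

lemma ps_natDegree (m : ℕ) (g : R3) (hg : g.IsHomogeneous m) : (ps g).natDegree ≤ m := by
  unfold ps
  rw [aeval_def, eval₂_eq']
  apply Polynomial.natDegree_sum_le_of_forall_le
  intro e he
  have hedeg : Finsupp.degree e = m := by
    by_contra h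
    exact (mem_support_iff.mp he) (hg.coeff_eq_zero h)
  rw [degree_three] at hedeg
  by_cases h2 : e 2 = 0
  · simp only [Fin.prod_univ_three, h2]
    simp
    refine (Polynomial.natDegree_C_mul_X_pow_le _ _).trans (by omega)
  · simp [Fin.prod_univ_three, h2]

lemma hom_of_z_mul (m : ℕ) (g' : R3) (h : (X 2 * g' : R3).IsHomogeneous m) :
    g'.IsHomogeneous (m - 1) := by
  intro d hd
  have h1 : coeff (Finsupp.single 2 1 + d) (X 2 * g' : R3) ≠ 0 := by
    rwa [coeff_X_mul]
  have h2 : Finsupp.degree (Finsupp.single 2 1 + d) = m := by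
    by_contra hne
    exact h1 (h.coeff_eq_zero hne)
  have h3 : Finsupp.degree d = m - 1 := by
    rw [map_add] at h2
    simp at h2
    omega
  rw [← h3, Finsupp.degree_eq_weight_one]
  rfl

lemma zdiv (m : ℕ) (g : R3) (hg : g.IsHomogeneous m) (h : ps g = 0) :
    ∃ g' : R3, g = X 2 * g' ∧ g'.IsHomogeneous (m - 1) := by
  have hdvd : (X 2 : R3) ∣ g := by
    rw [X_dvd_iff_modMonomial_eq_zero]
    ext d
    by_cases hd : Finsupp.single 2 1 ≤ d
    · rw [coeff_modMonomial_of_le _ hd]; simp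
    · rw [coeff_modMonomial_of_not_le _ hd]
      have hd2 : d 2 = 0 := by
        by_contra h0
        apply hd
        rw [Finsupp.single_le_iff]
        omega
      by_cases hdeg : Finsupp.degree d = m
      · rw [← ps_coeff m g hg d hdeg hd2, h]; simp
      · rw [hg.coeff_eq_zero hdeg]; simp
  obtain ⟨g', rfl⟩ := hdvd
  exact ⟨g', rfl, by
    have hh := hom_of_z_mul m g' hg
    exact hh⟩

/-- The data of two cubics in general position with respect to the line `z = 0`. -/
structure Pair (a b : R3) : Prop where
  ha : a.IsHomogeneous 3
  hb : b.IsHomogeneous 3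
  hcop : IsCoprime (ps a) (ps b)
  hda : (ps a).natDegree ≤ 2
  hdb : (ps b).natDegree = 3

lemma Pair.reduce {a b : R3} (P : Pair a b) (n : ℕ) (g : R3) (hg : g.IsHomogeneous (n + 3))
    (u v : Polynomial ℝ) (hu : u.natDegree ≤ n) (hv : v.natDegree ≤ n)
    (h : ps g = u * ps a + v * ps b) :
    ∃ g' : R3, g = th n u * a + th n v * b + X 2 * g' ∧ g'.IsHomogeneous (n + 2) := by
  obtain ⟨g', h1, h2⟩ := zdiv (n + 3) (g - (th n u * a + th n v * b))
    (hg.sub (((th_hom n u).mul P.ha).add ((th_hom n v).mul P.hb)))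
    (by simp [ps_th, hu, hv, h])
  exact ⟨g', by rw [← h1]; ring, h2⟩

/-- `z` is a nonzerodivisor modulo `(a, b)`. -/
lemma Pair.z_reg {a b : R3} (P : Pair a b) (m : ℕ) (g u v : R3) (hu : u.IsHomogeneous m)
    (hv : v.IsHomogeneous m) (h : X 2 * g = u * a + v * b) :
    ∃ u' v' : R3, g = u' * a + v' * b := by
  have h1 : ps u * ps a + ps v * ps b = 0 := by
    rw [← map_mul, ← map_mul, ← map_add, ← h, map_mul]
    simp [ps]
  have hb0 : ps b ≠ 0 := by
    intro h0
    have := P.hdb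
    rw [h0] at this
    simp at this
  have hdvd : ps b ∣ ps u := by
    apply P.hcop.symm.dvd_of_dvd_mul_right
    exact ⟨- ps v, by linear_combination h1⟩
  obtain ⟨w, hw⟩ := hdvd
  have hw2 : ps v = - (ps a * w) := by
    have : ps b * (ps v + ps a * w) = 0 := by rw [hw] at h1; linear_combination h1
    rcases mul_eq_zero.mp this with h0 | h0
    · exact absurd h0 hb0
    · linear_combination h0
  have key : ∃ W : R3, ps W = w ∧ ((W = 0) ∨ (W.IsHomogeneous (m - 3) ∧ 3 ≤ m)) := by
    by_cases hw0 : w = 0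
    · exact ⟨0, by simp [hw0], Or.inl rfl⟩
    · have hd : (ps u).natDegree = 3 + w.natDegree := by
        rw [hw, Polynomial.natDegree_mul hb0 hw0, P.hdb]
      have hd2 := ps_natDegree m u hu
      exact ⟨th (m - 3) w, ps_th _ _ (by omega), Or.inr ⟨th_hom _ _, by omega⟩⟩
  obtain ⟨W, hW, hWh⟩ := key
  have hWa : (W * a).IsHomogeneous m := by
    rcases hWh with h0 | ⟨h0, h3⟩
    · rw [h0, zero_mul]; exact isHomogeneous_zero _ _ _
    · have := h0.mul P.ha
      rwa [Nat.sub_add_cancel h3] at this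
  have hWb : (W * b).IsHomogeneous m := by
    rcases hWh with h0 | ⟨h0, h3⟩
    · rw [h0, zero_mul]; exact isHomogeneous_zero _ _ _
    · have := h0.mul P.hb
      rwa [Nat.sub_add_cancel h3] at this
  obtain ⟨u', hu', -⟩ := zdiv m (u - W * b) (hu.sub hWb) (by simp [hW, hw]; ring)
  obtain ⟨v', hv', -⟩ := zdiv m (v + W * a) (hv.add hWa) (by simp [hW, hw2]; ring)
  refine ⟨u', v', ?_⟩
  apply mul_left_cancel₀ (X_ne_zero (2 : Fin 3) : (X 2 : R3) ≠ 0)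
  rw [h]
  linear_combination a * hu' + b * hv'

lemma hc_mul (n k : ℕ) (u a : R3) (ha : a.IsHomogeneous k) :
    homogeneousComponent n (u * a) =
      if k ≤ n then homogeneousComponent (n - k) u * a else 0 := by
  have h1 : ∀ i, homogeneousComponent n (homogeneousComponent i u * a) =
      if n = i + k then homogeneousComponent i u * a else 0 := fun i =>
    homogeneousComponent_of_mem ((mem_homogeneousSubmodule _ _).mpr
      ((homogeneousComponent_isHomogeneous i u).mul ha))
  conv_lhs => rw [← sum_homogeneousComponent u]
  rw [Finset.sum_mul, map_sum]
  simp only [h1]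
  by_cases hk : k ≤ n
  · rw [if_pos hk, Finset.sum_eq_single (n - k)]
    · rw [if_pos (by omega)]
    · intro i _ hi
      rw [if_neg (by omega)]
    · intro hi
      rw [if_pos (by omega), homogeneousComponent_eq_zero, zero_mul]
      simp at hi
      omega
  · rw [if_neg hk]
    apply Finset.sum_eq_zero
    intro i _
    rw [if_neg (by omega)]

/-- The ideal generated by a pair. -/
def idl (a b : R3) : Ideal R3 := Ideal.span {a, b}

lemma mem_idl {a b g : R3} : g ∈ idl a b ↔ ∃ u v, g = u * a + v * b := by
  unfold idl
  rw [Ideal.mem_span_pair]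
  constructor
  · rintro ⟨u, v, h⟩; exact ⟨u, v, h.symm⟩
  · rintro ⟨u, v, h⟩; exact ⟨u, v, h.symm⟩

lemma Pair.hc_mem {a b : R3} (P : Pair a b) {g : R3} (hg : g ∈ idl a b) (n : ℕ) :
    ∃ u v : R3, u.IsHomogeneous (n - 3) ∧ v.IsHomogeneous (n - 3) ∧
      homogeneousComponent n g = u * a + v * b := by
  obtain ⟨u, v, rfl⟩ := mem_idl.mp hg
  rw [map_add, hc_mul n 3 u a P.ha, hc_mul n 3 v b P.hb]
  by_cases h : 3 ≤ n
  · exact ⟨_, _, homogeneousComponent_isHomogeneous _ u, homogeneousComponent_isHomogeneous _ v,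
      by simp [h]⟩
  · exact ⟨0, 0, isHomogeneous_zero _ _ _, isHomogeneous_zero _ _ _, by simp [h]⟩

lemma Pair.z_reg' {a b : R3} (P : Pair a b) (n : ℕ) (g : R3) (hg : g.IsHomogeneous n)
    (h : X 2 * g ∈ idl a b) : g ∈ idl a b := by
  obtain ⟨u, v, hu, hv, huv⟩ := P.hc_mem h (n + 1)
  have hh : (X 2 * g : R3).IsHomogeneous (n + 1) := by
    rw [add_comm]; exact (isHomogeneous_X ℝ (2 : Fin 3)).mul hg
  rw [homogeneousComponent_of_mem ((mem_homogeneousSubmodule _ _).mpr hh), if_pos rfl] at huv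
  exact mem_idl.mpr (P.z_reg _ g u v hu hv huv)

lemma Pair.z_pow_reg {a b : R3} (P : Pair a b) (k n : ℕ) (g : R3) (hg : g.IsHomogeneous n)
    (h : X 2 ^ k * g ∈ idl a b) : g ∈ idl a b := by
  induction k with
  | zero => simpa using h
  | succ k ih =>
    apply ih
    apply P.z_reg' (k * 1 + n)
    · have := ((isHomogeneous_X ℝ (2 : Fin 3)).pow k).mul hg
      simpa using this
    · convert h using 1; ring

/-- Homogeneous elements of the dehomogenized ideal. -/
lemma Pair.dehom {a b : R3} (P : Pair a b) (n : ℕ) (g h : R3) (hg : g.IsHomogeneous n)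
    (hgh : (X 2 - 1) * h - g ∈ idl a b) : g ∈ idl a b := by
  have comp : ∀ i, homogeneousComponent i ((X 2 - 1) * h - g) ∈ idl a b := by
    intro i
    obtain ⟨u, v, -, -, huv⟩ := P.hc_mem hgh i
    exact mem_idl.mpr ⟨u, v, huv⟩
  have comp0 : - homogeneousComponent 0 h - homogeneousComponent 0 g ∈ idl a b := by
    have := comp 0
    rw [show (X 2 - 1) * h - g = h * X 2 - h - g by ring, map_sub, map_sub,
      hc_mul 0 1 h _ (isHomogeneous_X ℝ (2 : Fin 3))] at this
    simpa using this
  have compS : ∀ i, X 2 * homogeneousComponent i h - homogeneousComponent (i + 1) h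
      - homogeneousComponent (i + 1) g ∈ idl a b := by
    intro i
    have := comp (i + 1)
    rw [show (X 2 - 1) * h - g = h * X 2 - h - g by ring, map_sub, map_sub,
      hc_mul (i + 1) 1 h _ (isHomogeneous_X ℝ (2 : Fin 3))] at this
    simpa [mul_comm] using this
  have hgc : ∀ i, homogeneousComponent i g = if i = n then g else 0 := fun i =>
    homogeneousComponent_of_mem ((mem_homogeneousSubmodule _ _).mpr hg)
  have low : ∀ i, i < n → homogeneousComponent i h ∈ idl a b := by
    intro i
    induction i with
    | zero =>
      intro hi
      rw [hgc, if_neg (by omega), sub_zero] at comp0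
      simpa using comp0
    | succ i ih =>
      intro hi
      have h1 := compS i
      rw [hgc, if_neg (by omega), sub_zero] at h1
      have h2 := (idl a b).mul_mem_left (X 2) (ih (by omega))
      have := (idl a b).sub_mem h2 h1
      simpa using this
  have high : ∀ k, X 2 ^ k * homogeneousComponent n h - homogeneousComponent (n + k) h
      ∈ idl a b := by
    intro k
    induction k with
    | zero => simp
    | succ k ih =>
      have h1 := compS (n + k)
      rw [hgc, if_neg (by omega), sub_zero] at h1
      have h2 := (idl a b).mul_mem_left (X 2) ih
      have := (idl a b).add_mem h2 h1
      convert this using 1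
      rw [show n + (k + 1) = n + k + 1 by ring]
      ring
  have hn : homogeneousComponent n h ∈ idl a b := by
    have h1 := high (h.totalDegree + 1)
    rw [homogeneousComponent_eq_zero (n + (h.totalDegree + 1)) h (by omega), sub_zero] at h1
    exact P.z_pow_reg _ n _ (homogeneousComponent_isHomogeneous _ _) h1
  cases n with
  | zero =>
    rw [hgc, if_pos rfl] at comp0
    have := (idl a b).add_mem comp0 hn
    have := (idl a b).neg_mem this
    simpa using this
  | succ n =>
    have h1 := compS n
    rw [hgc, if_pos rfl] at h1
    have h2 := (idl a b).mul_mem_left (X 2) (low n (by omega))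
    have h3 := (idl a b).sub_mem ((idl a b).sub_mem h2 hn) h1
    convert h3 using 1
    ring

lemma th_add (m : ℕ) (v w : Polynomial ℝ) : th m (v + w) = th m v + th m w := by
  unfold th
  rw [← Finset.sum_add_distrib]
  apply Finset.sum_congr rfl
  intro i _
  rw [Polynomial.coeff_add, C_add]
  ring

lemma th_smul (m : ℕ) (r : ℝ) (w : Polynomial ℝ) : th m (r • w) = r • th m w := by
  unfold th
  rw [Finset.smul_sum]
  apply Finset.sum_congr rfl
  intro i _
  rw [Polynomial.coeff_smul, smul_eq_mul, C_mul, smul_eq_C_mul]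
  ring

/-- The functional on univariate polynomials induced by a functional on quartic forms. -/
def tau (σ : R3 →ₗ[ℝ] ℝ) : Polynomial ℝ →ₗ[ℝ] ℝ where
  toFun w := σ (th 4 w)
  map_add' v w := by rw [th_add, map_add]
  map_smul' r w := by rw [th_smul, map_smul]; rfl

/-- Functionals killing `(a, b, z - 1)`. -/
structure JF (a b : R3) (σ : R3 →ₗ[ℝ] ℝ) : Prop where
  ha : ∀ g, σ (g * a) = 0
  hb : ∀ g, σ (g * b) = 0
  hz : ∀ g, σ (X 2 * g) = σ g

lemma Pair.bez {a b : R3} (P : Pair a b) (N : ℕ) (hN : 4 ≤ N) (g : Polynomial ℝ)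
    (hg : g.natDegree ≤ N) :
    ∃ u v : Polynomial ℝ, g = u * ps a + v * ps b ∧ u.natDegree ≤ 2 ∧ v.natDegree ≤ N - 3 := by
  have hb0 : ps b ≠ 0 := by
    intro h0
    have := P.hdb
    rw [h0] at this
    simp at this
  obtain ⟨s, t, hst⟩ := P.hcop
  have hu : ((g * s) % (ps b)).natDegree ≤ 2 := by
    have h1 := Polynomial.natDegree_mod_lt (g * s) (q := ps b) (by rw [P.hdb]; norm_num)
    rw [P.hdb] at h1
    omega
  have hE : g = ((g * s) % (ps b)) * ps a + ((g * s) / (ps b) * ps a + g * t) * ps b := by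
    have h1 := EuclideanDomain.div_add_mod (g * s) (ps b)
    have h2 : g = g * s * ps a + g * t * ps b := by linear_combination -g * hst
    linear_combination h2 - ps a * h1
  refine ⟨_, _, hE, hu, ?_⟩
  generalize (g * s) / (ps b) * ps a + g * t = v at hE
  generalize (g * s) % (ps b) = u at hE hu
  by_cases hv : v = 0
  · simp [hv]
  have h1 : (v * ps b).natDegree ≤ N := by
    have : v * ps b = g - u * ps a := by linear_combination -hE
    rw [this]
    refine (Polynomial.natDegree_sub_le _ _).trans (max_le hg ?_)
    refine Polynomial.natDegree_mul_le.trans ?_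
    have := P.hda
    omega
  rw [Polynomial.natDegree_mul hv hb0, P.hdb] at h1
  omega

lemma natDegree_drop (u : Polynomial ℝ) (n : ℕ) (hu : u.natDegree ≤ n + 1)
    (h : u.coeff (n + 1) = 0) : u.natDegree ≤ n := by
  rw [Polynomial.natDegree_le_iff_coeff_eq_zero] at hu ⊢
  intro k hk
  by_cases hkn : k = n + 1
  · rw [hkn]; exact h
  · exact hu k (by omega)

lemma tau_formula {a b : R3} (τ : Polynomial ℝ →ₗ[ℝ] ℝ)
    (hτa : ∀ l : Polynomial ℝ, l.natDegree ≤ 1 → τ (l * ps a) = 0)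
    (hτb : ∀ l : Polynomial ℝ, l.natDegree ≤ 1 → τ (l * ps b) = 0)
    (u v : Polynomial ℝ) (hu : u.natDegree ≤ 2) (hv : v.natDegree ≤ 1) :
    τ (u * ps a + v * ps b) = u.coeff 2 * τ (Polynomial.X ^ 2 * ps a) := by
  have h1 : (u - Polynomial.C (u.coeff 2) * Polynomial.X ^ 2).natDegree ≤ 1 := by
    apply natDegree_drop
    · refine (Polynomial.natDegree_sub_le _ _).trans (max_le hu ?_)
      exact Polynomial.natDegree_C_mul_X_pow_le _ _
    · simp
  have h2 := hτa _ h1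
  have h3 : u * ps a + v * ps b = (u - Polynomial.C (u.coeff 2) * Polynomial.X ^ 2) * ps a
      + u.coeff 2 • (Polynomial.X ^ 2 * ps a) + v * ps b := by
    rw [Polynomial.smul_eq_C_mul]; ring
  rw [h3, map_add, map_add, h2, hτb v hv, map_smul]
  simp

lemma tau_zero {a b : R3} (P : Pair a b) (τ : Polynomial ℝ →ₗ[ℝ] ℝ)
    (hτa : ∀ l : Polynomial ℝ, l.natDegree ≤ 1 → τ (l * ps a) = 0)
    (hτb : ∀ l : Polynomial ℝ, l.natDegree ≤ 1 → τ (l * ps b) = 0)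
    (h0 : τ (Polynomial.X ^ 2 * ps a) = 0) (g : Polynomial ℝ)
    (hg : g.natDegree ≤ 4) : τ g = 0 := by
  obtain ⟨u, v, rfl, hu, hv⟩ := P.bez 4 le_rfl g hg
  rw [tau_formula τ hτa hτb u v hu hv, h0, mul_zero]

lemma tau_three {a b : R3} (P : Pair a b) (τ : Polynomial ℝ →ₗ[ℝ] ℝ)
    (hτa : ∀ l : Polynomial ℝ, l.natDegree ≤ 1 → τ (l * ps a) = 0)
    (hτb : ∀ l : Polynomial ℝ, l.natDegree ≤ 1 → τ (l * ps b) = 0)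
    (h0 : τ (Polynomial.X ^ 2 * ps a) ≠ 0) (g : Polynomial ℝ)
    (hg : g.natDegree ≤ 3) (hg0 : τ g = 0) (hg1 : τ (Polynomial.X * g) = 0) :
    ∃ s t : ℝ, g = Polynomial.C s * ps a + Polynomial.C t * ps b := by
  obtain ⟨u, v, hE, hu, hv⟩ := P.bez 4 le_rfl g (by omega)
  have h2 : u.coeff 2 = 0 := by
    rw [hE, tau_formula τ hτa hτb u v hu hv] at hg0
    exact (mul_eq_zero.mp hg0).resolve_right h0
  have hu1 : u.natDegree ≤ 1 := natDegree_drop u 1 hu h2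
  have h1 : u.coeff 1 = 0 := by
    have : Polynomial.X * g = (Polynomial.X * u) * ps a + (Polynomial.X * v) * ps b := by
      rw [hE]; ring
    have hv0 : (Polynomial.X * v).natDegree ≤ 1 := by
      by_cases hv0 : v = 0
      · simp [hv0]
      have hb0 : ps b ≠ 0 := by
        intro h0
        have := P.hdb
        rw [h0] at this
        simp at this
      have h3 : (v * ps b).natDegree ≤ 3 := by
        have : v * ps b = g - u * ps a := by linear_combination -hE
        rw [this]
        refine (Polynomial.natDegree_sub_le _ _).trans (max_le hg ?_)
        refine Polynomial.natDegree_mul_le.trans ?_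
        have := P.hda
        omega
      rw [Polynomial.natDegree_mul hv0 hb0, P.hdb] at h3
      refine Polynomial.natDegree_mul_le.trans ?_
      simp
      omega
    have hu0 : (Polynomial.X * u).natDegree ≤ 2 := by
      refine Polynomial.natDegree_mul_le.trans ?_
      simp
      omega
    rw [this, tau_formula τ hτa hτb _ _ hu0 hv0] at hg1
    have := (mul_eq_zero.mp hg1).resolve_right h0
    simpa using this
  have hu0 : u.natDegree ≤ 0 := natDegree_drop u 0 hu1 h1
  have hv0 : v.natDegree ≤ 0 := by
    by_cases hv0 : v = 0
    · simp [hv0]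
    have hb0 : ps b ≠ 0 := by
      intro h0
      have := P.hdb
      rw [h0] at this
      simp at this
    have h3 : (v * ps b).natDegree ≤ 3 := by
      have : v * ps b = g - u * ps a := by linear_combination -hE
      rw [this]
      refine (Polynomial.natDegree_sub_le _ _).trans (max_le hg ?_)
      refine Polynomial.natDegree_mul_le.trans ?_
      have := P.hda
      omega
    rw [Polynomial.natDegree_mul hv0 hb0, P.hdb] at h3
    omega
  refine ⟨u.coeff 0, v.coeff 0, ?_⟩
  rw [← Polynomial.eq_C_of_natDegree_le_zero hu0, ← Polynomial.eq_C_of_natDegree_le_zero hv0]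
  exact hE

lemma tau_two {a b : R3} (P : Pair a b) (τ : Polynomial ℝ →ₗ[ℝ] ℝ)
    (hτa : ∀ l : Polynomial ℝ, l.natDegree ≤ 1 → τ (l * ps a) = 0)
    (hτb : ∀ l : Polynomial ℝ, l.natDegree ≤ 1 → τ (l * ps b) = 0)
    (h0 : τ (Polynomial.X ^ 2 * ps a) ≠ 0) (g : Polynomial ℝ)
    (hg : g.natDegree ≤ 2) (hg0 : τ g = 0) (hg1 : τ (Polynomial.X * g) = 0)
    (hg2 : τ (Polynomial.X ^ 2 * g) = 0) : g = 0 := by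
  obtain ⟨s, t, hst⟩ := tau_three P τ hτa hτb h0 g (by omega) hg0 hg1
  have ht : t = 0 := by
    by_contra ht
    have h1 : (Polynomial.C t * ps b).natDegree ≤ 2 := by
      have : Polynomial.C t * ps b = g - Polynomial.C s * ps a := by rw [hst]; ring
      rw [this]
      refine (Polynomial.natDegree_sub_le _ _).trans (max_le hg ?_)
      exact (Polynomial.natDegree_C_mul_le _ _).trans P.hda
    rw [Polynomial.natDegree_C_mul ht, P.hdb] at h1
    omega
  rw [ht] at hst
  have : Polynomial.X ^ 2 * g = s • (Polynomial.X ^ 2 * ps a) := by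
    rw [hst, Polynomial.smul_eq_C_mul]; simp; ring
  rw [this, map_smul, smul_eq_mul] at hg2
  have := (mul_eq_zero.mp hg2).resolve_right h0
  rw [hst, this]
  simp

lemma tau_a {a b : R3} (P : Pair a b) (σ : R3 →ₗ[ℝ] ℝ) (J : JF a b σ)
    (h3 : ∀ h : R3, h.IsHomogeneous 3 → σ h = 0)
    (l : Polynomial ℝ) (hl : l.natDegree ≤ 1) : tau σ (l * ps a) = 0 := by
  obtain ⟨g', h1, h2⟩ := P.reduce 1 (th 4 (l * ps a)) (th_hom _ _) l 0 hl (by simp) (by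
    rw [ps_th, zero_mul, add_zero]
    refine Polynomial.natDegree_mul_le.trans ?_
    have := P.hda
    omega)
  show σ (th 4 (l * ps a)) = 0
  rw [h1, map_add, map_add, J.ha, J.hb, J.hz, h3 _ h2]
  simp

lemma tau_b {a b : R3} (P : Pair a b) (σ : R3 →ₗ[ℝ] ℝ) (J : JF a b σ)
    (h3 : ∀ h : R3, h.IsHomogeneous 3 → σ h = 0)
    (l : Polynomial ℝ) (hl : l.natDegree ≤ 1) : tau σ (l * ps b) = 0 := by
  obtain ⟨g', h1, h2⟩ := P.reduce 1 (th 4 (l * ps b)) (th_hom _ _) 0 l (by simp) hl (by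
    rw [ps_th, zero_mul, zero_add]
    refine Polynomial.natDegree_mul_le.trans ?_
    have := P.hdb
    omega)
  show σ (th 4 (l * ps b)) = 0
  rw [h1, map_add, map_add, J.ha, J.hb, J.hz, h3 _ h2]
  simp

lemma sigma_eq_tau {a b : R3} (σ : R3 →ₗ[ℝ] ℝ) (J : JF a b σ)
    (h3 : ∀ h : R3, h.IsHomogeneous 3 → σ h = 0)
    (g : R3) (hg : g.IsHomogeneous 4) : σ g = tau σ (ps g) := by
  obtain ⟨g', h1, h2⟩ := zdiv 4 (g - th 4 (ps g)) (hg.sub (th_hom _ _))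
    (by rw [map_sub, ps_th _ _ (ps_natDegree 4 g hg), sub_self])
  show σ g = σ (th 4 (ps g))
  rw [← sub_eq_zero, ← map_sub, h1, J.hz, h3 _ h2]

lemma sigma_zero {a b : R3} (P : Pair a b) (σ : R3 →ₗ[ℝ] ℝ) (J : JF a b σ)
    (h3 : ∀ h : R3, h.IsHomogeneous 3 → σ h = 0)
    (h0 : tau σ (Polynomial.X ^ 2 * ps a) = 0) : σ = 0 := by
  have key : ∀ n, ∀ g : R3, g.IsHomogeneous n → σ g = 0 := by
    have low : ∀ k, ∀ n, n + k = 3 → ∀ g : R3, g.IsHomogeneous n → σ g = 0 := by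
      intro k
      induction k with
      | zero => intro n hn g hg; exact h3 g (by rwa [show n = 3 by omega] at hg)
      | succ k ih =>
        intro n hn g hg
        rw [← J.hz]
        exact ih (1 + n) (by omega) _ ((isHomogeneous_X ℝ (2 : Fin 3)).mul hg)
    intro n
    induction n with
    | zero => exact low 3 0 rfl
    | succ n ih =>
      intro g hg
      by_cases h : n + 1 ≤ 3
      · exact low (3 - (n + 1)) (n + 1) (by omega) g hg
      by_cases h4 : n + 1 = 4
      · rw [h4] at hg
        rw [sigma_eq_tau σ J h3 g hg]
        exact tau_zero P (tau σ) (tau_a P σ J h3) (tau_b P σ J h3) h0 _ (ps_natDegree 4 g hg)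
      obtain ⟨k, rfl⟩ : ∃ k, n = k + 2 := ⟨n - 2, by omega⟩
      obtain ⟨u, v, huv, hu, hv⟩ := P.bez (k + 3) (by omega) (ps g) (ps_natDegree _ g hg)
      obtain ⟨g', h1, h2⟩ := P.reduce k g hg u v (by omega) (by omega) huv
      rw [h1, map_add, map_add, J.ha, J.hb, J.hz, ih _ h2]
      simp
  apply LinearMap.ext
  intro g
  rw [← sum_homogeneousComponent g, map_sum, map_sum]
  exact Finset.sum_congr rfl fun i _ => key i _ (homogeneousComponent_isHomogeneous _ _)

/-- Multiplication of a functional by a polynomial. -/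
def actF (c : R3) (Λ : R3 →ₗ[ℝ] ℝ) : R3 →ₗ[ℝ] ℝ := Λ ∘ₗ LinearMap.mulLeft ℝ c

lemma actF_apply (c : R3) (Λ : R3 →ₗ[ℝ] ℝ) (h : R3) : actF c Λ h = Λ (c * h) := rfl

lemma JF.act {a b : R3} {Λ : R3 →ₗ[ℝ] ℝ} (J : JF a b Λ) (c : R3) : JF a b (actF c Λ) where
  ha g := by rw [actF_apply, ← mul_assoc]; exact J.ha _
  hb g := by rw [actF_apply, ← mul_assoc]; exact J.hb _
  hz g := by
    rw [actF_apply, actF_apply, ← J.hz (c * g)]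
    congr 1; ring

lemma isHomogeneous_C_mul_X_aux (s : ℝ) {n : ℕ} (a : R3) (ha : a.IsHomogeneous n) :
    (C s * a).IsHomogeneous n := by
  have := (isHomogeneous_C (Fin 3) s).mul ha
  rwa [zero_add] at this

/-- The Gorenstein duality statement. -/
lemma Pair.duality {a b : R3} (P : Pair a b) (Λ : R3 →ₗ[ℝ] ℝ) (J : JF a b Λ) (c v : R3)
    (hc3 : ∀ h : R3, h.IsHomogeneous 3 → Λ (c * h) = 0) (hc : actF c Λ ≠ 0)
    (hv : v.IsHomogeneous 3)
    (hv3 : ∀ h : R3, h.IsHomogeneous 3 → Λ (v * h) = 0)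
    (hvm : Λ (v * th 4 (Polynomial.X ^ 2 * ps a)) = 0) :
    ∃ s t : ℝ, v = s • a + t • b := by
  have hv0 : actF v Λ = 0 := sigma_zero P (actF v Λ) (J.act v) hv3 hvm
  set ρ := actF c Λ with hρ
  have Jρ : JF a b ρ := J.act c
  have hρ3 : ∀ h : R3, h.IsHomogeneous 3 → ρ h = 0 := hc3
  have hτ0 : tau ρ (Polynomial.X ^ 2 * ps a) ≠ 0 := fun h => hc (sigma_zero P ρ Jρ hρ3 h)
  have hρv : ∀ h, ρ (v * h) = 0 := by
    intro h
    have := LinearMap.congr_fun hv0 (c * h)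
    rw [actF_apply] at this
    rw [hρ, actF_apply]
    rw [← mul_assoc, mul_comm c v, mul_assoc]
    exact this
  have ta := tau_a P ρ Jρ hρ3
  have tb := tau_b P ρ Jρ hρ3
  have val : ∀ (n k : ℕ) (w : R3), w.IsHomogeneous n → n + k = 4 → (∀ h, ρ (w * h) = 0) →
      ∀ i ≤ k, tau ρ (Polynomial.X ^ i * ps w) = 0 := by
    intro n k w hw hnk hwh i hi
    have h1 : (w * th k (Polynomial.X ^ i)).IsHomogeneous 4 := by
      rw [← hnk]; exact hw.mul (th_hom _ _)
    have h2 := sigma_eq_tau ρ Jρ hρ3 _ h1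
    rw [hwh, map_mul, ps_th _ _ (by simpa using hi), mul_comm] at h2
    exact h2.symm
  -- vanishing in lower degrees
  have down : ∀ (n : ℕ) (w : R3), n ≤ 2 → w.IsHomogeneous n → (∀ h, ρ (w * h) = 0) →
      ∃ w', w = X 2 * w' ∧ w'.IsHomogeneous (n - 1) ∧ (∀ h, ρ (w' * h) = 0) := by
    intro n w hn hw hwh
    have hv := val n (4 - n) w hw (by omega) hwh
    have h0 : ps w = 0 := by
      apply tau_two P (tau ρ) ta tb hτ0 (ps w) ((ps_natDegree n w hw).trans hn)
      · simpa using hv 0 (by omega)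
      · simpa using hv 1 (by omega)
      · exact hv 2 (by omega)
    obtain ⟨w', h1, h2⟩ := zdiv n w hw h0
    refine ⟨w', h1, h2, ?_⟩
    intro h
    rw [← Jρ.hz, ← mul_assoc, ← h1, hwh]
  have hv4 := val 3 1 v hv rfl hρv
  obtain ⟨s, t, hst⟩ := tau_three P (tau ρ) ta tb hτ0 (ps v) (ps_natDegree 3 v hv)
    (by simpa using hv4 0 (by omega)) (by simpa using hv4 1 (by omega))
  obtain ⟨v2, hv2, hv2h⟩ := zdiv 3 (v - (C s * a + C t * b))
    (hv.sub (((isHomogeneous_C_mul_X_aux s a P.ha)).add (isHomogeneous_C_mul_X_aux t b P.hb)))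
    (by rw [map_sub, hst]; simp [ps])
  have hv2ρ : ∀ h, ρ (v2 * h) = 0 := by
    intro h
    rw [← Jρ.hz, ← mul_assoc, ← hv2, sub_mul, map_sub, hρv]
    rw [show (C s * a + C t * b) * h = (C s * h) * a + (C t * h) * b by ring, map_add, Jρ.ha, Jρ.hb]
    simp
  obtain ⟨v1, hv1, hv1h, hv1ρ⟩ := down 2 v2 le_rfl hv2h hv2ρ
  obtain ⟨v0, hv0, hv0h, hv0ρ⟩ := down 1 v1 (by omega) hv1h hv1ρ
  obtain ⟨w, hw, hwh, hwρ⟩ := down 0 v0 (by omega) hv0h hv0ρ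
  have hw0 : v0 = 0 := by
    have h1 : (v0).totalDegree = 0 := by
      have := hv0h.totalDegree_le
      simpa using this
    by_contra hne
    have hw1 : w ≠ 0 := by rintro rfl; apply hne; rw [hw, mul_zero]
    rw [hw, totalDegree_mul_of_isDomain (X_ne_zero _) hw1, totalDegree_X] at h1
    omega
  refine ⟨s, t, ?_⟩
  rw [hv0, hw0, mul_zero] at hv1
  rw [hv1, mul_zero, mul_zero] at hv2
  rw [sub_eq_zero] at hv2
  rw [hv2, smul_eq_C_mul, smul_eq_C_mul]

/-- Extension of a functional on sextics to a functional killing the dehomogenised ideal. -/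
lemma Pair.extend {a b : R3} (P : Pair a b) (L : R3 →ₗ[ℝ] ℝ)
    (hLa : ∀ h : R3, h.IsHomogeneous 3 → L (h * a) = 0)
    (hLb : ∀ h : R3, h.IsHomogeneous 3 → L (h * b) = 0) :
    ∃ Λ : R3 →ₗ[ℝ] ℝ, JF a b Λ ∧ ∀ g : R3, g.IsHomogeneous 6 → Λ g = L g := by
  set J0 : Ideal R3 := idl a b ⊔ Ideal.span {X 2 - 1} with hJ0
  let f := (J0.restrictScalars ℝ).mkQ ∘ₗ (homogeneousSubmodule (Fin 3) ℝ 6).subtype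
  have h1 : L ∘ₗ (homogeneousSubmodule (Fin 3) ℝ 6).subtype ∈ LinearMap.range f.dualMap := by
    rw [LinearMap.range_dualMap_eq_dualAnnihilator_ker, Submodule.mem_dualAnnihilator]
    rintro ⟨g, hg⟩ hk
    rw [mem_homogeneousSubmodule] at hg
    have hk' : g ∈ J0 := by
      simpa [f, Submodule.Quotient.mk_eq_zero] using hk
    rw [hJ0, Submodule.mem_sup] at hk'
    obtain ⟨i, hi, w, hw, rfl⟩ := hk'
    obtain ⟨h, rfl⟩ := Ideal.mem_span_singleton'.1 hw
    have hd := P.dehom 6 (i + h * (X 2 - 1)) h hg (by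
      rw [show (X 2 - 1) * h - (i + h * (X 2 - 1)) = - i by ring]
      exact neg_mem hi)
    obtain ⟨u, v, hu, hv, huv⟩ := P.hc_mem hd 6
    rw [homogeneousComponent_of_mem ((mem_homogeneousSubmodule _ _).mpr hg), if_pos rfl] at huv
    change L (i + h * (X 2 - 1)) = 0
    rw [huv, map_add, hLa u hu, hLb v hv, add_zero]
  obtain ⟨Λ0, hΛ0⟩ := h1
  have key : ∀ g ∈ J0, (Λ0 ∘ₗ (J0.restrictScalars ℝ).mkQ) g = 0 := by
    intro g hg
    have h0 : (J0.restrictScalars ℝ).mkQ g = 0 := by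
      rw [Submodule.mkQ_apply]; exact (Submodule.Quotient.mk_eq_zero _).2 hg
    rw [LinearMap.comp_apply, h0, map_zero]
  refine ⟨Λ0 ∘ₗ (J0.restrictScalars ℝ).mkQ, ⟨?_, ?_, ?_⟩, ?_⟩
  · intro g
    exact key _ (Ideal.mul_mem_left _ _ (Ideal.mem_sup_left (Ideal.subset_span (by simp))))
  · intro g
    exact key _ (Ideal.mul_mem_left _ _ (Ideal.mem_sup_left (Ideal.subset_span (by simp))))
  · intro g
    rw [← sub_eq_zero, ← map_sub, show X 2 * g - g = g * (X 2 - 1) by ring]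
    exact key _ (Ideal.mul_mem_left _ _ (Ideal.mem_sup_right (Ideal.subset_span (by simp))))
  · intro g hg
    exact LinearMap.congr_fun hΛ0 ⟨g, hg⟩

/-- Nullstellensatz. -/
lemma span_eq_top {n : ℕ} (p : Fin n → R3)
    (hp : ¬ ∃ P : Fin 3 → ℂ, P ≠ 0 ∧ ∀ i, aeval P (p i) = 0) :
    Ideal.span (Set.range p) ⊔ Ideal.span {X 2 - 1} = (⊤ : Ideal R3) := by
  by_contra hne
  obtain ⟨M, hM, hle⟩ := Ideal.exists_le_maximal _ hne
  letI : Field (R3 ⧸ M) := Ideal.Quotient.field M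
  haveI : Module.Finite ℝ (R3 ⧸ M) := finite_of_finite_type_of_isJacobsonRing ℝ (R3 ⧸ M)
  let φ : (R3 ⧸ M) →ₐ[ℝ] ℂ := IsAlgClosed.lift
  let ψ : R3 →ₐ[ℝ] ℂ := φ.comp (Ideal.Quotient.mkₐ ℝ M)
  have hψ : ∀ g, aeval (fun i => ψ (X i)) g = ψ g := by
    intro g
    rw [← comp_aeval_apply, aeval_X_left_apply]
  have hψ0 : ∀ g ∈ M, ψ g = 0 := by
    intro g hg
    simp only [ψ, AlgHom.comp_apply, Ideal.Quotient.mkₐ_eq_mk, Ideal.Quotient.eq_zero_iff_mem.2 hg,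
      map_zero]
  apply hp
  refine ⟨fun i => ψ (X i), ?_, ?_⟩
  · intro h
    have h2 := congrFun h 2
    have h3 := hψ0 (X 2 - 1) (hle (Ideal.mem_sup_right (Ideal.subset_span (by simp))))
    rw [map_sub, map_one] at h3
    simp only [Pi.zero_apply] at h2
    rw [h2] at h3
    norm_num at h3
  · intro i
    rw [hψ]
    exact hψ0 _ (hle (Ideal.mem_sup_left (Ideal.subset_span ⟨i, rfl⟩)))

lemma aeval_one_zero_zero (g : R3) (hg : g.IsHomogeneous 3) (h : (ps g).coeff 3 = 0) :
    aeval ![(1 : ℂ), 0, 0] g = 0 := by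
  rw [aeval_def, eval₂_eq]
  refine Finset.sum_eq_zero ?_
  intro d hd
  have hdeg : Finsupp.degree d = 3 := by
    by_contra hne
    exact (mem_support_iff.1 hd) (hg.coeff_eq_zero hne)
  by_cases h1 : d 1 = 0
  · by_cases h2 : d 2 = 0
    · have := ps_coeff 3 g hg d hdeg h2
      rw [degree_three] at hdeg
      rw [show d 0 = 3 by omega, h] at this
      rw [← this]; simp
    · apply mul_eq_zero_of_right
      apply Finset.prod_eq_zero (Finsupp.mem_support_iff.2 h2)
      simp [h2]
  · apply mul_eq_zero_of_right
    apply Finset.prod_eq_zero (Finsupp.mem_support_iff.2 h1)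
    simp [h1]

lemma aeval_ps (t : ℂ) (g : R3) : Polynomial.aeval t (ps g) = aeval ![t, 1, 0] g := by
  have h : (Polynomial.aeval t).comp ps = (aeval ![t, 1, 0] : R3 →ₐ[ℝ] ℂ) := by
    apply MvPolynomial.algHom_ext
    intro i
    fin_cases i <;> simp [ps]
  exact DFunLike.congr_fun h g

lemma linComb_hom {n : ℕ} (p : Fin n → R3) (hp : ∀ i, (p i).IsHomogeneous 3) (c : Fin n → ℝ) :
    (Fintype.linearCombination ℝ p c).IsHomogeneous 3 := by
  rw [← mem_homogeneousSubmodule, Fintype.linearCombination_apply]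
  exact Submodule.sum_mem _ fun i _ => Submodule.smul_mem _ _ (hp i)

/-- Choice of two combinations in general position. -/
lemma exists_pair {n : ℕ} (p : Fin n → R3) (hh : ∀ i, (p i).IsHomogeneous 3)
    (hp : ¬ ∃ P : Fin 3 → ℂ, P ≠ 0 ∧ ∀ i, aeval P (p i) = 0) :
    ∃ ca cb : Fin n → ℝ,
      Pair (Fintype.linearCombination ℝ p ca) (Fintype.linearCombination ℝ p cb) := by
  set B := Fintype.linearCombination ℝ p with hB
  have hBi : ∀ i, B (Pi.single i 1) = p i := by
    intro i
    rw [hB, Fintype.linearCombination_apply_single, one_smul]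
  push Not at hp
  obtain ⟨i0, hi0⟩ := hp ![0, 1, 0] (by intro h; simpa using congrFun h 1)
  rw [← aeval_ps] at hi0
  have ha0 : ps (p i0) ≠ 0 := by intro h; rw [h] at hi0; simp at hi0
  let pt : Option ((ps (p i0)).rootSet ℂ) → Fin 3 → ℂ
    | none => ![1, 0, 0]
    | some t => ![(t : ℂ), 1, 0]
  have hpt : ∀ j, pt j ≠ 0 := by
    rintro (_ | t) h
    · simpa [pt] using congrFun h 0
    · simpa [pt] using congrFun h 1
  let V : Option ((ps (p i0)).rootSet ℂ) → Subspace ℝ (Fin n → ℝ) := fun j =>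
    LinearMap.ker ((aeval (pt j) : R3 →ₐ[ℝ] ℂ).toLinearMap ∘ₗ B)
  have hcov : ⋃ j, (V j : Set (Fin n → ℝ)) ≠ Set.univ := by
    intro h
    obtain ⟨j, hj⟩ := Subspace.exists_eq_top_of_iUnion_eq_univ h
    obtain ⟨i, hi⟩ := hp (pt j) (hpt j)
    have : (Pi.single i 1 : Fin n → ℝ) ∈ V j := by rw [hj]; trivial
    simp only [V, LinearMap.mem_ker, LinearMap.comp_apply, hBi] at this
    exact hi this
  obtain ⟨cb, hcb⟩ := (Set.ne_univ_iff_exists_notMem _).1 hcov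
  simp only [Set.mem_iUnion, not_exists, SetLike.mem_coe] at hcb
  have hcb' : ∀ j, aeval (pt j) (B cb) ≠ 0 := fun j h => hcb j h
  have hb : (B cb).IsHomogeneous 3 := linComb_hom p hh cb
  have hb3 : (ps (B cb)).coeff 3 ≠ 0 := fun h => hcb' none (aeval_one_zero_zero _ hb h)
  have hcop : IsCoprime (ps (p i0)) (ps (B cb)) := by
    refine (Polynomial.isCoprime_iff_aeval_ne_zero_of_isAlgClosed ℝ ℂ _ _).2 ?_
    intro t
    by_cases ht : Polynomial.aeval t (ps (p i0)) = 0
    · right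
      rw [aeval_ps]
      exact hcb' (some ⟨t, Polynomial.mem_rootSet.2 ⟨ha0, ht⟩⟩)
    · exact Or.inl ht
  set l : ℝ := (ps (p i0)).coeff 3 / (ps (B cb)).coeff 3 with hl
  have hca : B (Pi.single i0 1 - l • cb) = p i0 - l • B cb := by
    rw [map_sub, map_smul, hBi]
  have hps : ps (B (Pi.single i0 1 - l • cb)) = ps (p i0) + ps (B cb) * Polynomial.C (-l) := by
    rw [hca, map_sub, map_smul, Polynomial.smul_eq_C_mul, Polynomial.C_neg]
    ring
  have hah : (B (Pi.single i0 1 - l • cb)).IsHomogeneous 3 := linComb_hom p hh _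
  refine ⟨Pi.single i0 1 - l • cb, cb, hah, hb, ?_, ?_, ?_⟩
  · rw [hps]
    exact hcop.add_mul_left_left _
  · have h3 := ps_natDegree 3 _ hah
    rw [Polynomial.natDegree_le_iff_coeff_eq_zero]
    intro N hN
    by_cases hN3 : N = 3
    · rw [hN3, hps, Polynomial.coeff_add, Polynomial.coeff_mul_C, hl]
      field_simp
      ring
    · exact Polynomial.coeff_eq_zero_of_natDegree_lt (by omega)
  · exact le_antisymm (ps_natDegree 3 _ hb) (Polynomial.le_natDegree_of_ne_zero hb3)

/-- The main algebraic fact: four independent cubics whose degree six products do not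
span all sextics have a common zero. -/
theorem common_zero (p : Fin 4 → R3) (hh : ∀ i, (p i).IsHomogeneous 3)
    (hli : LinearIndependent ℝ p) (L : R3 →ₗ[ℝ] ℝ) (g : R3) (hg : g.IsHomogeneous 6)
    (hLg : L g ≠ 0) (hL : ∀ i, ∀ q : R3, q.IsHomogeneous 3 → L (p i * q) = 0) :
    ∃ P : Fin 3 → ℂ, P ≠ 0 ∧ ∀ i, aeval P (p i) = 0 := by
  by_contra hp
  obtain ⟨ca, cb, P⟩ := exists_pair p hh hp
  set B := Fintype.linearCombination ℝ p with hB
  have hLB : ∀ c : Fin 4 → ℝ, ∀ q : R3, q.IsHomogeneous 3 → L (B c * q) = 0 := by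
    intro c q hq
    rw [hB, Fintype.linearCombination_apply, Finset.sum_mul, map_sum]
    refine Finset.sum_eq_zero fun i _ => ?_
    rw [smul_mul_assoc, map_smul, hL i q hq, smul_zero]
  obtain ⟨Λ, J, hΛ⟩ := P.extend L (fun h hh' => by rw [mul_comm]; exact hLB _ h hh')
    (fun h hh' => by rw [mul_comm]; exact hLB _ h hh')
  have hΛB : ∀ c : Fin 4 → ℝ, ∀ q : R3, q.IsHomogeneous 3 → Λ (B c * q) = 0 := by
    intro c q hq
    rw [hΛ _ ((linComb_hom p hh c).mul hq), hLB c q hq]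
  have hBi : ∀ i, B (Pi.single i 1) = p i := by
    intro i
    rw [hB, Fintype.linearCombination_apply_single, one_smul]
  have hex : ∃ i, actF (p i) Λ ≠ 0 := by
    by_contra hall
    push Not at hall
    have htop := span_eq_top p hp
    have hI : ∀ u ∈ Ideal.span (Set.range p), ∀ h, Λ (h * u) = 0 := by
      intro u hu
      refine Submodule.span_induction ?_ ?_ ?_ ?_ hu
      · rintro _ ⟨i, rfl⟩ h
        rw [mul_comm, ← actF_apply, hall i]; rfl
      · intro h; simp
      · intro x y _ _ hx hy h
        rw [mul_add, map_add, hx, hy, add_zero]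
      · intro a x _ hx h
        rw [smul_eq_mul, ← mul_assoc, hx]
    have hgt : (1 : R3) ∈ Ideal.span (Set.range p) ⊔ Ideal.span {X 2 - 1} := by rw [htop]; trivial
    obtain ⟨u, hu, w, hw, huw⟩ := Submodule.mem_sup.1 hgt
    obtain ⟨h, rfl⟩ := Ideal.mem_span_singleton'.1 hw
    apply hLg
    rw [← hΛ g hg, ← mul_one g, ← huw, mul_add, map_add, hI u hu, zero_add,
      show g * (h * (X 2 - 1)) = X 2 * (g * h) - g * h by ring, map_sub, J.hz, sub_self]
  obtain ⟨i, hi⟩ := hex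
  -- the kernel of one functional on combinations
  let F : (Fin 4 → ℝ) →ₗ[ℝ] ℝ :=
    Λ ∘ₗ LinearMap.mulRight ℝ (th 4 (Polynomial.X ^ 2 * ps (B ca))) ∘ₗ B
  have hF : ∀ c, F c = Λ (B c * th 4 (Polynomial.X ^ 2 * ps (B ca))) := fun c => rfl
  have hsub : (LinearMap.ker F).map B ≤ Submodule.span ℝ {B ca, B cb} := by
    rintro _ ⟨c, hc, rfl⟩
    obtain ⟨s, t, hst⟩ := P.duality Λ J (p i) (B c)
      (fun h hh' => by rw [← hBi]; exact hΛB _ h hh') hi (linComb_hom p hh c)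
      (fun h hh' => hΛB c h hh') hc
    rw [hst, Submodule.mem_span_pair]
    exact ⟨s, t, rfl⟩
  have hinj : Function.Injective B := by
    rw [hB]
    exact linearIndependent_iff_injective_fintypeLinearCombination.1 hli
  have h1 : Module.finrank ℝ ((LinearMap.ker F).map B) = Module.finrank ℝ (LinearMap.ker F) :=
    ((LinearMap.ker F).equivMapOfInjective B hinj).symm.finrank_eq
  have h2 := F.finrank_range_add_finrank_ker
  have h3 : Module.finrank ℝ (LinearMap.range F) ≤ 1 := by
    simpa using Submodule.finrank_le (LinearMap.range F)
  have hfin : Module.Finite ℝ (Submodule.span ℝ {B ca, B cb}) :=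
    Module.Finite.span_of_finite ℝ (Set.toFinite _)
  have h4 : Module.finrank ℝ (Submodule.span ℝ {B ca, B cb}) ≤ 2 := by
    classical
    have := finrank_span_finset_le_card (R := ℝ) (({B ca, B cb} : Finset R3))
    rw [Set.finrank] at this
    rw [Finset.coe_pair] at this
    exact this.trans Finset.card_le_two
  have h5 := Submodule.finrank_mono hsub
  simp at h2
  omega

/-- Index set of monomials of degree `d` in three variables. -/
abbrev Idx (d : ℕ) : Type := {t : Fin 3 → Fin (d + 1) // (t 0 : ℕ) + t 1 + t 2 = d}

lemma card_idx3 : Fintype.card (Idx 3) = 10 := by decide +kernel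
lemma card_idx4 : Fintype.card (Idx 4) = 15 := by decide +kernel
lemma card_idx6 : Fintype.card (Idx 6) = 28 := by decide +kernel

/-- The exponent attached to an index. -/
def ex {d : ℕ} (t : Idx d) : Fin 3 →₀ ℕ := Finsupp.equivFunOnFinite.symm fun i => (t.1 i : ℕ)

lemma ex_apply {d : ℕ} (t : Idx d) (i : Fin 3) : ex t i = (t.1 i : ℕ) := rfl

lemma ex_degree {d : ℕ} (t : Idx d) : Finsupp.degree (ex t) = d := by
  rw [degree_three]; exact t.2

lemma ex_inj {d : ℕ} : Function.Injective (ex (d := d)) := by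
  intro s t h
  apply Subtype.ext
  funext i
  apply Fin.ext
  exact DFunLike.congr_fun h i

lemma ex_surj {d : ℕ} (m : Fin 3 →₀ ℕ) (hm : Finsupp.degree m = d) : ∃ t : Idx d, ex t = m := by
  rw [degree_three] at hm
  have hlt : ∀ i : Fin 3, m i < d + 1 := by
    intro i; fin_cases i <;> simp <;> omega
  refine ⟨⟨fun i => ⟨m i, hlt i⟩, hm⟩, ?_⟩
  ext i; rfl

/-- The Euclidean space of coefficient vectors of forms of degree `d`. -/
abbrev E (d : ℕ) : Type := EuclideanSpace ℝ (Idx d)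

/-- The form with a given coefficient vector. -/
def toP (d : ℕ) : E d →ₗ[ℝ] R3 where
  toFun c := ∑ t, monomial (ex t) (c t)
  map_add' c c' := by simp [Finset.sum_add_distrib]
  map_smul' s c := by simp [Finset.smul_sum, smul_monomial]

lemma toP_apply {d : ℕ} (c : E d) : toP d c = ∑ t, monomial (ex t) (c t) := rfl

/-- The coefficient vector of a polynomial. -/
def ofP (d : ℕ) : R3 →ₗ[ℝ] E d where
  toFun g := WithLp.toLp 2 fun t => coeff (ex t) g
  map_add' g g' := by ext t; simp
  map_smul' s g := by ext t; simp

@[simp] lemma ofP_apply {d : ℕ} (g : R3) (t : Idx d) : ofP d g t = coeff (ex t) g := rfl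

lemma coeff_toP {d : ℕ} (c : E d) (t : Idx d) : coeff (ex t) (toP d c) = c t := by
  rw [toP_apply, coeff_sum, Finset.sum_eq_single t]
  · simp
  · intro s _ hs
    rw [coeff_monomial, if_neg fun h => hs (ex_inj h)]
  · simp

lemma toP_hom {d : ℕ} (c : E d) : (toP d c).IsHomogeneous d := by
  rw [toP_apply]
  exact IsHomogeneous.sum _ _ _ fun t _ => isHomogeneous_monomial _ (ex_degree t)

lemma ofP_toP {d : ℕ} (c : E d) : ofP d (toP d c) = c := by
  ext t; rw [ofP_apply, coeff_toP]

lemma toP_ofP {d : ℕ} {g : R3} (hg : g.IsHomogeneous d) : toP d (ofP d g) = g := by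
  ext m
  by_cases hm : Finsupp.degree m = d
  · obtain ⟨t, rfl⟩ := ex_surj m hm
    rw [coeff_toP, ofP_apply]
  · rw [(toP_hom _).coeff_eq_zero hm, hg.coeff_eq_zero hm]

lemma toP_inj {d : ℕ} : Function.Injective (toP d) :=
  Function.LeftInverse.injective ofP_toP

lemma coeff_toP_eq {d : ℕ} (m : Fin 3 →₀ ℕ) :
    (∃ t : Idx d, ∀ c : E d, coeff m (toP d c) = c t) ∨ ∀ c : E d, coeff m (toP d c) = 0 := by
  by_cases hm : Finsupp.degree m = d
  · obtain ⟨t, rfl⟩ := ex_surj m hm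
    exact Or.inl ⟨t, fun c => coeff_toP c t⟩
  · exact Or.inr fun c => (toP_hom _).coeff_eq_zero hm

section smooth

variable {V : Type*} [NormedAddCommGroup V] [NormedSpace ℝ V]

/-- Families of polynomials with smooth coefficients. -/
def CD (F : V → R3) : Prop := ∀ m, ContDiff ℝ 1 fun x => coeff m (F x)

lemma CD.const (g : R3) : CD (fun _ : V => g) := fun _ => contDiff_const

lemma CD.add {F G : V → R3} (hF : CD F) (hG : CD G) : CD fun x => F x + G x := by
  intro m; simp only [coeff_add]; exact (hF m).add (hG m)

lemma CD.mul {F G : V → R3} (hF : CD F) (hG : CD G) : CD fun x => F x * G x := by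
  classical
  intro m; simp only [coeff_mul]
  exact ContDiff.sum fun i _ => (hF _).mul (hG _)

lemma CD.pow {F : V → R3} (hF : CD F) (n : ℕ) : CD fun x => F x ^ n := by
  induction n with
  | zero => simp only [pow_zero]; exact CD.const 1
  | succ n ih => simp only [pow_succ]; exact ih.mul hF

lemma CD.sum {α : Type*} {s : Finset α} {F : α → V → R3} (hF : ∀ a ∈ s, CD (F a)) :
    CD fun x => ∑ a ∈ s, F a x := by
  intro m; simp only [coeff_sum]
  exact ContDiff.sum fun a ha => hF a ha m

lemma CD.C {f : V → ℝ} (hf : ContDiff ℝ 1 f) : CD fun x => (MvPolynomial.C (f x) : R3) := by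
  classical
  intro m
  simp only [coeff_C]
  split_ifs
  · exact hf
  · exact contDiff_const

lemma CD.toP {d : ℕ} {f : V → E d} (hf : ContDiff ℝ 1 f) : CD fun x => SexticAux.toP d (f x) := by
  intro m
  rcases coeff_toP_eq (d := d) m with ⟨t, ht⟩ | h0
  · simp only [ht]
    exact (contDiff_euclidean.1 hf) t
  · simp only [h0]; exact contDiff_const

lemma CD.ofP {d : ℕ} {F : V → R3} (hF : CD F) : ContDiff ℝ 1 fun x => SexticAux.ofP d (F x) := by
  rw [contDiff_euclidean]
  intro t
  exact hF _

end smooth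

/-- The bilinear multiplication of cubics. -/
def Bm (p q : E 3) : E 6 := ofP 6 (toP 3 p * toP 3 q)

lemma toP_Bm (p q : E 3) : toP 6 (Bm p q) = toP 3 p * toP 3 q :=
  toP_ofP ((toP_hom p).mul (toP_hom q))

lemma Bm_comm (p q : E 3) : Bm p q = Bm q p := by rw [Bm, mul_comm]; rfl
lemma Bm_add_left (p p' q : E 3) : Bm (p + p') q = Bm p q + Bm p' q := by simp [Bm, add_mul]
lemma Bm_smul_left (s : ℝ) (p q : E 3) : Bm (s • p) q = s • Bm p q := by simp [Bm]
lemma Bm_add_right (p q q' : E 3) : Bm p (q + q') = Bm p q + Bm p q' := by simp [Bm, mul_add]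
lemma Bm_smul_right (s : ℝ) (p q : E 3) : Bm p (s • q) = s • Bm p q := by simp [Bm]
lemma Bm_zero_right (p : E 3) : Bm p 0 = 0 := by simp [Bm]
lemma Bm_zero_left (p : E 3) : Bm 0 p = 0 := by simp [Bm]
lemma Bm_sum_left {α : Type*} (s : Finset α) (f : α → E 3) (q : E 3) :
    Bm (∑ a ∈ s, f a) q = ∑ a ∈ s, Bm (f a) q := by simp [Bm, Finset.sum_mul]

/-- Sum of squares map. -/
def phi (r : ℕ) (c : Fin r → E 3) : E 6 := ∑ i, Bm (c i) (c i)

lemma toP_phi {r : ℕ} (c : Fin r → E 3) : toP 6 (phi r c) = ∑ i, toP 3 (c i) ^ 2 := by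
  rw [phi, map_sum]
  exact Finset.sum_congr rfl fun i _ => by rw [toP_Bm, sq]

/-- Coefficient vectors of sums of `r` squares. -/
def XS (r : ℕ) : Set (E 6) := Set.range (phi r)

lemma mem_XS_iff {r : ℕ} {f : E 6} : f ∈ XS r ↔ IsSOS 3 3 r (toP 6 f) := by
  constructor
  · rintro ⟨c, rfl⟩
    exact ⟨fun i => toP 3 (c i), fun i => toP_hom _, toP_phi c⟩
  · rintro ⟨p, hp, hf⟩
    refine ⟨fun i => ofP 3 (p i), toP_inj ?_⟩
    rw [toP_phi, hf]
    exact Finset.sum_congr rfl fun i _ => by rw [toP_ofP (hp i)]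

lemma phi_contDiff (r : ℕ) : ContDiff ℝ 1 (phi r) := by
  unfold phi Bm
  refine ContDiff.sum fun i _ => CD.ofP ?_
  exact CD.mul (CD.toP (contDiff_apply ℝ (E 3) i)) (CD.toP (contDiff_apply ℝ (E 3) i))

lemma phi_eq_zero {r : ℕ} {c : Fin r → E 3} (h : phi r c = 0) : c = 0 := by
  have h1 := toP_phi c
  rw [h, map_zero] at h1
  funext i
  apply toP_inj
  rw [Pi.zero_apply, map_zero]
  apply MvPolynomial.funext
  intro v
  have h2 := congrArg (eval v) h1
  simp only [map_zero, map_sum, map_pow] at h2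
  have h3 := (Finset.sum_eq_zero_iff_of_nonneg (fun j _ => sq_nonneg _)).1 h2.symm i
    (Finset.mem_univ i)
  rw [map_zero]
  exact pow_eq_zero_iff (two_ne_zero) |>.1 h3

lemma phi_smul {r : ℕ} (s : ℝ) (c : Fin r → E 3) : phi r (s • c) = s ^ 2 • phi r c := by
  simp only [phi, Finset.smul_sum, Pi.smul_apply, Bm_smul_left, Bm_smul_right, smul_smul, sq]

lemma phi_bound (r : ℕ) : ∃ m > 0, ∀ c : Fin r → E 3, m * ‖c‖ ^ 2 ≤ ‖phi r c‖ := by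
  have hc : IsCompact (Metric.sphere (0 : Fin r → E 3) 1) := isCompact_sphere _ _
  by_cases hne : (Metric.sphere (0 : Fin r → E 3) 1).Nonempty
  · obtain ⟨c0, hc0, hmin⟩ := hc.exists_isMinOn hne
      (phi_contDiff r).continuous.norm.continuousOn
    have hc01 : ‖c0‖ = 1 := by simpa using hc0
    refine ⟨‖phi r c0‖, ?_, ?_⟩
    · rw [gt_iff_lt, norm_pos_iff]
      intro h
      rw [phi_eq_zero h] at hc01
      simp at hc01
    · intro c
      by_cases h0 : c = 0
      · simp [h0]
      · have hn : 0 < ‖c‖ := norm_pos_iff.2 h0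
        have hu : ‖c‖⁻¹ • c ∈ Metric.sphere (0 : Fin r → E 3) 1 := by
          simp [norm_smul, hn.ne']
        have h1 := hmin hu
        simp only [Set.mem_ofPred_eq] at h1
        rw [phi_smul, norm_smul] at h1
        have h2 : ‖(‖c‖⁻¹ ^ 2 : ℝ)‖ = (‖c‖ ^ 2)⁻¹ := by simp
        rw [h2] at h1
        rw [le_inv_mul_iff₀ (by positivity)] at h1
        linarith
  · refine ⟨1, one_pos, ?_⟩
    intro c
    by_cases h0 : c = 0
    · simp [h0]
    · exfalso
      apply hne
      have hn : 0 < ‖c‖ := norm_pos_iff.2 h0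
      exact ⟨‖c‖⁻¹ • c, by simp [norm_smul, hn.ne']⟩

lemma phi_closedMap (r : ℕ) : IsClosedMap (phi r) := by
  apply IsProperMap.isClosedMap
  rw [isProperMap_iff_tendsto_cocompact]
  refine ⟨(phi_contDiff r).continuous, ?_⟩
  obtain ⟨m, hm, hb⟩ := phi_bound r
  rw [← Metric.cobounded_eq_cocompact, ← Metric.cobounded_eq_cocompact,
    ← tendsto_norm_atTop_iff_cobounded]
  refine Filter.tendsto_atTop_mono hb ?_
  exact (Filter.tendsto_pow_atTop (two_ne_zero)).comp tendsto_norm_cobounded_atTop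
    |>.const_mul_atTop hm

lemma XS_closed (r : ℕ) : IsClosed (XS r) := (phi_closedMap r).isClosed_range

lemma XS_mono {r s : ℕ} (h : r ≤ s) : XS r ⊆ XS s := by
  rintro _ ⟨c, rfl⟩
  obtain ⟨k, rfl⟩ := Nat.exists_eq_add_of_le h
  refine ⟨Fin.append c 0, ?_⟩
  simp only [phi, Fin.sum_univ_add, Fin.append_left, Fin.append_right, Pi.zero_apply, Bm_zero_left,
    Finset.sum_const_zero, add_zero]

/-- Tuples of cubics with a common complex zero. -/
def ZS : Set (Fin 4 → E 3) :=
  {c | ∃ P : Fin 3 → ℂ, P ∈ Metric.sphere (0 : Fin 3 → ℂ) 1 ∧ ∀ i, aeval P (toP 3 (c i)) = 0}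

lemma aeval_toP {d : ℕ} (c : E d) (P : Fin 3 → ℂ) :
    aeval P (toP d c) = ∑ t : Idx d, (c t : ℂ) * ∏ i, P i ^ (ex t i) := by
  rw [toP_apply, map_sum]
  refine Finset.sum_congr rfl fun t _ => ?_
  rw [aeval_monomial, Finsupp.prod_fintype _ _ (by simp)]
  rfl

lemma ZS_closed : IsClosed ZS := by
  have hK : IsCompact (Metric.sphere (0 : Fin 3 → ℂ) 1) := isCompact_sphere _ _
  have hcs : CompactSpace (Metric.sphere (0 : Fin 3 → ℂ) 1) := isCompact_iff_compactSpace.1 hK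
  let S : Set ((Metric.sphere (0 : Fin 3 → ℂ) 1) × (Fin 4 → E 3)) :=
    {x | ∀ i, aeval (x.1 : Fin 3 → ℂ) (toP 3 (x.2 i)) = 0}
  have hS : IsClosed S := by
    have : S = ⋂ i, {x | aeval (x.1 : Fin 3 → ℂ) (toP 3 (x.2 i)) = 0} := by
      ext x; simp [S]
    rw [this]
    refine isClosed_iInter fun i => isClosed_eq ?_ continuous_const
    simp only [aeval_toP]
    refine continuous_finsetSum _ fun t _ => Continuous.mul ?_ ?_
    · fun_prop
    · exact continuous_finsetProd _ fun j _ =>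
        ((continuous_apply j).comp (continuous_subtype_val.comp continuous_fst)).pow _
  have : ZS = Prod.snd '' S := by
    ext c
    constructor
    · rintro ⟨P, hP, h⟩
      exact ⟨(⟨P, hP⟩, c), h, rfl⟩
    · rintro ⟨⟨⟨P, hP⟩, c'⟩, h, rfl⟩
      exact ⟨P, hP, h⟩
  rw [this]
  exact isClosedMap_snd_of_compactSpace S hS

lemma aeval_smul_hom (g : R3) (n : ℕ) (hg : g.IsHomogeneous n) (s : ℂ) (P : Fin 3 → ℂ) :
    aeval (s • P) g = s ^ n * aeval P g := by
  rw [aeval_def, aeval_def, eval₂_eq, eval₂_eq, Finset.mul_sum]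
  refine Finset.sum_congr rfl fun d hd => ?_
  have hdeg : Finsupp.degree d = n := by
    by_contra hne
    exact (mem_support_iff.1 hd) (hg.coeff_eq_zero hne)
  have : ∏ i ∈ d.support, (s • P) i ^ d i = s ^ n * ∏ i ∈ d.support, P i ^ d i := by
    simp only [Pi.smul_apply, smul_eq_mul, mul_pow, Finset.prod_mul_distrib]
    rw [Finset.prod_pow_eq_pow_sum, ← hdeg]
    rfl
  rw [this]; ring

lemma mem_ZS {c : Fin 4 → E 3} (P : Fin 3 → ℂ) (hP : P ≠ 0)
    (h : ∀ i, aeval P (toP 3 (c i)) = 0) : c ∈ ZS := by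
  refine ⟨((‖P‖⁻¹ : ℝ) : ℂ) • P, ?_, fun i => ?_⟩
  · have : ‖P‖ ≠ 0 := norm_ne_zero_iff.2 hP
    simp [norm_smul, this]
  · rw [aeval_smul_hom _ 3 (toP_hom _), h, mul_zero]

lemma real_lemma1 (α β γ δ : ℝ) (h : ∀ s : ℝ, 0 ≤ s * α + s ^ 2 * β + s ^ 3 * γ + s ^ 4 * δ) :
    α = 0 := by
  have key : ∀ α γ : ℝ, (∀ s : ℝ, 0 ≤ s * α + s ^ 2 * β + s ^ 3 * γ + s ^ 4 * δ) → 0 ≤ α := by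
    intro α γ h
    have ht : Filter.Tendsto (fun s : ℝ => α + s * β + s ^ 2 * γ + s ^ 3 * δ)
        (nhdsWithin 0 (Set.Ioi 0)) (nhds (α + 0 * β + 0 ^ 2 * γ + 0 ^ 3 * δ)) := by
      apply Filter.Tendsto.mono_left _ nhdsWithin_le_nhds
      apply Continuous.tendsto
      fun_prop
    have := ge_of_tendsto ht (b := 0) (by
      filter_upwards [self_mem_nhdsWithin] with s hs
      have hs' : 0 < s := hs
      have := h s
      rw [show s * α + s ^ 2 * β + s ^ 3 * γ + s ^ 4 * δ
        = s * (α + s * β + s ^ 2 * γ + s ^ 3 * δ) by ring] at this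
      exact nonneg_of_mul_nonneg_right this hs')
    simpa using this
  apply le_antisymm
  · have := key (-α) (-γ) (fun s => by have := h (-s); nlinarith [this])
    linarith
  · exact key α γ h

lemma real_lemma2 (β δ : ℝ) (h : ∀ s : ℝ, 0 ≤ s ^ 2 * β + s ^ 4 * δ) : 0 ≤ β := by
  have ht : Filter.Tendsto (fun s : ℝ => β + s ^ 2 * δ)
      (nhdsWithin 0 (Set.Ioi 0)) (nhds (β + 0 ^ 2 * δ)) := by
    apply Filter.Tendsto.mono_left _ nhdsWithin_le_nhds
    apply Continuous.tendsto
    fun_prop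
  have := ge_of_tendsto ht (b := 0) (by
    filter_upwards [self_mem_nhdsWithin] with s hs
    have hs' : 0 < s := hs
    have := h s
    rw [show s ^ 2 * β + s ^ 4 * δ = s ^ 2 * (β + s ^ 2 * δ) by ring] at this
    exact nonneg_of_mul_nonneg_right this (by positivity))
  simpa using this

open scoped InnerProductSpace

lemma phi_var {r : ℕ} (c h : Fin r → E 3) (s : ℝ) :
    phi r (c + s • h) = phi r c + s • ((2 : ℝ) • ∑ i, Bm (c i) (h i)) + s ^ 2 • phi r h := by
  simp only [phi, Finset.smul_sum, ← Finset.sum_add_distrib]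
  refine Finset.sum_congr rfl fun i _ => ?_
  simp only [Pi.add_apply, Pi.smul_apply, Bm_add_left, Bm_add_right, Bm_smul_left, Bm_smul_right]
  rw [Bm_comm (h i) (c i)]
  module

lemma norm_var (L a b : E 6) (s : ℝ) : ‖L - s • a - s ^ 2 • b‖ ^ 2 =
    ‖L‖ ^ 2 + (s * (-2 * ⟪L, a⟫_ℝ) + s ^ 2 * (‖a‖ ^ 2 - 2 * ⟪L, b⟫_ℝ) + s ^ 3 * (2 * ⟪a, b⟫_ℝ)
      + s ^ 4 * ‖b‖ ^ 2) := by
  rw [norm_sub_sq_real, norm_sub_sq_real, inner_sub_left, inner_smul_right, inner_smul_right,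
    inner_smul_left, inner_smul_right, norm_smul, norm_smul]
  simp only [Real.norm_eq_abs, mul_pow, sq_abs, conj_trivial]
  ring

/-- The nearest point lemma. -/
lemma nearest {r : ℕ} (f : E 6) (hf : f ∈ XS r) (hf4 : f ∉ XS 4) :
    ∃ c ∈ ZS, dist f (phi 4 c) = Metric.infDist f (XS 4) := by
  obtain ⟨y, ⟨c, rfl⟩, hy⟩ := (XS_closed 4).exists_infDist_eq_dist
    (Set.range_nonempty (phi 4)) f
  refine ⟨c, ?_, hy.symm⟩
  set L := f - phi 4 c with hL
  have hL0 : L ≠ 0 := by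
    intro h
    rw [sub_eq_zero] at h
    exact hf4 ⟨c, h.symm⟩
  have hmin : ∀ c', ‖L‖ ^ 2 ≤ ‖f - phi 4 c'‖ ^ 2 := by
    intro c'
    have h1 := Metric.infDist_le_dist_of_mem (x := f) (s := XS 4) ⟨c', rfl⟩
    rw [hy, dist_eq_norm, dist_eq_norm] at h1
    gcongr
  have hvar : ∀ h : Fin 4 → E 3, ∀ s : ℝ,
      0 ≤ s * (-2 * ⟪L, (2 : ℝ) • ∑ i, Bm (c i) (h i)⟫_ℝ)
      + s ^ 2 * (‖(2 : ℝ) • ∑ i, Bm (c i) (h i)‖ ^ 2 - 2 * ⟪L, phi 4 h⟫_ℝ)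
      + s ^ 3 * (2 * ⟪(2 : ℝ) • ∑ i, Bm (c i) (h i), phi 4 h⟫_ℝ) + s ^ 4 * ‖phi 4 h‖ ^ 2 := by
    intro h s
    have h1 := hmin (c + s • h)
    rw [phi_var, ← sub_sub, ← sub_sub, ← hL, norm_var] at h1
    linarith
  have first : ∀ h : Fin 4 → E 3, ⟪L, ∑ i, Bm (c i) (h i)⟫_ℝ = 0 := by
    intro h
    have := real_lemma1 _ _ _ _ (hvar h)
    rw [inner_smul_right] at this
    linarith
  have hone : ∀ i q, ⟪L, Bm (c i) q⟫_ℝ = 0 := by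
    intro i q
    have := first (Pi.single i q)
    rw [Finset.sum_eq_single i] at this
    · simpa using this
    · intro j _ hj
      rw [Pi.single_eq_of_ne hj, Bm_zero_right]
    · simp
  have hphi : ⟪L, phi 4 c⟫_ℝ = 0 := first c
  have hli : LinearIndependent ℝ fun i => toP 3 (c i) := by
    rw [Fintype.linearIndependent_iff]
    by_contra hdep
    push Not at hdep
    obtain ⟨u, hu, j, hj⟩ := hdep
    have hu' : ∑ i, u i • c i = 0 := by
      apply toP_inj
      rw [map_sum, map_zero, ← hu]
      exact Finset.sum_congr rfl fun i _ => by rw [map_smul]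
    have hupos : 0 < ∑ i, u i ^ 2 :=
      Finset.sum_pos' (fun i _ => sq_nonneg _) ⟨j, Finset.mem_univ _, by positivity⟩
    have hsq : ∀ h : E 3, ⟪L, Bm h h⟫_ℝ ≤ 0 := by
      intro h
      have h1 := hvar (fun i => u i • h)
      have h2 : ∑ i, Bm (c i) (u i • h) = 0 := by
        have : ∀ i, Bm (c i) (u i • h) = Bm (u i • c i) h := fun i => by
          rw [Bm_smul_right, Bm_smul_left]
        simp only [this]
        rw [← Bm_sum_left, hu', Bm_zero_left]
      have h3 : phi 4 (fun i => u i • h) = (∑ i, u i ^ 2) • Bm h h := by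
        simp only [phi, Bm_smul_left, Bm_smul_right, smul_smul, Finset.sum_smul, sq]
      rw [h2, h3] at h1
      have h4 := real_lemma2 (-2 * ⟪L, (∑ i, u i ^ 2) • Bm h h⟫_ℝ)
        (‖(∑ i, u i ^ 2) • Bm h h‖ ^ 2) (fun s => by
          have := h1 s
          simp only [smul_zero, inner_zero_right, inner_zero_left, norm_zero] at this
          linarith)
      rw [inner_smul_right] at h4
      nlinarith
    obtain ⟨e, rfl⟩ := hf
    have h5 : ⟪L, phi r e⟫_ℝ ≤ 0 := by
      rw [phi, inner_sum]
      exact Finset.sum_nonpos fun i _ => hsq _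
    have h6 : ⟪L, L⟫_ℝ ≤ 0 := by
      conv_lhs => rw [hL, inner_sub_right, ← hL, hphi]
      linarith
    rw [real_inner_self_eq_norm_sq] at h6
    exact hL0 (norm_eq_zero.1 (pow_eq_zero_iff two_ne_zero |>.1 (le_antisymm h6 (sq_nonneg _))))
  let Lf : R3 →ₗ[ℝ] ℝ := (innerₛₗ ℝ L) ∘ₗ ofP 6
  have hLf : ∀ g, Lf g = ⟪L, ofP 6 g⟫_ℝ := fun g => rfl
  obtain ⟨P, hP, hz⟩ := common_zero (fun i => toP 3 (c i)) (fun i => toP_hom _) hli Lf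
    (toP 6 L) (toP_hom L) (by
      rw [hLf, ofP_toP]
      exact inner_self_ne_zero.2 hL0) (by
      intro i q hq
      rw [hLf, ← toP_ofP hq]
      exact hone i (ofP 3 q))
  exact mem_ZS P hP hz

/-- The cone of sums of squares. -/
def SS : Set (E 6) := ⋃ r, XS r

lemma mem_SS {f : E 6} : f ∈ SS ↔ ∃ r, f ∈ XS r := Set.mem_iUnion

lemma XS_add {r s : ℕ} {f g : E 6} (hf : f ∈ XS r) (hg : g ∈ XS s) : f + g ∈ XS (r + s) := by
  obtain ⟨c, rfl⟩ := hf
  obtain ⟨e, rfl⟩ := hg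
  refine ⟨Fin.append c e, ?_⟩
  simp only [phi, Fin.sum_univ_add, Fin.append_left, Fin.append_right]

lemma XS_smul {r : ℕ} {f : E 6} (hf : f ∈ XS r) (s : ℝ) (hs : 0 ≤ s) : s • f ∈ XS r := by
  obtain ⟨c, rfl⟩ := hf
  refine ⟨Real.sqrt s • c, ?_⟩
  rw [phi_smul, Real.sq_sqrt hs]

lemma SS_convex : Convex ℝ SS := by
  intro f hf g hg a b ha hb _
  obtain ⟨r, hr⟩ := mem_SS.1 hf
  obtain ⟨s, hs⟩ := mem_SS.1 hg
  exact mem_SS.2 ⟨r + s, XS_add (XS_smul hr a ha) (XS_smul hs b hb)⟩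

lemma zero_mem_SS : (0 : E 6) ∈ SS := mem_SS.2 ⟨0, 0, by simp [phi]⟩

lemma sq_mem_SS (p : E 3) : Bm p p ∈ SS := mem_SS.2 ⟨1, fun _ => p, by simp [phi]⟩

lemma split_ex (t : Idx 6) : ∃ a b : Idx 3, ex a + ex b = ex t := by
  have h : ∀ t : Idx 6, ∃ a b : Idx 3, ∀ i, (a.1 i : ℕ) + b.1 i = t.1 i := by
    rintro ⟨t, ht⟩
    obtain ⟨x, hx, y, hy, z, hz, hsum⟩ : ∃ x ≤ (t 0 : ℕ), ∃ y ≤ (t 1 : ℕ), ∃ z ≤ (t 2 : ℕ),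
        x + y + z = 3 := by
      have ht' : (t 0 : ℕ) + t 1 + t 2 = 6 := ht
      generalize (t 0 : ℕ) = x at *
      generalize (t 1 : ℕ) = y at *
      generalize (t 2 : ℕ) = z at *
      exact ⟨min 3 x, by omega, min (3 - min 3 x) y, by omega,
        3 - min 3 x - min (3 - min 3 x) y, by omega, by omega⟩
    refine ⟨⟨![⟨x, by omega⟩, ⟨y, by omega⟩, ⟨z, by omega⟩], by simpa using hsum⟩,
      ⟨![⟨t 0 - x, by omega⟩, ⟨t 1 - y, by omega⟩, ⟨t 2 - z, by omega⟩], by simp; omega⟩, ?_⟩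
    intro i
    fin_cases i <;> simp <;> omega
  obtain ⟨a, b, hab⟩ := h t
  refine ⟨a, b, ?_⟩
  ext i
  exact hab i

lemma toP_single {d : ℕ} (t : Idx d) (s : ℝ) :
    toP d (EuclideanSpace.single t s) = monomial (ex t) s := by
  rw [toP_apply, Finset.sum_eq_single t]
  · simp
  · intro u _ hu
    simp [hu]
  · simp

lemma SS_span : Submodule.span ℝ SS = ⊤ := by
  rw [eq_top_iff]
  intro f _
  have hB : ∀ p q, Bm p q ∈ Submodule.span ℝ SS := by
    intro p q
    have : Bm p q = (1 / 2 : ℝ) • Bm (p + q) (p + q) - (1 / 2 : ℝ) • Bm p p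
        - (1 / 2 : ℝ) • Bm q q := by
      simp only [Bm_add_left, Bm_add_right]
      rw [Bm_comm q p]
      module
    rw [this]
    exact Submodule.sub_mem _ (Submodule.sub_mem _
      (Submodule.smul_mem _ _ (Submodule.subset_span (sq_mem_SS _)))
      (Submodule.smul_mem _ _ (Submodule.subset_span (sq_mem_SS _))))
      (Submodule.smul_mem _ _ (Submodule.subset_span (sq_mem_SS _)))
  have hf : f = ∑ t, EuclideanSpace.single t (f t) := by
    ext t
    simp
  rw [hf]
  refine Submodule.sum_mem _ fun t _ => ?_
  obtain ⟨a, b, hab⟩ := split_ex t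
  have : EuclideanSpace.single t (f t) =
      Bm (EuclideanSpace.single a (f t)) (EuclideanSpace.single b 1) := by
    apply toP_inj
    rw [toP_Bm, toP_single, toP_single, toP_single, monomial_mul, hab, mul_one]
  rw [this]
  exact hB _ _

lemma SS_interior : (interior SS).Nonempty := by
  rw [SS_convex.interior_nonempty_iff_affineSpan_eq_top]
  rw [AffineSubspace.affineSpan_eq_top_iff_vectorSpan_eq_top_of_nonempty ℝ (E 6) (E 6)
    ⟨0, zero_mem_SS⟩, eq_top_iff, ← SS_span, Submodule.span_le]
  intro f hf
  simpa using vsub_mem_vectorSpan ℝ hf zero_mem_SS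

lemma SS_sub_closure : SS ⊆ closure (interior SS) := by
  rw [SS_convex.closure_interior_eq_closure_of_nonempty_interior SS_interior]
  exact subset_closure

lemma finrank_E6 : Module.finrank ℝ (E 6) = 28 := by
  rw [finrank_euclideanSpace, card_idx6]

lemma finrank_E3 : Module.finrank ℝ (E 3) = 10 := by
  rw [finrank_euclideanSpace, card_idx3]

lemma finrank_E4 : Module.finrank ℝ (E 4) = 15 := by
  rw [finrank_euclideanSpace, card_idx4]

/-- Plane rotations. -/
lemma rotate (p q : E 3) (t : Idx 3) : ∃ p' q' : E 3, Bm p' p' + Bm q' q' = Bm p p + Bm q q ∧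
    q' t = 0 ∧ ∀ t', p t' = 0 → q t' = 0 → p' t' = 0 ∧ q' t' = 0 := by
  by_cases h0 : p t ^ 2 + q t ^ 2 = 0
  · have : q t = 0 := by nlinarith [sq_nonneg (p t), sq_nonneg (q t)]
    exact ⟨p, q, rfl, this, fun t' h1 h2 => ⟨h1, h2⟩⟩
  · have hpos : 0 < p t ^ 2 + q t ^ 2 := lt_of_le_of_ne (by positivity) (Ne.symm h0)
    set ρ := Real.sqrt (p t ^ 2 + q t ^ 2) with hρ
    have hρ2 : ρ ^ 2 = p t ^ 2 + q t ^ 2 := Real.sq_sqrt hpos.le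
    have hρ0 : ρ ≠ 0 := (Real.sqrt_pos.2 hpos).ne'
    set a := p t / ρ with ha
    set b := q t / ρ with hb
    have hab : a ^ 2 + b ^ 2 = 1 := by
      rw [ha, hb]; field_simp; rw [hρ2]
    refine ⟨a • p + b • q, (-b) • p + a • q, ?_, ?_, ?_⟩
    · simp only [Bm_add_left, Bm_add_right, Bm_smul_left, Bm_smul_right, Bm_comm q p]
      have : ∀ u v w : E 6, a • (a • u) + b • (a • v) + (a • (b • v) + b • (b • w)) +
          ((-b) • ((-b) • u) + a • ((-b) • v) + ((-b) • (a • v) + a • (a • w))) =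
          (a ^ 2 + b ^ 2) • u + (a ^ 2 + b ^ 2) • w := by
        intro u v w; module
      have h2 := this (Bm p p) (Bm p q) (Bm q q)
      rw [hab, one_smul, one_smul] at h2
      rw [← h2]
      module
    · simp only [PiLp.add_apply, PiLp.smul_apply, smul_eq_mul]
      rw [ha, hb]; ring
    · intro t' h1 h2
      simp [h1, h2]

/-- The linear conditions normalising three cubics. -/
def nrm (t1 t2 : Idx 3) : (Fin 3 → E 3) →ₗ[ℝ] (Fin 3 → ℝ) where
  toFun c := ![c 1 t1, c 2 t1, c 2 t2]
  map_add' c e := by ext i; fin_cases i <;> simp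
  map_smul' s c := by ext i; fin_cases i <;> simp

lemma nrm_surj (t1 t2 : Idx 3) (h : t1 ≠ t2) : Function.Surjective (nrm t1 t2) := by
  intro v
  refine ⟨![0, EuclideanSpace.single t1 (v 0),
    EuclideanSpace.single t1 (v 1) + EuclideanSpace.single t2 (v 2)], ?_⟩
  ext i
  fin_cases i <;> simp [nrm, h, h.symm]

lemma dense_compl_X3 : Dense (XS 3)ᶜ := by
  let t1 : Idx 3 := ⟨![3, 0, 0], by decide⟩
  let t2 : Idx 3 := ⟨![0, 3, 0], by decide⟩
  have h12 : t1 ≠ t2 := by decide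
  let K := LinearMap.ker (nrm t1 t2)
  have hK : Module.finrank ℝ K = 27 := by
    have h1 := (nrm t1 t2).finrank_range_add_finrank_ker
    rw [LinearMap.range_eq_top.2 (nrm_surj t1 t2 h12), finrank_top, Module.finrank_pi,
      Module.finrank_pi_fintype] at h1
    simp only [finrank_E3] at h1
    simp only [Fintype.card_fin, Finset.sum_const, Finset.card_univ, smul_eq_mul] at h1
    change 3 + Module.finrank ℝ K = _ at h1
    omega
  have hd : ContDiff ℝ 1 (fun c : K => phi 3 (c : Fin 3 → E 3)) :=
    (phi_contDiff 3).comp K.subtypeL.contDiff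
  have := hd.dense_compl_range_of_finrank_lt_finrank (by rw [hK, finrank_E6]; norm_num)
  refine this.mono (Set.compl_subset_compl.2 ?_)
  rintro _ ⟨c, rfl⟩
  obtain ⟨p0, p1, e1, z1, -⟩ := rotate (c 0) (c 1) t1
  obtain ⟨q0, p2, e2, z2, -⟩ := rotate p0 (c 2) t1
  obtain ⟨q1, q2, e3, z3, hz⟩ := rotate p1 p2 t2
  obtain ⟨z4, z5⟩ := hz t1 z1 z2
  refine ⟨⟨![q0, q1, q2], ?_⟩, ?_⟩
  · rw [LinearMap.mem_ker]
    ext i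
    fin_cases i <;> simp [nrm, z3, z4, z5]
  · simp only [phi, Fin.sum_univ_three]
    change Bm q0 q0 + Bm q1 q1 + Bm q2 q2 = _
    rw [← e1, add_right_comm (Bm p0 p0), ← e2, add_assoc, e3]
    abel

/-- The normal form of sums of squares of cubics vanishing at a nonreal point. -/
def wf (U V W : R3) (q : Fin 3 → ℝ) (r : Fin 4 → ℝ) (s : E 4) : R3 :=
  (U ^ 2 + V ^ 2) ^ 2 * (C (q 0) * U ^ 2 + C (q 1) * (U * V) + C (q 2) * V ^ 2) +
  W * (U ^ 2 + V ^ 2) * (C (r 0) * V ^ 3 + C (r 1) * (U * V ^ 2) + C (r 2) * (U ^ 2 * V)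
    + C (r 3) * U ^ 3) +
  W ^ 2 * ∑ t : Idx 4, C (s t) * (U ^ (t.1 0 : ℕ) * V ^ (t.1 1 : ℕ) * W ^ (t.1 2 : ℕ))

lemma wf_map (D : R3 →ₐ[ℝ] R3) (U V W : R3) (q : Fin 3 → ℝ) (r : Fin 4 → ℝ) (s : E 4) :
    D (wf U V W q r s) = wf (D U) (D V) (D W) q r s := by
  have hC : ∀ x : ℝ, D (C x) = C x := fun x => D.commutes x
  simp only [wf, map_add, map_mul, map_pow, map_sum, hC]

lemma toP_eq_sum (s : E 4) : toP 4 s =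
    ∑ t : Idx 4, C (s t) * (X 0 ^ (t.1 0 : ℕ) * X 1 ^ (t.1 1 : ℕ) * X 2 ^ (t.1 2 : ℕ)) := by
  rw [toP_apply]
  refine Finset.sum_congr rfl fun t _ => ?_
  rw [monomial_eq, Finsupp.prod_fintype _ _ (by simp), Fin.prod_univ_three]
  rfl

lemma th_three (w : Polynomial ℝ) : th 3 w = C (w.coeff 0) * X 1 ^ 3 +
    C (w.coeff 1) * (X 0 * X 1 ^ 2) + C (w.coeff 2) * (X 0 ^ 2 * X 1) + C (w.coeff 3) * X 0 ^ 3 := by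
  simp [th, Finset.sum_range_succ]
  try ring

lemma split_z (g : R3) (n : ℕ) (hg : g.IsHomogeneous n) :
    ∃ g', g = th n (ps g) + X 2 * g' ∧ g'.IsHomogeneous (n - 1) := by
  obtain ⟨g', h1, h2⟩ := zdiv n (g - th n (ps g)) (hg.sub (th_hom _ _))
    (by rw [map_sub, ps_th _ _ (ps_natDegree n g hg), sub_self])
  exact ⟨g', by rw [← h1]; ring, h2⟩

lemma vanish_form (p : R3) (hp : p.IsHomogeneous 3) (h : aeval ![Complex.I, 1, 0] p = 0) :
    ∃ (l m : R3) (b3 b2 : ℝ), l = C b3 * X 0 + C b2 * X 1 ∧ m.IsHomogeneous 2 ∧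
      p = (X 0 ^ 2 + X 1 ^ 2) * l + X 2 * m := by
  obtain ⟨m, h1, h2⟩ := split_z p 3 hp
  rw [← aeval_ps, Polynomial.aeval_eq_sum_range' (n := 4)
    (lt_of_le_of_lt (ps_natDegree 3 p hp) (by norm_num))] at h
  set w := ps p with hw
  have h3 : w.coeff 0 = w.coeff 2 ∧ w.coeff 1 = w.coeff 3 := by
    have hI3 : Complex.I ^ 3 = -Complex.I := by
      rw [pow_succ, Complex.I_sq]; ring
    simp only [Finset.sum_range_succ, Finset.sum_range_zero, pow_zero, pow_one, Complex.I_sq,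
      hI3] at h
    have hre := congrArg Complex.re h
    have him := congrArg Complex.im h
    simp at hre him
    constructor <;> linarith
  refine ⟨_, m, w.coeff 3, w.coeff 2, rfl, h2, ?_⟩
  rw [h1, th_three, h3.1, h3.2]
  ring

lemma sum_form {n : ℕ} (p : Fin n → R3) (hp : ∀ i, (p i).IsHomogeneous 3)
    (h : ∀ i, aeval ![Complex.I, 1, 0] (p i) = 0) :
    ∃ q r s, ∑ i, p i ^ 2 = wf (X 0) (X 1) (X 2) q r s := by
  choose l m b3 b2 hl hm hpe using fun i => vanish_form (p i) (hp i) (h i)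
  have hlh : ∀ i, (l i).IsHomogeneous 1 := by
    intro i
    rw [hl]
    exact (isHomogeneous_C_mul_X_aux _ _ (isHomogeneous_X _ _)).add
      (isHomogeneous_C_mul_X_aux _ _ (isHomogeneous_X _ _))
  have hG : (∑ i, C 2 * (l i * m i) : R3).IsHomogeneous 3 :=
    IsHomogeneous.sum _ _ _ fun i _ => isHomogeneous_C_mul_X_aux _ _ ((hlh i).mul (hm i))
  obtain ⟨G', hG1, hG2⟩ := split_z _ 3 hG
  set G := (∑ i, C 2 * (l i * m i) : R3) with hGdef
  have hS : ((X 0 ^ 2 + X 1 ^ 2) * G' + ∑ i, m i ^ 2 : R3).IsHomogeneous 4 := by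
    refine IsHomogeneous.add ?_ ?_
    · exact IsHomogeneous.mul (m := 2) (n := 2) (((isHomogeneous_X _ _).pow 2).add
        ((isHomogeneous_X _ _).pow 2)) hG2
    · exact IsHomogeneous.sum _ _ _ fun i _ => (hm i).pow 2
  refine ⟨![∑ i, b3 i ^ 2, ∑ i, 2 * (b3 i * b2 i), ∑ i, b2 i ^ 2],
    fun k => (ps G).coeff k, ofP 4 ((X 0 ^ 2 + X 1 ^ 2) * G' + ∑ i, m i ^ 2), ?_⟩
  unfold wf
  rw [← toP_eq_sum, toP_ofP hS]
  have e1 : ∑ i, p i ^ 2 = (X 0 ^ 2 + X 1 ^ 2) ^ 2 * ∑ i, l i ^ 2 + X 2 * (X 0 ^ 2 + X 1 ^ 2) * G +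
      X 2 ^ 2 * ∑ i, m i ^ 2 := by
    rw [hGdef, Finset.mul_sum, Finset.mul_sum, Finset.mul_sum, ← Finset.sum_add_distrib,
      ← Finset.sum_add_distrib]
    refine Finset.sum_congr rfl fun i _ => ?_
    rw [hpe i]
    have : (C 2 : R3) = 2 := map_ofNat C 2
    rw [this]
    ring
  have e2 : ∑ i, l i ^ 2 = C (∑ i, b3 i ^ 2) * X 0 ^ 2 + C (∑ i, 2 * (b3 i * b2 i)) * (X 0 * X 1)
      + C (∑ i, b2 i ^ 2) * X 1 ^ 2 := by
    rw [map_sum, map_sum, map_sum, Finset.sum_mul, Finset.sum_mul, Finset.sum_mul,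
      ← Finset.sum_add_distrib, ← Finset.sum_add_distrib]
    refine Finset.sum_congr rfl fun i _ => ?_
    rw [hl i]
    simp only [map_mul, map_pow]
    have : (C 2 : R3) = 2 := map_ofNat C 2
    rw [this]
    ring
  rw [e1, e2]
  conv_lhs => rw [hG1, th_three]
  simp
  ring

lemma aeval_comp_aeval (P : Fin 3 → ℂ) (S : Fin 3 → R3) (g : R3) :
    aeval P (aeval S g) = aeval (fun i => aeval P (S i)) g := by
  rw [← comp_aeval_apply]

lemma isHom_aeval (S : Fin 3 → R3) (hS : ∀ i, (S i).IsHomogeneous 1) (g : R3) (n : ℕ)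
    (hg : g.IsHomogeneous n) : (aeval S g).IsHomogeneous n := by
  have := hg.aeval S hS
  simpa using this

lemma transform1 {n : ℕ} (p : Fin n → R3) (hp : ∀ i, (p i).IsHomogeneous 3) (P : Fin 3 → ℂ)
    (hP1 : P 1 = 1) (hP0 : (P 0).im ≠ 0) (h : ∀ i, aeval P (p i) = 0) :
    ∃ (v : Fin 4 → ℝ) (q : Fin 3 → ℝ) (r : Fin 4 → ℝ) (s : E 4),
      ∑ i, p i ^ 2 = wf (C (v 0) * X 0 + C (v 1) * X 1) (X 1)
        (X 2 + C (v 2) * X 1 + C (v 3) * X 0) q r s := by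
  set a := (P 0).re with ha
  set b := (P 0).im with hb
  set δ := - (P 2).im / b with hδ
  set γ := - ((P 2).re + δ * a) with hγ
  let S : Fin 3 → R3 := ![C b * X 0 + C a * X 1, X 1,
    X 2 - C γ * X 1 - C δ * (C b * X 0 + C a * X 1)]
  have hX : ∀ i : Fin 3, (X i : R3).IsHomogeneous 1 := fun i => isHomogeneous_X _ _
  have hS0 : (C b * X 0 + C a * X 1 : R3).IsHomogeneous 1 :=
    (isHomogeneous_C_mul_X_aux _ _ (hX 0)).add (isHomogeneous_C_mul_X_aux _ _ (hX 1))
  have hS : ∀ i, (S i).IsHomogeneous 1 := by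
    intro i
    fin_cases i
    · exact hS0
    · exact hX 1
    · exact ((hX 2).sub (isHomogeneous_C_mul_X_aux _ _ (hX 1))).sub
        (isHomogeneous_C_mul_X_aux _ _ hS0)
  let T : Fin 3 → R3 := ![C b⁻¹ * X 0 + C (-(a / b)) * X 1, X 1,
    X 2 + C γ * X 1 + C δ * X 0]
  have hCb : (C b * C b⁻¹ : R3) = 1 := by
    rw [← C_mul, mul_inv_cancel₀ hP0, C_1]
  have hCa : (C b * C (-(a / b)) + C a : R3) = 0 := by
    rw [← C_mul, ← C_add, show b * -(a / b) + a = 0 by field_simp; ring, C_0]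
  have hTS : ∀ g, aeval T (aeval S g) = g := by
    intro g
    rw [comp_aeval_apply]
    conv_rhs => rw [← aeval_X_left_apply g]
    congr 2
    have hX0 : C b * (C b⁻¹ * X 0 + C (-(a / b)) * X 1) + C a * X 1 = (X 0 : R3) := by
      linear_combination (X 0 : R3) * hCb + (X 1 : R3) * hCa
    have hc : ∀ x : ℝ, (aeval T (C x) : R3) = C x := fun x => by simp [algebraMap_eq]
    funext i
    fin_cases i
    · simp only [S, T, Fin.zero_eta, Matrix.cons_val_zero, map_add, map_mul, hc, aeval_X,
        Matrix.cons_val_one]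
      exact hX0
    · simp [S, T]
    · simp only [S, T, Fin.reduceFinMk, Matrix.cons_val, map_add, map_mul, map_sub, hc, aeval_X]
      rw [hX0]
      ring
  have hv : ∀ i, aeval ![Complex.I, 1, 0] (aeval S (p i)) = 0 := by
    intro i
    rw [aeval_comp_aeval]
    refine Eq.trans ?_ (h i)
    congr 2
    have hP0e : (b : ℂ) * Complex.I + a = P 0 := by
      rw [add_comm, ha, hb, Complex.re_add_im]
    funext j
    fin_cases j
    · simp [S]
      exact hP0e
    · simp [S, hP1]
    · simp [S]
      rw [hP0e]
      apply Complex.ext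
      · simp [hγ, ← ha]
      · simp [hδ, ← hb]
        field_simp
  obtain ⟨q, r, s, hqs⟩ := sum_form (fun i => aeval S (p i))
    (fun i => isHom_aeval S hS _ 3 (hp i)) hv
  refine ⟨![b⁻¹, -(a / b), γ, δ], q, r, s, ?_⟩
  have h1 := congrArg (aeval T) hqs
  rw [wf_map, map_sum] at h1
  simp only [map_pow, hTS] at h1
  rw [h1]
  simp [T]

/-- The explicit family attached to a permutation of the variables. -/
def fam (σ : Equiv.Perm (Fin 3)) (v : Fin 4 → ℝ) (q : Fin 3 → ℝ) (r : Fin 4 → ℝ) (s : E 4) : R3 :=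
  wf (C (v 0) * X (σ 0) + C (v 1) * X (σ 1)) (X (σ 1))
    (X (σ 2) + C (v 2) * X (σ 1) + C (v 3) * X (σ 0)) q r s

lemma transform {n : ℕ} (p : Fin n → R3) (hp : ∀ i, (p i).IsHomogeneous 3) (P : Fin 3 → ℂ)
    (σ : Equiv.Perm (Fin 3))
    (hP1 : P (σ 1) = 1) (hP0 : (P (σ 0)).im ≠ 0) (h : ∀ i, aeval P (p i) = 0) :
    ∃ v q r s, ∑ i, p i ^ 2 = fam σ v q r s := by
  obtain ⟨v, q, r, s, h1⟩ := transform1 (fun i => rename σ.symm (p i))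
    (fun i => (hp i).rename_isHomogeneous) (P ∘ σ) hP1 hP0 (fun i => by
      rw [aeval_rename, ← h i]
      congr 2
      funext j; simp)
  refine ⟨v, q, r, s, ?_⟩
  have h2 := congrArg (rename σ) h1
  rw [wf_map, map_sum] at h2
  simp only [map_pow, rename_rename, map_add, map_mul, rename_C, rename_X] at h2
  simpa [fam] using h2

/-- The reference form. -/
def g0 : R3 := X 0 ^ 6 + X 1 ^ 6 + X 2 ^ 6

lemma g0_hom : g0.IsHomogeneous 6 :=
  ((isHomogeneous_X_pow _ _).add (isHomogeneous_X_pow _ _)).add (isHomogeneous_X_pow _ _)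

/-- The coefficient vector of the reference form. -/
def G0 : E 6 := ofP 6 g0

lemma toP_G0 : toP 6 G0 = g0 := toP_ofP g0_hom

lemma G0_mem : G0 ∈ XS 4 := by
  apply XS_mono (show 3 ≤ 4 by norm_num)
  rw [mem_XS_iff, toP_G0]
  refine ⟨fun i => X i ^ 3, fun i => isHomogeneous_X_pow _ _, ?_⟩
  rw [Fin.sum_univ_three, g0]
  ring

/-- Parameter space of the cone over the families. -/
abbrev Par : Type := (Fin 4 → ℝ) × (Fin 3 → ℝ) × (Fin 4 → ℝ) × E 4 × ℝ

/-- The cone over a family with vertex the reference form. -/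
def coneMap (σ : Equiv.Perm (Fin 3)) (x : Par) : E 6 :=
  ofP 6 (C (1 - x.2.2.2.2) * g0 + C x.2.2.2.2 * fam σ x.1 x.2.1 x.2.2.1 x.2.2.2.1)

lemma finrank_Par : Module.finrank ℝ Par = 27 := by
  simp only [Par, Module.finrank_prod, finrank_E4, Module.finrank_pi, Module.finrank_self,
    Fintype.card_fin]

lemma coneMap_contDiff (σ : Equiv.Perm (Fin 3)) : ContDiff ℝ 1 (coneMap σ) := by
  unfold coneMap
  apply CD.ofP
  have hv : ∀ i, CD (fun x : Par => (C (x.1 i) : R3)) := fun i => CD.C (by fun_prop)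
  have hq : ∀ i, CD (fun x : Par => (C (x.2.1 i) : R3)) := fun i => CD.C (by fun_prop)
  have hr : ∀ i, CD (fun x : Par => (C (x.2.2.1 i) : R3)) := fun i => CD.C (by fun_prop)
  have hs : ∀ t, CD (fun x : Par => (C (x.2.2.2.1 t) : R3)) := fun t => CD.C (by fun_prop)
  have ht : CD (fun x : Par => (C (x.2.2.2.2) : R3)) := CD.C (by fun_prop)
  have ht' : CD (fun x : Par => (C (1 - x.2.2.2.2) : R3)) := CD.C (by fun_prop)
  have hX : ∀ i, CD (fun _ : Par => (X i : R3)) := fun i => CD.const _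
  refine (ht'.mul (CD.const _)).add (ht.mul ?_)
  unfold fam wf
  have hU := ((hv 0).mul (hX (σ 0))).add ((hv 1).mul (hX (σ 1)))
  have hV := hX (σ 1)
  have hW := ((hX (σ 2)).add ((hv 2).mul (hX (σ 1)))).add ((hv 3).mul (hX (σ 0)))
  have hUV := (hU.pow 2).add (hV.pow 2)
  refine CD.add (CD.add (CD.mul (hUV.pow 2) ?_) (CD.mul (hW.mul hUV) ?_)) (CD.mul (hW.pow 2) ?_)
  · exact (((hq 0).mul (hU.pow 2)).add ((hq 1).mul (hU.mul hV))).add ((hq 2).mul (hV.pow 2))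
  · exact ((((hr 0).mul (hV.pow 3)).add ((hr 1).mul (hU.mul (hV.pow 2)))).add
      ((hr 2).mul ((hU.pow 2).mul hV))).add ((hr 3).mul (hU.pow 3))
  · exact CD.sum fun t _ => (hs t).mul (((hU.pow _).mul (hV.pow _)).mul (hW.pow _))

lemma dense_cones : Dense (⋃ σ, Set.range (coneMap σ))ᶜ := by
  apply dense_compl_of_dimH_lt_finrank
  rw [dimH_iUnion, finrank_E6]
  refine lt_of_le_of_lt (b := ((27 : ℕ) : ENNReal)) (iSup_le fun σ => ?_) (by norm_num)
  have := (coneMap_contDiff σ).dimH_range_le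
  rwa [finrank_Par] at this

lemma eval_nonneg {f : E 6} (hf : f ∈ SS) (v : Fin 3 → ℝ) : 0 ≤ eval v (toP 6 f) := by
  obtain ⟨r, c, rfl⟩ := mem_SS.1 hf
  rw [toP_phi, map_sum]
  exact Finset.sum_nonneg fun i _ => by rw [map_pow]; exact sq_nonneg _

lemma exists_perm : ∀ j k : Fin 3, k ≠ j → ∃ σ : Equiv.Perm (Fin 3), σ 1 = j ∧ σ 0 = k := by
  decide +kernel

lemma no_crossing (f0 : E 6) (hf0 : f0 ∈ SS) (hcone : ∀ σ, f0 ∉ Set.range (coneMap σ))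
    (s : ℝ) (hs0 : 0 ≤ s) (hs1 : s < 1) (c : Fin 4 → E 3) (hc : c ∈ ZS)
    (h : phi 4 c = (1 - s) • G0 + s • f0) : False := by
  obtain ⟨P, hP1, hP⟩ := hc
  have hPne : P ≠ 0 := by rintro rfl; simp at hP1
  have hpoly : ∑ i, toP 3 (c i) ^ 2 = (1 - s) • g0 + s • toP 6 f0 := by
    rw [← toP_phi, h, map_add, map_smul, map_smul, toP_G0]
  obtain ⟨j, hj⟩ : ∃ j, P j ≠ 0 := by
    by_contra hall
    push Not at hall
    exact hPne (funext hall)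
  rcases hs0.eq_or_lt with rfl | hspos
  · rw [sub_zero, one_smul, zero_smul, add_zero] at hpoly
    have h1 := congrArg (fun g => aeval P (pderiv j g)) hpoly
    simp only [map_sum, Derivation.leibniz_pow, map_smul, nsmul_eq_mul, map_mul, smul_eq_mul,
      map_pow, hP, zero_pow (two_ne_zero), zero_mul, mul_zero, map_natCast] at h1
    have h2 : aeval P (pderiv j g0) = 6 * P j ^ 5 := by
      fin_cases j <;> simp [g0, Derivation.leibniz_pow, pderiv_X]
    rw [h2] at h1
    simp at h1
    exact hj h1
  · set Q : Fin 3 → ℂ := (P j)⁻¹ • P with hQ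
    have hQz : ∀ i, aeval Q (toP 3 (c i)) = 0 := by
      intro i
      rw [hQ, aeval_smul_hom _ 3 (toP_hom _), hP, mul_zero]
    have hQj : Q j = 1 := by simp [hQ, hj]
    by_cases hreal : ∀ k, (Q k).im = 0
    · let v : Fin 3 → ℝ := fun k => (Q k).re
      have hQv : Q = fun k => ((v k : ℝ) : ℂ) := by
        funext k
        apply Complex.ext <;> simp [v, hreal]
      have hev : ∀ i, eval v (toP 3 (c i)) = 0 := by
        intro i
        have h1 := hQz i
        have h2 : aeval Q (toP 3 (c i)) = ((eval v (toP 3 (c i)) : ℝ) : ℂ) := by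
          rw [hQv]
          exact aeval_algebraMap_apply ℂ v _
        rw [h2] at h1
        exact_mod_cast h1
      have h3 := congrArg (eval v) hpoly
      simp only [map_sum, map_pow, hev, map_add, smul_eval] at h3
      simp only [zero_pow two_ne_zero, Finset.sum_const_zero] at h3
      have h4 := eval_nonneg hf0 v
      have h5 : 1 ≤ eval v g0 := by
        have hvj : v j = 1 := by simp [v, hQj]
        have e0 : 0 ≤ v 0 ^ 6 := by positivity
        have e1 : 0 ≤ v 1 ^ 6 := by positivity
        have e2 : 0 ≤ v 2 ^ 6 := by positivity
        simp only [g0, map_add, map_pow, eval_X]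
        have : v j ^ 6 ≤ v 0 ^ 6 + v 1 ^ 6 + v 2 ^ 6 := by
          fin_cases j <;> simp <;> linarith
        rw [hvj] at this
        linarith
      nlinarith
    · push Not at hreal
      obtain ⟨k, hk⟩ := hreal
      have hkj : k ≠ j := by
        rintro rfl
        rw [hQj] at hk
        simp at hk
      obtain ⟨σ, hσ1, hσ0⟩ := exists_perm j k hkj
      obtain ⟨v, q, r, t, ht⟩ := transform (fun i => toP 3 (c i)) (fun i => toP_hom _) Q σ
        (by rw [hσ1]; exact hQj) (by rw [hσ0]; exact hk) hQz
      apply hcone σ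
      refine ⟨(v, q, r, t, s⁻¹), ?_⟩
      apply toP_inj
      unfold coneMap
      have h6 : C (1 - s⁻¹) * g0 + C s⁻¹ * fam σ v q r t = toP 6 f0 := by
        rw [← ht, hpoly, ← smul_eq_C_mul, ← smul_eq_C_mul, smul_add, smul_smul, smul_smul,
          inv_mul_cancel₀ hspos.ne', one_smul, ← add_assoc, ← add_smul]
        rw [show 1 - s⁻¹ + s⁻¹ * (1 - s) = 0 by field_simp; ring, zero_smul, zero_add]
      change toP 6 (ofP 6 (C (1 - s⁻¹) * g0 + C s⁻¹ * fam σ v q r t)) = _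
      rw [h6, ofP_toP]

/-- Every sum of squares of ternary cubics is a sum of four squares. -/
theorem SS_eq : SS ⊆ XS 4 := by
  intro f hf
  by_contra hf4
  have hopen : IsOpen (interior SS ∩ (XS 4)ᶜ) := isOpen_interior.inter (XS_closed 4).isOpen_compl
  have hne : (interior SS ∩ (XS 4)ᶜ).Nonempty := by
    have h1 := SS_sub_closure hf
    rw [mem_closure_iff] at h1
    obtain ⟨x, hx1, hx2⟩ := h1 _ (XS_closed 4).isOpen_compl hf4
    exact ⟨x, hx2, hx1⟩
  obtain ⟨f0, ⟨hf0i, hf04⟩, hf0c⟩ := dense_cones.inter_open_nonempty _ hopen hne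
  have hf0 : f0 ∈ SS := interior_subset hf0i
  have hcone : ∀ σ, f0 ∉ Set.range (coneMap σ) := by
    intro σ hσ
    exact hf0c (Set.mem_iUnion.2 ⟨σ, hσ⟩)
  let γ : ℝ → E 6 := fun s => (1 - s) • G0 + s • f0
  have hγ : Continuous γ := by fun_prop
  let A : Set ℝ := Set.Icc 0 1 ∩ γ ⁻¹' (XS 4)
  have hA : IsCompact A := isCompact_Icc.inter_right ((XS_closed 4).preimage hγ)
  have hA0 : (0 : ℝ) ∈ A := by
    refine ⟨by simp, ?_⟩
    simp only [γ, Set.mem_preimage, sub_zero, one_smul, zero_smul, add_zero]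
    exact G0_mem
  have hsA := hA.sSup_mem ⟨0, hA0⟩
  set s := sSup A with hs
  have hs1 : s < 1 := by
    refine lt_of_le_of_ne hsA.1.2 ?_
    intro h1
    have := hsA.2
    rw [h1] at this
    apply hf04
    simpa [γ] using this
  have hclosed : IsClosed (phi 4 '' ZS) := phi_closedMap 4 _ ZS_closed
  have hmem : γ s ∈ phi 4 '' ZS := by
    rw [← hclosed.closure_eq, Metric.mem_closure_iff]
    intro ε hε
    have hnear : ∀ᶠ x in nhdsWithin s (Set.Ioi s), dist (γ x) (γ s) < ε / 2 ∧ x ≤ 1 ∧ s < x := by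
      have h1 : ∀ᶠ x in nhds s, dist (γ x) (γ s) < ε / 2 :=
        Metric.tendsto_nhds.1 hγ.continuousAt _ (by positivity)
      have h2 : ∀ᶠ x in nhds s, x ≤ 1 := (eventually_lt_nhds hs1).mono fun x hx => hx.le
      filter_upwards [h1.filter_mono nhdsWithin_le_nhds, h2.filter_mono nhdsWithin_le_nhds,
        self_mem_nhdsWithin] with x hx1 hx2 hx3
      exact ⟨hx1, hx2, hx3⟩
    obtain ⟨x, hx1, hx2, hx3⟩ := hnear.exists
    have hx0 : 0 ≤ x := hsA.1.1.trans hx3.le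
    have hxS : γ x ∈ SS :=
      SS_convex (mem_SS.2 ⟨4, G0_mem⟩) hf0 (by linarith) hx0 (by ring)
    have hx4 : γ x ∉ XS 4 := by
      intro h4
      have : x ≤ s := le_csSup hA.bddAbove ⟨⟨hx0, hx2⟩, h4⟩
      linarith
    obtain ⟨r, hr⟩ := mem_SS.1 hxS
    obtain ⟨c, hc, hd⟩ := nearest (γ x) hr hx4
    refine ⟨phi 4 c, ⟨c, hc, rfl⟩, ?_⟩
    have h5 : Metric.infDist (γ x) (XS 4) ≤ dist (γ x) (γ s) := Metric.infDist_le_dist_of_mem hsA.2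
    calc dist (γ s) (phi 4 c) ≤ dist (γ s) (γ x) + dist (γ x) (phi 4 c) := dist_triangle _ _ _
      _ < ε := by rw [dist_comm (γ s), hd]; linarith
  obtain ⟨c, hc, hce⟩ := hmem
  exact no_crossing f0 hf0 hcone s hsA.1.1 hs1 c hc hce

/-- Coordinates of a sextic form. -/
def crd (g : homogeneousSubmodule (Fin 3) ℝ 6) : E 6 := ofP 6 (g : R3)

/-- The sextic form with given coordinates. -/
def frm (c : E 6) : homogeneousSubmodule (Fin 3) ℝ 6 :=
  ⟨toP 6 c, (mem_homogeneousSubmodule 6 _).2 (toP_hom c)⟩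

lemma crd_frm (c : E 6) : crd (frm c) = c := ofP_toP c

lemma toP_crd (g : homogeneousSubmodule (Fin 3) ℝ 6) : toP 6 (crd g) = (g : R3) :=
  toP_ofP ((mem_homogeneousSubmodule 6 _).1 g.2)

lemma frm_crd (g : homogeneousSubmodule (Fin 3) ℝ 6) : frm (crd g) = g :=
  Subtype.ext (toP_crd g)

lemma continuous_crd : Continuous crd := by
  have h1 : Continuous (fun (f : R3) (m : Fin 3 →₀ ℕ) => coeff m f) := continuous_induced_dom
  have h2 : Continuous (fun g => (fun t => crd g t : Idx 6 → ℝ)) := by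
    refine continuous_pi fun t => ?_
    have : (fun g => crd g t) = fun g : homogeneousSubmodule (Fin 3) ℝ 6 =>
        (fun (f : R3) (m : Fin 3 →₀ ℕ) => coeff m f) (g : R3) (ex t) := by
      funext g
      exact ofP_apply _ _
    rw [this]
    exact (continuous_apply (ex t)).comp (h1.comp continuous_subtype_val)
  exact (PiLp.continuous_toLp 2 _).comp h2

lemma continuous_frm : Continuous frm := by
  refine Continuous.subtype_mk ?_ _
  refine continuous_induced_rng.2 (continuous_pi fun m => ?_)
  rcases coeff_toP_eq (d := 6) m with ⟨t, ht⟩ | h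
  · simp only [Function.comp_def, ht]
    fun_prop
  · simp only [Function.comp_def, h]
    fun_prop

lemma crd_mem_XS (g : homogeneousSubmodule (Fin 3) ℝ 6) (r : ℕ) :
    crd g ∈ XS r ↔ IsSOS 3 3 r (g : R3) := by
  rw [mem_XS_iff, toP_crd]

lemma crd_mem_SS (g : homogeneousSubmodule (Fin 3) ℝ 6) :
    crd g ∈ SS ↔ g ∈ SigmaSet36 := by
  rw [mem_SS]
  exact exists_congr fun r => crd_mem_XS g r

lemma length_eq_four_iff (g : SigmaSet36) :
    sosLength 3 3 ((g : homogeneousSubmodule (Fin 3) ℝ 6) : R3) = 4 ↔ crd g ∉ XS 3 := by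
  have h4 : IsSOS 3 3 4 ((g : homogeneousSubmodule (Fin 3) ℝ 6) : R3) :=
    (crd_mem_XS _ 4).1 (SS_eq ((crd_mem_SS _).2 g.2))
  have hmem := Nat.sInf_mem (s := {r | IsSOS 3 3 r ((g : homogeneousSubmodule (Fin 3) ℝ 6) : R3)})
    ⟨4, h4⟩
  have hle : sosLength 3 3 ((g : homogeneousSubmodule (Fin 3) ℝ 6) : R3) ≤ 4 := Nat.sInf_le h4
  constructor
  · intro h h3
    have : sosLength 3 3 ((g : homogeneousSubmodule (Fin 3) ℝ 6) : R3) ≤ 3 :=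
      Nat.sInf_le ((crd_mem_XS _ 3).1 h3)
    omega
  · intro h
    by_contra hne
    have hlt : sosLength 3 3 ((g : homogeneousSubmodule (Fin 3) ℝ 6) : R3) ≤ 3 := by omega
    exact h (XS_mono hlt ((crd_mem_XS _ _).2 hmem))

lemma length_set_eq :
    {g : SigmaSet36 | sosLength 3 3 ((g : homogeneousSubmodule (Fin 3) ℝ 6) : R3) = 4} =
      (fun g : SigmaSet36 => crd g) ⁻¹' (XS 3)ᶜ := by
  ext g
  exact length_eq_four_iff g

lemma main_open :
    IsOpen ((fun g : SigmaSet36 => crd g) ⁻¹' (XS 3)ᶜ) :=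
  (XS_closed 3).isOpen_compl.preimage (continuous_crd.comp continuous_subtype_val)

lemma main_dense :
    Dense ((fun g : SigmaSet36 => crd g) ⁻¹' (XS 3)ᶜ) := by
  rw [dense_iff_inter_open]
  rintro U hU ⟨g, hg⟩
  obtain ⟨V, hV, rfl⟩ := isOpen_induced_iff.1 hU
  have hW : IsOpen (frm ⁻¹' V) := hV.preimage continuous_frm
  have hgW : crd g ∈ frm ⁻¹' V := by
    change frm (crd g) ∈ V
    rw [frm_crd]
    exact hg
  have hcl := SS_sub_closure ((crd_mem_SS _).2 g.2)
  obtain ⟨c, hc⟩ := mem_closure_iff.1 hcl _ hW hgW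
  obtain ⟨e, ⟨he1, he2⟩, he3⟩ :=
    dense_iff_inter_open.1 dense_compl_X3 _ (hW.inter isOpen_interior) ⟨c, hc⟩
  have heS : frm e ∈ SigmaSet36 := by
    rw [← crd_mem_SS, crd_frm]
    exact interior_subset he2
  refine ⟨⟨frm e, heS⟩, he1, ?_⟩
  change crd (frm e) ∈ (XS 3)ᶜ
  rw [crd_frm]
  exact he3

end SexticAux

/-- The set of sums of squares of ternary sextics of sos length exactly `4` is
open and dense in `Σ_{3,6}` (with the subspace topology from `ℝ[x₁,x₂,x₃]₆`). -/
theorem length_four_open_dense_in_sigma36 :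
    IsOpen {g : SigmaSet36 | sosLength 3 3 ((g : MvPolynomial.homogeneousSubmodule (Fin 3) ℝ 6) : MvPolynomial (Fin 3) ℝ) = 4} ∧
    Dense {g : SigmaSet36 | sosLength 3 3 ((g : MvPolynomial.homogeneousSubmodule (Fin 3) ℝ 6) : MvPolynomial (Fin 3) ℝ) = 4} := by
  have h := SexticAux.length_set_eq
  exact ⟨h ▸ SexticAux.main_open, h ▸ SexticAux.main_dense⟩
end
end
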